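/- Let d ≥ 3 and p_d = d/(d−1). Suppose E ⊆ (0,∞) satisfies the regularity hypothesis (R̃_{p_d}) and that there is a constant C with N(E^k, 2^k δ) ≤ C δ^{−1} (log(1/δ))^{−1/(d−1)} (log log(1/δ))^{−1} for all k ∈ ℤ and all 0 < δ ≤ e^{−2}. Then M_E is of weak type (p_d, p_d): there is a constant C' such that meas({x : M_E f(x) > α}) ≤ C' α^{−p_d} ‖f‖_{L^{p_d}}^{p_d} for all continuous compactly supported f and all α > 0. -/

import Mathlib

open MeasureTheory Metric Set Filter
open scoped ENNReal NNReal Topology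

noncomputable section

abbrev Ed (d : ℕ) := EuclideanSpace ℝ (Fin d)

/-- The rotation-invariant probability measure on the unit sphere. -/
def sphereProb (d : ℕ) : Measure (sphere (0 : Ed d) 1) :=
  ((volume : Measure (Ed d)).toSphere Set.univ)⁻¹ • (volume : Measure (Ed d)).toSphere

/-- Spherical mean `A_t f`. -/
def sphMean (d : ℕ) (t : ℝ) (f : Ed d → ℂ) (x : Ed d) : ℂ :=
  ∫ y : sphere (0 : Ed d) 1, f (x - t • (y : Ed d)) ∂(sphereProb d)

/-- Spherical maximal function, with values in `ℝ≥0∞`. -/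
def maxFn (d : ℕ) (E : Set ℝ) (f : Ed d → ℂ) (x : Ed d) : ℝ≥0∞ :=
  ⨆ t ∈ E, (‖sphMean d t f x‖₊ : ℝ≥0∞)

/-- `N(S,δ)`: minimal number of intervals of length `δ` needed to cover `S`
(with the value `1` for the empty set). -/
def covN (S : Set ℝ) (δ : ℝ) : ℕ :=
  max 1 (sInf {n : ℕ | ∃ c : Fin n → ℝ, S ⊆ ⋃ i, Set.Icc (c i) (c i + δ)})

def Ek (E : Set ℝ) (k : ℤ) : Set ℝ := E ∩ Set.Ico ((2:ℝ)^k) ((2:ℝ)^(k+1))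

/-- weak type (p,p) for the spherical maximal operator. -/
def WeakTypePP (d : ℕ) (E : Set ℝ) (p : ℝ) : Prop :=
  ∃ C : ℝ, ∀ f : Ed d → ℂ, Continuous f → HasCompactSupport f → ∀ a : ℝ, 0 < a →
    volume {x | ENNReal.ofReal a < maxFn d E f x} ≤
      ENNReal.ofReal (C * a ^ (-p) * ∫ x, ‖f x‖ ^ p)

/-- `J` is equally spaced with width `δ` and possible deviation `C`. -/
def EquallySpaced (J : Set ℝ) (δ C : ℝ) : Prop :=
  ∀ t ∈ J, C⁻¹ * δ ≤ infDist t (J \ {t}) ∧ infDist t (J \ {t}) ≤ C * δ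

/-- The set of endpoints `𝒟^k` of a family of sets. -/
def Dk (𝒥 : ℤ → Set (Set ℝ)) (k : ℤ) : Set ℝ := ⋃ J ∈ 𝒥 k, {sInf J, sSup J}

/-- `𝒥^k_μ`: the members of `𝒥^k` which are equally spaced with width `2^{k-μ}`
and possible deviation `C`. -/
def Jmu (𝒥 : ℤ → Set (Set ℝ)) (C : ℝ) (k : ℤ) (μ : ℕ) : Set (Set ℝ) :=
  {J ∈ 𝒥 k | EquallySpaced J ((2:ℝ) ^ (k - (μ:ℤ))) C}

/-- Conditions (a) and (b) of the regularity hypotheses `(R_p)` and `(R̃_p)`. -/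
def RegFamilyCore (E : Set ℝ) (d : ℕ) (p : ℝ) (𝒥 : ℤ → Set (Set ℝ)) (C : ℝ) : Prop :=
  1 < C ∧
  (∀ k : ℤ, ∀ J ∈ 𝒥 k, J ⊆ Set.Icc ((2:ℝ)^k) ((2:ℝ)^(k+1))) ∧
  (∀ k : ℤ, Ek E k ⊆ ⋃ J ∈ 𝒥 k, J) ∧
  (∀ k : ℤ, ∀ J ∈ 𝒥 k, ∃ δ : ℝ, 0 < δ ∧ EquallySpaced J δ C) ∧
  (∃ ω : ℕ → ℝ, (∀ j, 0 < ω j) ∧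
    (∑' j : ℕ, ENNReal.ofReal ((ω j) ^ (-(p / (p - 1))))) ≤ 1 ∧
    ∃ C0 : ℝ, ∀ k : ℤ,
      (∑' j : ℕ, ENNReal.ofReal ((ω j) ^ p) * (covN (Dk 𝒥 (k + j)) ((2:ℝ) ^ k) : ℝ≥0∞) *
          ENNReal.ofReal ((2:ℝ) ^ (-(j:ℝ) * ((d:ℝ) - 1) * (p - 1)))) ≤ ENNReal.ofReal C0)

/-- Condition (c) of the regularity hypothesis `(R_p)`. -/
def CardCond (E : Set ℝ) (𝒥 : ℤ → Set (Set ℝ)) (C : ℝ) : Prop :=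
  ∃ C1 : ℝ, 1 < C1 ∧ ∀ k : ℤ, ∀ μ : ℕ,
    (∑' J : (Jmu 𝒥 C k μ), ((J : Set ℝ).ncard : ℝ≥0∞)) ≤
      ENNReal.ofReal C1 * (covN (Ek E k) ((2:ℝ) ^ (k - (μ:ℤ))) : ℝ≥0∞)

/-- Condition (c̃) of the regularity hypothesis `(R̃_{p_d})`. -/
def CardCondTilde (E : Set ℝ) (𝒥 : ℤ → Set (Set ℝ)) (C : ℝ) : Prop :=
  ∃ C1 : ℝ, 1 < C1 ∧ ∀ k : ℤ, ∀ n : ℕ,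
    (∑' μ : {μ : ℕ // n ≤ μ},
        ENNReal.ofReal ((2:ℝ) ^ (-(μ.1:ℝ))) *
          ∑' J : (Jmu 𝒥 C k μ.1), ((J : Set ℝ).ncard : ℝ≥0∞)) ≤
      ENNReal.ofReal (C1 * (2:ℝ) ^ (-(n:ℝ))) * (covN (Ek E k) ((2:ℝ) ^ (k - (n:ℤ))) : ℝ≥0∞)

/-- The regularity hypothesis `(R_p)`. -/
def RegHyp (E : Set ℝ) (d : ℕ) (p : ℝ) : Prop :=
  ∃ (𝒥 : ℤ → Set (Set ℝ)) (C : ℝ), RegFamilyCore E d p 𝒥 C ∧ CardCond E 𝒥 C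

/-- The regularity hypothesis `(R̃_{p_d})`. -/
def RegHypTilde (E : Set ℝ) (d : ℕ) (p : ℝ) : Prop :=
  ∃ (𝒥 : ℤ → Set (Set ℝ)) (C : ℝ), RegFamilyCore E d p 𝒥 C ∧ CardCondTilde E 𝒥 C

set_option linter.unusedSectionVars false

namespace SphMax

section

open FourierTransform SchwartzMap

theorem lintegral_enorm_sq_fourier {d : ℕ} {G : Ed d → ℂ} (h1 : Integrable G)
    (h2 : MemLp G 2) : ∫⁻ x, ‖𝓕 G x‖ₑ ^ 2 = ∫⁻ x, ‖G x‖ₑ ^ 2 := by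
  have hcont : Continuous (𝓕 G) :=
    VectorFourier.fourierIntegral_continuous Real.continuous_fourierChar
      (by exact continuous_inner) h1
  have key : (𝓕 (h2.toLp G) : Lp ℂ 2 (volume : Measure (Ed d))) =ᵐ[volume] 𝓕 G := by
    apply ae_eq_of_integral_contDiff_smul_eq
    · exact (Lp.memLp _).locallyIntegrable (by norm_num)
    · exact hcont.locallyIntegrable
    · intro φ hφ hφc
      let ψ : 𝓢(Ed d, ℂ) := HasCompactSupport.toSchwartzMap (f := fun x => (φ x : ℂ))
        (hφc.comp_left (g := fun r : ℝ => (r : ℂ)) (by simp))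
        (Complex.ofRealCLM.contDiff.comp hφ)
      have e1 := congrArg (fun T : TemperedDistribution (Ed d) ℂ => T ψ)
        (Lp.fourier_toTemperedDistribution_eq (h2.toLp G))
      simp only [TemperedDistribution.fourier_apply, Lp.toTemperedDistribution_apply] at e1
      have e2 : ∫ x, φ x • (𝓕 (h2.toLp G) : Lp ℂ 2 (volume : Measure (Ed d))) x
          = ∫ x, ψ x • (𝓕 (h2.toLp G) : Lp ℂ 2 (volume : Measure (Ed d))) x := by
        congr 1
      have e3 : ∫ x, φ x • 𝓕 G x = ∫ x, ψ x • 𝓕 G x := by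
        congr 1
      rw [e2, e3, ← e1]
      have e4 : ∫ x, (𝓕 ψ) x • (h2.toLp G) x = ∫ x, (𝓕 ψ) x • G x := by
        apply integral_congr_ae
        filter_upwards [h2.coeFn_toLp] with x hx
        rw [hx]
      rw [e4]
      have := VectorFourier.integral_fourierIntegral_smul_eq_flip (L := innerₗ (Ed d))
        (μ := volume) (ν := volume) Real.continuous_fourierChar continuous_inner
        (f := fun x => ψ x) (g := G) ψ.integrable h1
      simpa [SchwartzMap.fourier_coe] using! this
  have e := Lp.norm_fourier_eq (h2.toLp G)
  have e5 : eLpNorm (𝓕 G) 2 volume = eLpNorm G 2 volume := by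
    rw [Lp.norm_def, Lp.norm_def, eLpNorm_congr_ae key, eLpNorm_congr_ae h2.coeFn_toLp] at e
    refine (ENNReal.toReal_eq_toReal_iff' ?_ h2.2.ne).1 e
    rw [← eLpNorm_congr_ae key]
    exact (Lp.memLp _).2.ne
  simp only [eLpNorm_eq_lintegral_rpow_enorm_toReal two_ne_zero ENNReal.ofNat_ne_top] at e5
  simpa using ENNReal.rpow_left_injective (by norm_num) e5

theorem lintegral_enorm_sq_fourierInv {d : ℕ} {G : Ed d → ℂ} (h1 : Integrable G)
    (h2 : MemLp G 2) : ∫⁻ x, ‖𝓕⁻ G x‖ₑ ^ 2 = ∫⁻ x, ‖G x‖ₑ ^ 2 := by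
  rw [← lintegral_enorm_sq_fourier h1 h2,
    ← lintegral_neg_eq_self (fun x => ‖𝓕 G x‖ₑ ^ 2)]
  simp only [Real.fourierInv_eq_fourier_neg]

end

section

variable {d : ℕ}

/-- The heat kernel on `ℝ^d` at time `τ`. -/
def gk (d : ℕ) (τ : ℝ) (x : Ed d) : ℝ :=
  (4 * Real.pi * τ) ^ (-(d : ℝ) / 2) * Real.exp (-(‖x‖ ^ 2 / (4 * τ)))

theorem gk_pos {τ : ℝ} (hτ : 0 < τ) (x : Ed d) : 0 < gk d τ x := by
  unfold gk; positivity

theorem gk_nonneg {τ : ℝ} (hτ : 0 < τ) (x : Ed d) : 0 ≤ gk d τ x := (gk_pos hτ x).le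

@[fun_prop]
theorem continuous_gk {τ : ℝ} : Continuous (gk d τ) := by
  unfold gk; fun_prop

theorem gk_le_const {τ : ℝ} (hτ : 0 < τ) (x : Ed d) :
    gk d τ x ≤ (4 * Real.pi * τ) ^ (-(d : ℝ) / 2) := by
  unfold gk
  refine mul_le_of_le_one_right (by positivity) ?_
  rw [Real.exp_le_one_iff]
  have : 0 ≤ ‖x‖ ^ 2 / (4 * τ) := by positivity
  linarith

theorem integral_gk {τ : ℝ} (hτ : 0 < τ) : ∫ x, gk d τ x = 1 := by
  unfold gk
  rw [integral_const_mul]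
  have h := GaussianFourier.integral_rexp_neg_mul_sq_norm (V := Ed d) (b := 1 / (4 * τ))
    (by positivity)
  have h2 : ∀ x : Ed d, Real.exp (-(‖x‖ ^ 2 / (4 * τ))) = Real.exp (-(1 / (4 * τ)) * ‖x‖ ^ 2) := by
    intro x; congr 1; ring
  simp_rw [h2]
  have h3 : Real.pi / (1 / (4 * τ)) = 4 * Real.pi * τ := by field_simp
  rw [h, finrank_euclideanSpace_fin, h3, ← Real.rpow_add (by positivity)]
  ring_nf
  simp

theorem integrable_gk {τ : ℝ} (hτ : 0 < τ) : Integrable (gk d τ) := by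
  by_contra h
  have := integral_gk (d := d) hτ
  rw [integral_undef h] at this
  exact zero_ne_one this

theorem lintegral_gk {τ : ℝ} (hτ : 0 < τ) : ∫⁻ x, ENNReal.ofReal (gk d τ x) = 1 := by
  rw [← ofReal_integral_eq_lintegral_ofReal (integrable_gk hτ)
    (Eventually.of_forall fun x => gk_nonneg hτ x), integral_gk hτ, ENNReal.ofReal_one]

theorem gk_mul_gk {a b : ℝ} (ha : 0 < a) (hb : 0 < b) (x y : Ed d) :
    gk d a (x - y) * gk d b y =
      gk d (a + b) x * gk d (a * b / (a + b)) (y - (b / (a + b)) • x) := by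
  have hab : 0 < a + b := by positivity
  unfold gk
  have h1 : (4 * Real.pi * a) ^ (-(d : ℝ) / 2) * (4 * Real.pi * b) ^ (-(d : ℝ) / 2) =
      (4 * Real.pi * (a + b)) ^ (-(d : ℝ) / 2) *
        (4 * Real.pi * (a * b / (a + b))) ^ (-(d : ℝ) / 2) := by
    rw [← Real.mul_rpow (by positivity) (by positivity),
      ← Real.mul_rpow (by positivity) (by positivity)]
    congr 1
    field_simp
  have h2 : -(‖x - y‖ ^ 2 / (4 * a)) + -(‖y‖ ^ 2 / (4 * b)) = -(‖x‖ ^ 2 / (4 * (a + b))) +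
      -(‖y - (b / (a + b)) • x‖ ^ 2 / (4 * (a * b / (a + b)))) := by
    rw [norm_sub_sq_real, norm_sub_sq_real, norm_smul, inner_smul_right, real_inner_comm x y,
      mul_pow, Real.norm_eq_abs, sq_abs]
    field_simp
    ring
  calc _ = ((4 * Real.pi * a) ^ (-(d : ℝ) / 2) * (4 * Real.pi * b) ^ (-(d : ℝ) / 2)) *
        Real.exp (-(‖x - y‖ ^ 2 / (4 * a)) + -(‖y‖ ^ 2 / (4 * b))) := by
        rw [Real.exp_add]; ring
    _ = _ := by rw [h1, h2, Real.exp_add]; ring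

theorem lintegral_gk_mul_gk {a b : ℝ} (ha : 0 < a) (hb : 0 < b) (x z : Ed d) :
    ∫⁻ y, ENNReal.ofReal (gk d a (x - y)) * ENNReal.ofReal (gk d b (y - z)) =
      ENNReal.ofReal (gk d (a + b) (x - z)) := by
  have hab : 0 < a * b / (a + b) := by positivity
  calc _ = ∫⁻ y, ENNReal.ofReal (gk d a ((x - z) - y)) * ENNReal.ofReal (gk d b y) := by
        rw [← lintegral_sub_right_eq_self (fun y =>
          ENNReal.ofReal (gk d a ((x - z) - y)) * ENNReal.ofReal (gk d b y)) z]
        simp only [sub_sub_sub_cancel_right]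
    _ = ∫⁻ y, ENNReal.ofReal (gk d (a + b) (x - z)) *
          ENNReal.ofReal (gk d (a * b / (a + b)) (y - (b / (a + b)) • (x - z))) := by
        congr 1; ext y
        rw [← ENNReal.ofReal_mul (gk_nonneg ha _), gk_mul_gk ha hb,
          ENNReal.ofReal_mul (gk_nonneg (by positivity) _)]
    _ = _ := by
        rw [lintegral_const_mul _ (by fun_prop), lintegral_sub_right_eq_self (fun y =>
          ENNReal.ofReal (gk d (a * b / (a + b)) y)), lintegral_gk hab, mul_one]

theorem gk_le_mul_gk {a b c : ℝ} (ha : 0 < a) (hb : 0 < b) {x x' : Ed d}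
    (h : ‖x'‖ ^ 2 / (4 * b) ≤ ‖x‖ ^ 2 / (4 * a) + c) :
    gk d a x ≤ (b / a) ^ ((d : ℝ) / 2) * Real.exp c * gk d b x' := by
  unfold gk
  have h1 : (b / a) ^ ((d : ℝ) / 2) * (4 * Real.pi * b) ^ (-(d : ℝ) / 2) =
      (4 * Real.pi * a) ^ (-(d : ℝ) / 2) := by
    rw [neg_div, Real.rpow_neg (by positivity), Real.rpow_neg (by positivity),
      ← div_eq_mul_inv, ← Real.div_rpow (by positivity) (by positivity),
      ← Real.inv_rpow (by positivity)]
    congr 1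
    field_simp
  calc _ ≤ (4 * Real.pi * a) ^ (-(d : ℝ) / 2) *
        Real.exp (c + -(‖x'‖ ^ 2 / (4 * b))) := by
        gcongr; linarith
    _ = _ := by rw [← h1, Real.exp_add]; ring

end

section

variable {d : ℕ}

/-- The heat semigroup acting on nonnegative functions. -/
def Hl (τ : ℝ) (v : Ed d → ℝ≥0∞) (x : Ed d) : ℝ≥0∞ :=
  ∫⁻ z, ENNReal.ofReal (gk d τ (x - z)) * v z

/-- Spherical mean of the heat extension of a nonnegative function. -/
def AH (t τ : ℝ) (v : Ed d → ℝ≥0∞) (x : Ed d) : ℝ≥0∞ :=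
  ∫⁻ y : sphere (0 : Ed d) 1, Hl τ v (x - t • (y : Ed d)) ∂(sphereProb d)

instance [h : Fact (3 ≤ d)] : NeZero d := ⟨by have := h.out; omega⟩

instance [h : Fact (3 ≤ d)] : Nontrivial (Ed d) := by
  have : Nonempty (Fin d) := ⟨⟨0, by have := h.out; omega⟩⟩
  exact inferInstanceAs (Nontrivial (EuclideanSpace ℝ (Fin d)))

instance [Fact (3 ≤ d)] : IsProbabilityMeasure (sphereProb d) := by
  refine ⟨?_⟩
  unfold sphereProb
  rw [Measure.smul_apply, smul_eq_mul]
  refine ENNReal.inv_mul_cancel ?_ (measure_ne_top _ _)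
  rw [Ne, Measure.measure_univ_eq_zero]
  exact Measure.toSphere_ne_zero _

theorem measurable_Hl {τ : ℝ} {v : Ed d → ℝ≥0∞} (hv : Measurable v) : Measurable (Hl τ v) := by
  unfold Hl
  apply Measurable.lintegral_prod_right'
    (f := fun p : Ed d × Ed d => ENNReal.ofReal (gk d τ (p.1 - p.2)) * v p.2)
  have : Measurable fun p : Ed d × Ed d => gk d τ (p.1 - p.2) :=
    (continuous_gk.comp (by fun_prop)).measurable
  fun_prop

theorem Hl_mono {τ : ℝ} {v w : Ed d → ℝ≥0∞} (h : ∀ z, v z ≤ w z) (x : Ed d) :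
    Hl τ v x ≤ Hl τ w x :=
  lintegral_mono fun z => by gcongr; exact h z

theorem Hl_const_mul {τ : ℝ} (c : ℝ≥0∞) {v : Ed d → ℝ≥0∞} (hv : Measurable v) (x : Ed d) :
    Hl τ (fun z => c * v z) x = c * Hl τ v x := by
  unfold Hl
  rw [← lintegral_const_mul _ (by fun_prop)]
  congr 1; ext z; ring

theorem Hl_add {τ : ℝ} {v w : Ed d → ℝ≥0∞} (hv : Measurable v) (x : Ed d) :
    Hl τ (fun z => v z + w z) x = Hl τ v x + Hl τ w x := by
  unfold Hl
  rw [← lintegral_add_left (by fun_prop)]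
  congr 1; ext z; ring

theorem Hl_const {τ : ℝ} (hτ : 0 < τ) (c : ℝ≥0∞) (x : Ed d) : Hl τ (fun _ => c) x = c := by
  unfold Hl
  rw [lintegral_mul_const _ (by fun_prop),
    lintegral_sub_left_eq_self (fun z => ENNReal.ofReal (gk d τ z)), lintegral_gk hτ, one_mul]

theorem Hl_le_const {τ : ℝ} (hτ : 0 < τ) {c : ℝ≥0∞} {v : Ed d → ℝ≥0∞} (h : ∀ z, v z ≤ c)
    (x : Ed d) : Hl τ v x ≤ c :=
  (Hl_mono h x).trans (Hl_const hτ c x).le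

theorem lintegral_Hl {τ : ℝ} (hτ : 0 < τ) {v : Ed d → ℝ≥0∞} (hv : Measurable v) :
    ∫⁻ x, Hl τ v x = ∫⁻ x, v x := by
  unfold Hl
  have hm : Measurable fun p : Ed d × Ed d => gk d τ (p.1 - p.2) :=
    (continuous_gk.comp (by fun_prop)).measurable
  rw [lintegral_lintegral_swap (by fun_prop)]
  congr 1; ext z
  rw [lintegral_mul_const _ (by fun_prop),
    lintegral_sub_right_eq_self (fun x => ENNReal.ofReal (gk d τ x)), lintegral_gk hτ, one_mul]

theorem Hl_Hl {a b : ℝ} (ha : 0 < a) (hb : 0 < b) {v : Ed d → ℝ≥0∞} (hv : Measurable v)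
    (x : Ed d) : Hl a (Hl b v) x = Hl (a + b) v x := by
  unfold Hl
  have hm : Measurable fun p : Ed d × Ed d => gk d b (p.1 - p.2) :=
    (continuous_gk.comp (by fun_prop)).measurable
  calc _ = ∫⁻ y, ∫⁻ z, ENNReal.ofReal (gk d a (x - y)) *
          (ENNReal.ofReal (gk d b (y - z)) * v z) := by
        congr 1; ext y; rw [lintegral_const_mul _ (by fun_prop)]
    _ = ∫⁻ z, ∫⁻ y, ENNReal.ofReal (gk d a (x - y)) *
          (ENNReal.ofReal (gk d b (y - z)) * v z) := by
        apply lintegral_lintegral_swap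
        have hm2 : Measurable fun p : Ed d × Ed d => gk d a (x - p.1) :=
          (continuous_gk.comp (by fun_prop)).measurable
        fun_prop
    _ = _ := by
        congr 1; ext z
        rw [← lintegral_gk_mul_gk ha hb, ← lintegral_mul_const _ (by fun_prop)]
        congr 1; ext y; ring

/-- Comparison of heat averages at two times and two points, tested on the support of `v`. -/
theorem Hl_le_mul_Hl {a b c : ℝ} (ha : 0 < a) (hb : 0 < b) {v : Ed d → ℝ≥0∞} {x x' : Ed d}
    (hv : Measurable v)
    (h : ∀ z, v z ≠ 0 → ‖x' - z‖ ^ 2 / (4 * b) ≤ ‖x - z‖ ^ 2 / (4 * a) + c) :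
    Hl a v x ≤ ENNReal.ofReal ((b / a) ^ ((d : ℝ) / 2) * Real.exp c) * Hl b v x' := by
  unfold Hl
  rw [← lintegral_const_mul _ (by fun_prop)]
  refine lintegral_mono fun z => ?_
  by_cases hz : v z = 0
  · simp [hz]
  · rw [← mul_assoc, ← ENNReal.ofReal_mul (by positivity)]
    gcongr
    exact gk_le_mul_gk ha hb (h z hz)

section
variable [Fact (3 ≤ d)]

theorem measurable_AH {t τ : ℝ} {v : Ed d → ℝ≥0∞} (hv : Measurable v) :
    Measurable (AH t τ v) := by
  unfold AH
  apply Measurable.lintegral_prod_right'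
    (f := fun p : Ed d × sphere (0 : Ed d) 1 => Hl τ v (p.1 - t • (p.2 : Ed d)))
  exact (measurable_Hl hv).comp (by fun_prop)

theorem measurable_Hl_sub {t τ : ℝ} {v : Ed d → ℝ≥0∞} (hv : Measurable v) (x : Ed d) :
    Measurable fun y : sphere (0 : Ed d) 1 => Hl τ v (x - t • (y : Ed d)) :=
  (measurable_Hl hv).comp (by fun_prop)

theorem AH_mono {t τ : ℝ} {v w : Ed d → ℝ≥0∞} (h : ∀ z, v z ≤ w z) (x : Ed d) :
    AH t τ v x ≤ AH t τ w x :=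
  lintegral_mono fun _ => Hl_mono h _

theorem AH_const_mul {t τ : ℝ} (c : ℝ≥0∞) {v : Ed d → ℝ≥0∞} (hv : Measurable v) (x : Ed d) :
    AH t τ (fun z => c * v z) x = c * AH t τ v x := by
  unfold AH
  rw [← lintegral_const_mul _ (measurable_Hl_sub hv x)]
  congr 1; ext z; rw [Hl_const_mul c hv]

theorem AH_add {t τ : ℝ} {v w : Ed d → ℝ≥0∞} (hv : Measurable v) (x : Ed d) :
    AH t τ (fun z => v z + w z) x = AH t τ v x + AH t τ w x := by
  unfold AH
  rw [← lintegral_add_left (measurable_Hl_sub hv x)]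
  congr 1; ext z; rw [Hl_add hv]

theorem AH_le_const {t τ : ℝ} (hτ : 0 < τ) {c : ℝ≥0∞} {v : Ed d → ℝ≥0∞} (h : ∀ z, v z ≤ c)
    (x : Ed d) : AH t τ v x ≤ c := by
  unfold AH
  calc _ ≤ ∫⁻ _ : sphere (0 : Ed d) 1, c ∂(sphereProb d) :=
        lintegral_mono fun _ => Hl_le_const hτ h _
    _ = c := by simp

theorem lintegral_AH {t τ : ℝ} (hτ : 0 < τ) {v : Ed d → ℝ≥0∞} (hv : Measurable v) :
    ∫⁻ x, AH t τ v x = ∫⁻ x, v x := by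
  unfold AH
  rw [lintegral_lintegral_swap]
  · simp_rw [lintegral_sub_right_eq_self (fun x => Hl τ v x), lintegral_Hl hτ hv]
    simp
  · exact ((measurable_Hl hv).comp (by fun_prop)).aemeasurable

theorem AH_Hl {t a b : ℝ} (ha : 0 < a) (hb : 0 < b) {v : Ed d → ℝ≥0∞} (hv : Measurable v)
    (x : Ed d) : AH t a (Hl b v) x = AH t (a + b) v x := by
  unfold AH
  simp_rw [Hl_Hl ha hb hv]

theorem AH_le_mul_AH {a b c t t' : ℝ} (ha : 0 < a) (hb : 0 < b) {v : Ed d → ℝ≥0∞} {x x' : Ed d}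
    (hv : Measurable v)
    (h : ∀ y : sphere (0 : Ed d) 1, ∀ z, v z ≠ 0 →
      ‖x' - t' • (y : Ed d) - z‖ ^ 2 / (4 * b) ≤ ‖x - t • (y : Ed d) - z‖ ^ 2 / (4 * a) + c) :
    AH t a v x ≤ ENNReal.ofReal ((b / a) ^ ((d : ℝ) / 2) * Real.exp c) * AH t' b v x' := by
  unfold AH
  rw [← lintegral_const_mul _ (measurable_Hl_sub hv x')]
  exact lintegral_mono fun y => Hl_le_mul_Hl ha hb hv (h y)

theorem AH_le_AH_of_le {t a b : ℝ} (ha : 0 < a) (hab : a ≤ b) {v : Ed d → ℝ≥0∞}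
    (hv : Measurable v) (x : Ed d) :
    AH t a v x ≤ ENNReal.ofReal ((b / a) ^ ((d : ℝ) / 2)) * AH t b v x := by
  have := AH_le_mul_AH (t := t) (t' := t) (c := 0) ha (ha.trans_le hab) (x := x) (x' := x) hv
    (fun y z _ => by rw [add_zero]; gcongr)
  simpa using this

end

end

section

variable {d : ℕ}

/-- The heat semigroup acting on real functions. -/
def heat (τ : ℝ) (v : Ed d → ℝ) (x : Ed d) : ℝ := ∫ z, gk d τ (x - z) * v z

/-- Spherical mean of the heat extension of a real function. -/
def AHr (t τ : ℝ) (v : Ed d → ℝ) (x : Ed d) : ℝ :=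
  ∫ y : sphere (0 : Ed d) 1, heat τ v (x - t • (y : Ed d)) ∂(sphereProb d)

theorem integrable_gk_mul {τ : ℝ} (hτ : 0 < τ) {v : Ed d → ℝ} (hv : Integrable v) (x : Ed d) :
    Integrable fun z => gk d τ (x - z) * v z := by
  refine hv.bdd_mul (c := (4 * Real.pi * τ) ^ (-(d : ℝ) / 2)) ?_ ?_
  · exact (continuous_gk.comp (by fun_prop)).aestronglyMeasurable
  · refine Eventually.of_forall fun z => ?_
    rw [Real.norm_of_nonneg (gk_nonneg hτ _)]
    exact gk_le_const hτ _

theorem continuous_heat {τ : ℝ} (hτ : 0 < τ) {v : Ed d → ℝ} (hv : Integrable v) :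
    Continuous (heat τ v) := by
  unfold heat
  refine continuous_of_dominated
    (bound := fun z => (4 * Real.pi * τ) ^ (-(d : ℝ) / 2) * ‖v z‖) ?_ ?_ ?_ ?_
  · exact fun x => (integrable_gk_mul hτ hv x).aestronglyMeasurable
  · intro x
    refine Eventually.of_forall fun z => ?_
    rw [norm_mul, Real.norm_of_nonneg (gk_nonneg hτ _)]
    gcongr
    exact gk_le_const hτ _
  · exact hv.norm.const_mul _
  · exact Eventually.of_forall fun z => (continuous_gk.comp (by fun_prop)).mul continuous_const

theorem heat_sub {τ : ℝ} (hτ : 0 < τ) {v w : Ed d → ℝ} (hv : Integrable v) (hw : Integrable w)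
    (x : Ed d) : heat τ (fun z => v z - w z) x = heat τ v x - heat τ w x := by
  unfold heat
  rw [← integral_sub (integrable_gk_mul hτ hv x) (integrable_gk_mul hτ hw x)]
  congr 1; ext z; ring

theorem heat_add {τ : ℝ} (hτ : 0 < τ) {v w : Ed d → ℝ} (hv : Integrable v) (hw : Integrable w)
    (x : Ed d) : heat τ (fun z => v z + w z) x = heat τ v x + heat τ w x := by
  unfold heat
  rw [← integral_add (integrable_gk_mul hτ hv x) (integrable_gk_mul hτ hw x)]
  congr 1; ext z; ring

theorem enorm_heat_le {τ : ℝ} (hτ : 0 < τ) (v : Ed d → ℝ) (x : Ed d) :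
    ‖heat τ v x‖ₑ ≤ Hl τ (fun z => ‖v z‖ₑ) x := by
  unfold heat Hl
  refine (enorm_integral_le_lintegral_enorm _).trans (lintegral_mono fun z => ?_)
  rw [enorm_mul, Real.enorm_eq_ofReal (gk_nonneg hτ _)]

theorem enorm_AHr_le {t τ : ℝ} (hτ : 0 < τ) (v : Ed d → ℝ) (x : Ed d) :
    ‖AHr t τ v x‖ₑ ≤ AH t τ (fun z => ‖v z‖ₑ) x := by
  unfold AHr AH
  exact (enorm_integral_le_lintegral_enorm _).trans (lintegral_mono fun z => enorm_heat_le hτ _ _)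

theorem ofReal_heat {τ : ℝ} (hτ : 0 < τ) {v : Ed d → ℝ} (hv : Integrable v) (h0 : ∀ z, 0 ≤ v z)
    (x : Ed d) : ENNReal.ofReal (heat τ v x) = Hl τ (fun z => ENNReal.ofReal (v z)) x := by
  unfold heat Hl
  rw [ofReal_integral_eq_lintegral_ofReal (integrable_gk_mul hτ hv x)
    (Eventually.of_forall fun z => mul_nonneg (gk_nonneg hτ _) (h0 z))]
  congr 1; ext z; rw [ENNReal.ofReal_mul (gk_nonneg hτ _)]

theorem heat_nonneg {τ : ℝ} (hτ : 0 < τ) {v : Ed d → ℝ} (h0 : ∀ z, 0 ≤ v z)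
    (x : Ed d) : 0 ≤ heat τ v x :=
  integral_nonneg fun z => mul_nonneg (gk_nonneg hτ _) (h0 z)

theorem abs_heat_le {τ : ℝ} (hτ : 0 < τ) {v : Ed d → ℝ} {B : ℝ} (h0 : ∀ z, |v z| ≤ B)
    (x : Ed d) : |heat τ v x| ≤ B := by
  have hB : 0 ≤ B := (abs_nonneg _).trans (h0 0)
  have := (enorm_heat_le hτ v x).trans (Hl_le_const hτ (c := ENNReal.ofReal B) (fun z => by
    rw [Real.enorm_eq_ofReal_abs]; exact ENNReal.ofReal_le_ofReal (h0 z)) x)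
  rw [Real.enorm_eq_ofReal_abs] at this
  exact (ENNReal.ofReal_le_ofReal_iff hB).1 this

theorem integrable_heat {τ : ℝ} (hτ : 0 < τ) {v : Ed d → ℝ} (hv : Integrable v) :
    Integrable (heat τ v) := by
  refine ⟨(continuous_heat hτ hv).aestronglyMeasurable, ?_⟩
  obtain ⟨w, hw, hvw⟩ := hv.aestronglyMeasurable.aemeasurable
  calc ∫⁻ x, ‖heat τ v x‖ₑ = ∫⁻ x, ‖heat τ w x‖ₑ := by
        congr 1; ext x; congr 1
        refine integral_congr_ae ?_
        filter_upwards [hvw] with z hz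
        rw [hz]
    _ ≤ ∫⁻ x, Hl τ (fun z => ‖w z‖ₑ) x := lintegral_mono fun x => enorm_heat_le hτ _ _
    _ = ∫⁻ x, ‖w x‖ₑ := lintegral_Hl hτ (by fun_prop)
    _ < ⊤ := (hv.congr hvw).2

theorem integral_gk_mul_gk {a b : ℝ} (ha : 0 < a) (hb : 0 < b) (x z : Ed d) :
    ∫ y, gk d a (x - y) * gk d b (y - z) = gk d (a + b) (x - z) := by
  have h := lintegral_gk_mul_gk ha hb x z
  have hm : Continuous fun y => gk d a (x - y) * gk d b (y - z) :=
    (continuous_gk.comp (by fun_prop)).mul (continuous_gk.comp (by fun_prop))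
  rw [integral_eq_lintegral_of_nonneg_ae
    (Eventually.of_forall fun y => mul_nonneg (gk_nonneg ha _) (gk_nonneg hb _))
    hm.aestronglyMeasurable]
  simp_rw [ENNReal.ofReal_mul (gk_nonneg ha _)]
  rw [h, ENNReal.toReal_ofReal (gk_nonneg (by positivity) _)]

theorem heat_heat {a b : ℝ} (ha : 0 < a) (hb : 0 < b) {v : Ed d → ℝ} (hv : Integrable v)
    (x : Ed d) : heat a (heat b v) x = heat (a + b) v x := by
  unfold heat
  calc _ = ∫ y, ∫ z, gk d a (x - y) * (gk d b (y - z) * v z) := by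
        congr 1; ext y; rw [integral_const_mul]
    _ = ∫ z, ∫ y, gk d a (x - y) * (gk d b (y - z) * v z) := by
        apply integral_integral_swap
        have h1 : Integrable (fun p : Ed d × Ed d => gk d a (x - p.1) * v p.2)
            (volume.prod volume) :=
          ((integrable_gk ha).comp_sub_left x).mul_prod hv
        have h2 := h1.bdd_mul (f := fun p : Ed d × Ed d => gk d b (p.1 - p.2))
          (c := (4 * Real.pi * b) ^ (-(d : ℝ) / 2))
          (continuous_gk.comp (by fun_prop)).aestronglyMeasurable
          (Eventually.of_forall fun z => by
            rw [Real.norm_of_nonneg (gk_nonneg hb _)]; exact gk_le_const hb _)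
        refine h2.congr (Eventually.of_forall fun p => ?_)
        simp only [Function.uncurry]; ring
    _ = _ := by
        congr 1; ext z
        rw [← integral_gk_mul_gk ha hb, ← integral_mul_const]
        congr 1; ext y; ring

theorem integral_heat {τ : ℝ} (hτ : 0 < τ) {v : Ed d → ℝ} (hv : Integrable v)
    (h0 : ∀ z, 0 ≤ v z) (hm : Measurable v) : ∫ x, heat τ v x = ∫ x, v x := by
  rw [integral_eq_lintegral_of_nonneg_ae (Eventually.of_forall (heat_nonneg hτ h0))
    (continuous_heat hτ hv).aestronglyMeasurable,
    integral_eq_lintegral_of_nonneg_ae (Eventually.of_forall h0) hv.aestronglyMeasurable]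
  simp_rw [ofReal_heat hτ hv h0]
  rw [lintegral_Hl hτ (by fun_prop)]

section
variable [Fact (3 ≤ d)]

theorem integrable_sphere {f : Ed d → ℝ} (hf : Continuous f) (x : Ed d) (t : ℝ) :
    Integrable (fun y : sphere (0 : Ed d) 1 => f (x - t • (y : Ed d))) (sphereProb d) :=
  (hf.comp (by fun_prop)).integrable_of_hasCompactSupport (HasCompactSupport.of_compactSpace _)

theorem AHr_sub {t τ : ℝ} (hτ : 0 < τ) {v w : Ed d → ℝ} (hv : Integrable v) (hw : Integrable w)
    (x : Ed d) : AHr t τ (fun z => v z - w z) x = AHr t τ v x - AHr t τ w x := by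
  unfold AHr
  rw [← integral_sub (integrable_sphere (continuous_heat hτ hv) x t)
    (integrable_sphere (continuous_heat hτ hw) x t)]
  simp_rw [heat_sub hτ hv hw]

theorem AHr_add {t τ : ℝ} (hτ : 0 < τ) {v w : Ed d → ℝ} (hv : Integrable v) (hw : Integrable w)
    (x : Ed d) : AHr t τ (fun z => v z + w z) x = AHr t τ v x + AHr t τ w x := by
  unfold AHr
  rw [← integral_add (integrable_sphere (continuous_heat hτ hv) x t)
    (integrable_sphere (continuous_heat hτ hw) x t)]
  simp_rw [heat_add hτ hv hw]

theorem AHr_heat {t a b : ℝ} (ha : 0 < a) (hb : 0 < b) {v : Ed d → ℝ} (hv : Integrable v)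
    (x : Ed d) : AHr t a (heat b v) x = AHr t (a + b) v x := by
  unfold AHr
  simp_rw [heat_heat ha hb hv]

theorem tendsto_heat_zero {v : Ed d → ℝ} (hv : Continuous v) (hi : Integrable v) (x : Ed d) :
    Tendsto (fun τ => heat τ v x) (𝓝[>] 0) (𝓝 (v x)) := by
  have h := tendsto_integral_comp_smul_smul_of_integrable' (μ := (volume : Measure (Ed d)))
    (φ := gk d 1) (fun x => gk_nonneg one_pos x) (integral_gk one_pos) (x₀ := x) (g := v)
    ?_ hi hv.continuousAt
  · have h2 : Tendsto (fun τ : ℝ => (√τ)⁻¹) (𝓝[>] 0) atTop := by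
      refine tendsto_inv_nhdsGT_zero.comp ?_
      refine tendsto_nhdsWithin_iff.2 ⟨?_, ?_⟩
      · have := (Real.continuous_sqrt.tendsto 0).mono_left (nhdsWithin_le_nhds (s := Ioi 0))
        simpa using this
      · filter_upwards [self_mem_nhdsWithin] with τ hτ
        exact Real.sqrt_pos.2 hτ
    refine (h.comp h2).congr' ?_
    filter_upwards [self_mem_nhdsWithin] with τ hτ
    have hτ : 0 < τ := hτ
    simp only [Function.comp, heat, smul_eq_mul]
    congr 1; ext z; congr 1
    unfold gk
    have hs : (√τ)⁻¹ ^ 2 = τ⁻¹ := by rw [inv_pow, Real.sq_sqrt hτ.le]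
    rw [norm_smul, mul_pow, norm_inv, Real.norm_of_nonneg (Real.sqrt_nonneg _), hs,
      finrank_euclideanSpace_fin, ← mul_assoc, inv_pow]
    congr 1
    · rw [Real.mul_rpow (by positivity) hτ.le, mul_one, mul_comm]
      congr 1
      rw [neg_div, Real.rpow_neg hτ.le, Real.sqrt_eq_rpow, ← Real.rpow_mul_natCast hτ.le]
      congr 2; ring
    · congr 2; field_simp
  · have h1 : Tendsto (fun r : ℝ => (4 * Real.pi * 1) ^ (-(d : ℝ) / 2) * Real.exp 1 *
        (r ^ d * Real.exp (-r))) atTop (𝓝 0) := by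
      simpa using (Real.tendsto_pow_mul_exp_neg_atTop_nhds_zero d).const_mul
        ((4 * Real.pi * 1) ^ (-(d : ℝ) / 2) * Real.exp 1)
    refine squeeze_zero (fun y => by have := gk_nonneg one_pos y; positivity) (fun y => ?_)
      (h1.comp (tendsto_norm_cobounded_atTop (E := Ed d)))
    simp only [Function.comp, finrank_euclideanSpace_fin, gk]
    have : Real.exp (-(‖y‖ ^ 2 / (4 * 1))) ≤ Real.exp 1 * Real.exp (-‖y‖) := by
      rw [← Real.exp_add]
      gcongr
      nlinarith [sq_nonneg (‖y‖ - 2)]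
    calc _ ≤ ‖y‖ ^ d * ((4 * Real.pi * 1) ^ (-(d : ℝ) / 2) *
          (Real.exp 1 * Real.exp (-‖y‖))) := by gcongr
      _ = _ := by ring

theorem tendsto_AHr_zero {v : Ed d → ℝ} (hv : Continuous v) (hi : Integrable v) {B : ℝ}
    (hB : ∀ z, |v z| ≤ B) (t : ℝ) (x : Ed d) :
    Tendsto (fun τ => AHr t τ v x) (𝓝[>] 0)
      (𝓝 (∫ y : sphere (0 : Ed d) 1, v (x - t • (y : Ed d)) ∂(sphereProb d))) := by
  unfold AHr
  refine tendsto_integral_filter_of_dominated_convergence (fun _ => B) ?_ ?_ ?_ ?_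
  · filter_upwards [self_mem_nhdsWithin] with τ hτ
    exact (integrable_sphere (continuous_heat hτ hi) x t).aestronglyMeasurable
  · filter_upwards [self_mem_nhdsWithin] with τ hτ
    exact Eventually.of_forall fun y => abs_heat_le hτ hB _
  · exact integrable_const _
  · exact Eventually.of_forall fun y => tendsto_heat_zero hv hi _

end

end

section

open scoped Pointwise

variable {d : ℕ}

/-- The action of a linear isometry on the unit sphere. -/
def sphMap (L : Ed d ≃ₗᵢ[ℝ] Ed d) (y : sphere (0 : Ed d) 1) : sphere (0 : Ed d) 1 :=
  ⟨L y, by simp⟩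

theorem continuous_sphMap (L : Ed d ≃ₗᵢ[ℝ] Ed d) : Continuous (sphMap L) :=
  Continuous.subtype_mk (L.continuous.comp continuous_subtype_val) _

theorem map_sphMap_toSphere (L : Ed d ≃ₗᵢ[ℝ] Ed d) :
    ((volume : Measure (Ed d)).toSphere).map (sphMap L) = (volume : Measure (Ed d)).toSphere := by
  ext s hs
  rw [Measure.map_apply (continuous_sphMap L).measurable hs,
    Measure.toSphere_apply' _ ((continuous_sphMap L).measurable hs), Measure.toSphere_apply' _ hs]
  congr 1
  have h2 := L.measurePreserving.measure_preimage_emb L.toHomeomorph.measurableEmbedding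
    (Ioo (0 : ℝ) 1 • (Subtype.val '' s))
  rw [← h2]
  congr 1
  ext x
  simp only [Set.mem_smul, mem_image, mem_preimage, Subtype.exists, mem_sphere_zero_iff_norm,
    exists_and_right, exists_eq_right]
  constructor
  · rintro ⟨r, hr, y, ⟨hy, hys⟩, rfl⟩
    exact ⟨r, hr, L y, ⟨by simpa using hy, hys⟩, by simp⟩
  · rintro ⟨r, hr, y, ⟨hy, hys⟩, hx⟩
    refine ⟨r, hr, L.symm y, ⟨by simpa using hy, ?_⟩, ?_⟩
    · simpa [sphMap] using hys
    · rw [← map_smul, hx, L.symm_apply_apply]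

theorem map_sphMap (L : Ed d ≃ₗᵢ[ℝ] Ed d) : (sphereProb d).map (sphMap L) = sphereProb d := by
  unfold sphereProb
  rw [Measure.map_smul, map_sphMap_toSphere]

theorem integral_sphMap (L : Ed d ≃ₗᵢ[ℝ] Ed d) {F : Ed d → ℝ} (hF : Continuous F) :
    ∫ y : sphere (0 : Ed d) 1, F (L y) ∂(sphereProb d) =
      ∫ y : sphere (0 : Ed d) 1, F y ∂(sphereProb d) := by
  conv_rhs => rw [← map_sphMap L]
  exact (integral_map (continuous_sphMap L).measurable.aemeasurable
    (hF.comp continuous_subtype_val).aestronglyMeasurable).symm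

theorem exists_isometry_apply_eq {x y : Ed d} (h : ‖x‖ = ‖y‖) :
    ∃ L : Ed d ≃ₗᵢ[ℝ] Ed d, L x = y :=
  ⟨(ℝ ∙ (x - y))ᗮ.reflection, Submodule.reflection_sub h⟩

theorem integral_inner_eq {F : ℝ → ℝ} (hF : Continuous F) {ζ ξ : Ed d} (h : ‖ζ‖ = ‖ξ‖) :
    ∫ y : sphere (0 : Ed d) 1, F (inner ℝ (y : Ed d) ζ) ∂(sphereProb d) =
      ∫ y : sphere (0 : Ed d) 1, F (inner ℝ (y : Ed d) ξ) ∂(sphereProb d) := by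
  obtain ⟨L, rfl⟩ := exists_isometry_apply_eq h
  rw [← integral_sphMap L (F := fun y => F (inner ℝ y (L ζ))) (by fun_prop)]
  simp

section
variable [Fact (3 ≤ d)]

/-- The radial profile of the Fourier transform of the sphere, and its derivatives. -/
def sphCos (d : ℕ) [NeZero d] (r : ℝ) : ℝ :=
  ∫ y : sphere (0 : Ed d) 1, Real.cos (r * (y : Ed d) 0) ∂(sphereProb d)

def sphCos1 (d : ℕ) [NeZero d] (r : ℝ) : ℝ :=
  -∫ y : sphere (0 : Ed d) 1, (y : Ed d) 0 * Real.sin (r * (y : Ed d) 0) ∂(sphereProb d)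

theorem integral_cos_inner (ζ : Ed d) :
    ∫ y : sphere (0 : Ed d) 1, Real.cos (inner ℝ (y : Ed d) ζ) ∂(sphereProb d) =
      sphCos d ‖ζ‖ := by
  have h := integral_inner_eq (F := Real.cos) Real.continuous_cos (ζ := ζ)
    (ξ := EuclideanSpace.single 0 ‖ζ‖) (by simp)
  rw [h]
  unfold sphCos
  simp [EuclideanSpace.inner_single_right]

theorem integral_sin_inner (ζ : Ed d) :
    ∫ y : sphere (0 : Ed d) 1, Real.sin (inner ℝ (y : Ed d) ζ) ∂(sphereProb d) = 0 := by
  have h := integral_inner_eq (F := Real.sin) Real.continuous_sin (ζ := ζ)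
    (ξ := -ζ) (by simp)
  simp only [inner_neg_right, Real.sin_neg, integral_neg] at h
  linarith

theorem integral_cexp_inner (ζ : Ed d) :
    ∫ y : sphere (0 : Ed d) 1, Complex.exp (Complex.I * (inner ℝ (y : Ed d) ζ : ℝ))
      ∂(sphereProb d) = (sphCos d ‖ζ‖ : ℂ) := by
  have hi : ∀ F : sphere (0 : Ed d) 1 → ℝ, Continuous F →
      Integrable (fun y => (F y : ℂ)) (sphereProb d) := fun F hF =>
    (Complex.continuous_ofReal.comp hF).integrable_of_hasCompactSupport
      (HasCompactSupport.of_compactSpace _)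
  have h1 : ∀ y : sphere (0 : Ed d) 1, Complex.exp (Complex.I * (inner ℝ (y : Ed d) ζ : ℝ)) =
      (Real.cos (inner ℝ (y : Ed d) ζ) : ℂ) + (Real.sin (inner ℝ (y : Ed d) ζ) : ℂ) * Complex.I := by
    intro y
    rw [mul_comm, Complex.exp_mul_I]
    simp
  simp_rw [h1]
  rw [integral_add (hi _ (by fun_prop)) ((hi _ (by fun_prop)).mul_const _), integral_mul_const]
  rw [integral_complex_ofReal, integral_complex_ofReal, integral_cos_inner, integral_sin_inner]
  simp

theorem integrable_of_continuous_sphere {F : sphere (0 : Ed d) 1 → ℝ} (hF : Continuous F) :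
    Integrable F (sphereProb d) :=
  hF.integrable_of_hasCompactSupport (HasCompactSupport.of_compactSpace _)

theorem hasDerivAt_integral_sphere {c a b : sphere (0 : Ed d) 1 → ℝ} (hc : Continuous c)
    (ha : Continuous a) (hb : Continuous b) {F F' : ℝ → ℝ} (hF : ∀ x, HasDerivAt F (F' x) x)
    (hF' : Continuous F') (hB : ∀ x, |F' x| ≤ 1) (s : ℝ) :
    HasDerivAt (fun s => ∫ y, c y * F (a y + s * b y) ∂(sphereProb d))
      (∫ y, c y * b y * F' (a y + s * b y) ∂(sphereProb d)) s := by
  have hFc : Continuous F := continuous_iff_continuousAt.2 fun x => (hF x).continuousAt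
  refine (hasDerivAt_integral_of_dominated_loc_of_deriv_le (bound := fun y => |c y * b y|)
    (s := univ) (F' := fun s y => c y * b y * F' (a y + s * b y)) univ_mem ?_ ?_ ?_ ?_ ?_ ?_).2
  · exact Eventually.of_forall fun s => (integrable_of_continuous_sphere
      (by fun_prop)).aestronglyMeasurable
  · exact integrable_of_continuous_sphere (by fun_prop)
  · exact (integrable_of_continuous_sphere (by fun_prop)).aestronglyMeasurable
  · refine Eventually.of_forall fun y s _ => ?_
    rw [norm_mul]
    exact mul_le_of_le_one_right (norm_nonneg _) (hB _)
  · exact integrable_of_continuous_sphere (by fun_prop)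
  · refine Eventually.of_forall fun y s _ => ?_
    have h1 : HasDerivAt (fun s => a y + s * b y) (b y) s := by
      simpa using ((hasDerivAt_id s).mul_const (b y)).const_add (a y)
    have := ((hF (a y + s * b y)).comp s h1).const_mul (c y)
    rw [mul_comm (F' _), ← mul_assoc] at this
    exact this

end

end

section

variable {d : ℕ} [Fact (3 ≤ d)]

/-- The second derivative of `sphCos`. -/
def sphCos2 (d : ℕ) [NeZero d] (r : ℝ) : ℝ :=
  -∫ y : sphere (0 : Ed d) 1, (y : Ed d) 0 ^ 2 * Real.cos (r * (y : Ed d) 0) ∂(sphereProb d)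

theorem hasDerivAt_sphCos (r : ℝ) : HasDerivAt (sphCos d) (sphCos1 d r) r := by
  have h := hasDerivAt_integral_sphere (d := d) (c := fun _ => 1) (a := fun _ => 0)
    (b := fun y => (y : Ed d) 0) (by fun_prop) (by fun_prop) (by fun_prop)
    (F := Real.cos) (F' := fun x => -Real.sin x) Real.hasDerivAt_cos (by fun_prop)
    (fun x => by rw [abs_neg]; exact Real.abs_sin_le_one x) r
  simpa [sphCos, sphCos1, integral_neg] using! h

theorem hasDerivAt_sphCos1 (r : ℝ) : HasDerivAt (sphCos1 d) (sphCos2 d r) r := by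
  have h := hasDerivAt_integral_sphere (d := d) (c := fun y => (y : Ed d) 0) (a := fun _ => 0)
    (b := fun y => (y : Ed d) 0) (by fun_prop) (by fun_prop) (by fun_prop)
    (F := Real.sin) (F' := Real.cos) Real.hasDerivAt_sin (by fun_prop)
    Real.abs_cos_le_one r
  simpa [sphCos1, sphCos2, pow_two] using! h.neg

theorem sphCos1_div {i : Fin d} (hi : i ≠ 0) {r : ℝ} (hr : 0 < r) :
    sphCos1 d r / r =
      -∫ y : sphere (0 : Ed d) 1, (y : Ed d) i ^ 2 * Real.cos (r * (y : Ed d) 0)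
        ∂(sphereProb d) := by
  have hpos : ∀ s : ℝ, 0 < r ^ 2 + s ^ 2 := fun s => by positivity
  have hK : ∀ s : ℝ, ∫ y : sphere (0 : Ed d) 1,
      1 * Real.cos (r * (y : Ed d) 0 + s * (y : Ed d) i) ∂(sphereProb d) =
      sphCos d (√(r ^ 2 + s ^ 2)) := by
    intro s
    have h := integral_cos_inner (EuclideanSpace.single (0 : Fin d) r + EuclideanSpace.single i s)
    have hn : ‖EuclideanSpace.single (0 : Fin d) r + EuclideanSpace.single i s‖ =
        √(r ^ 2 + s ^ 2) := by
      rw [← Real.sqrt_sq (norm_nonneg (EuclideanSpace.single (0 : Fin d) r + _)),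
        norm_add_sq_real]
      simp [EuclideanSpace.inner_single_left, hi.symm]
    rw [hn] at h
    rw [← h]
    simp [inner_add_right, EuclideanSpace.inner_single_right]
  have hρ : ∀ s : ℝ, HasDerivAt (fun s => √(r ^ 2 + s ^ 2)) (s / √(r ^ 2 + s ^ 2)) s := by
    intro s
    have h1 : HasDerivAt (fun s : ℝ => r ^ 2 + s ^ 2) (2 * s) s := by
      simpa using (hasDerivAt_pow 2 s).const_add (r ^ 2)
    convert h1.sqrt (hpos s).ne' using 1
    field_simp
  have h1 : ∀ s : ℝ, ∫ y : sphere (0 : Ed d) 1,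
      (1 * (y : Ed d) i) * -Real.sin (r * (y : Ed d) 0 + s * (y : Ed d) i) ∂(sphereProb d) =
      s * (sphCos1 d (√(r ^ 2 + s ^ 2)) / √(r ^ 2 + s ^ 2)) := by
    intro s
    have e1 := hasDerivAt_integral_sphere (d := d) (c := fun _ => 1)
      (a := fun y => r * (y : Ed d) 0)
      (b := fun y => (y : Ed d) i) (by fun_prop) (by fun_prop) (by fun_prop)
      (F := Real.cos) (F' := fun x => -Real.sin x) Real.hasDerivAt_cos (by fun_prop)
      (fun x => by rw [abs_neg]; exact Real.abs_sin_le_one x) s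
    simp_rw [hK] at e1
    have e2 := (hasDerivAt_sphCos (d := d) (√(r ^ 2 + s ^ 2))).comp s (hρ s)
    rw [e1.unique e2]
    ring
  have e1 := hasDerivAt_integral_sphere (d := d) (c := fun y => 1 * (y : Ed d) i)
      (a := fun y => r * (y : Ed d) 0)
      (b := fun y => (y : Ed d) i) (by fun_prop) (by fun_prop) (by fun_prop)
      (F := fun x => -Real.sin x) (F' := fun x => -Real.cos x)
      (fun x => (Real.hasDerivAt_sin x).neg) (by fun_prop)
      (fun x => by rw [abs_neg]; exact Real.abs_cos_le_one x) 0
  simp_rw [h1] at e1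
  have e2 := ((hasDerivAt_sphCos1 (d := d) (√(r ^ 2 + 0 ^ 2))).comp 0 (hρ 0)).div (hρ 0)
    (Real.sqrt_pos.2 (hpos 0)).ne'
  have e3 := (hasDerivAt_id (0 : ℝ)).mul e2
  have e4 := e1.unique e3
  simp only [id, one_mul, zero_mul, add_zero, Function.comp_apply, Pi.div_apply, mul_neg, integral_neg] at e4
  rw [show r ^ 2 + (0 : ℝ) ^ 2 = r ^ 2 by ring, Real.sqrt_sq hr.le] at e4
  rw [← e4]
  simp [pow_two]

theorem sphCos_ode {r : ℝ} (hr : 0 < r) :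
    sphCos2 d r = -sphCos d r - (d - 1) * sphCos1 d r / r := by
  have h1 : sphCos d r = ∑ i : Fin d, ∫ y : sphere (0 : Ed d) 1,
      (y : Ed d) i ^ 2 * Real.cos (r * (y : Ed d) 0) ∂(sphereProb d) := by
    rw [← integral_finsetSum _ fun i _ => integrable_of_continuous_sphere (by fun_prop)]
    unfold sphCos
    congr 1; ext y
    rw [← Finset.sum_mul]
    have : ∑ i : Fin d, (y : Ed d) i ^ 2 = 1 := by
      have := EuclideanSpace.norm_sq_eq (y : Ed d)
      rw [norm_eq_of_mem_sphere y] at this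
      simpa using this.symm
    rw [this, one_mul]
  rw [← Finset.add_sum_erase _ _ (Finset.mem_univ (0 : Fin d))] at h1
  have h2 : ∑ i ∈ Finset.univ.erase (0 : Fin d), ∫ y : sphere (0 : Ed d) 1,
      (y : Ed d) i ^ 2 * Real.cos (r * (y : Ed d) 0) ∂(sphereProb d) =
      (d - 1) * (-(sphCos1 d r / r)) := by
    rw [Finset.sum_congr rfl fun i hi => by
      rw [← neg_neg (∫ y : sphere (0 : Ed d) 1, (y : Ed d) i ^ 2 *
        Real.cos (r * (y : Ed d) 0) ∂(sphereProb d)),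
        ← sphCos1_div (Finset.ne_of_mem_erase hi) hr]]
    have : (1 : ℕ) ≤ d := NeZero.one_le
    simp [Finset.card_erase_of_mem, this]
  rw [h2] at h1
  unfold sphCos2
  rw [h1]
  ring

theorem abs_sphCos_le (r : ℝ) : |sphCos d r| ≤ 1 := by
  have := norm_integral_le_of_norm_le_const (μ := sphereProb d) (C := 1)
    (f := fun y : sphere (0 : Ed d) 1 => Real.cos (r * (y : Ed d) 0))
    (Eventually.of_forall fun y => Real.abs_cos_le_one _)
  simpa [sphCos] using this

theorem abs_coord_le (y : sphere (0 : Ed d) 1) (i : Fin d) : |(y : Ed d) i| ≤ 1 := by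
  have := PiLp.norm_apply_le (y : Ed d) i
  rwa [norm_eq_of_mem_sphere y] at this

theorem abs_sphCos1_le (r : ℝ) : |sphCos1 d r| ≤ 1 := by
  have := norm_integral_le_of_norm_le_const (μ := sphereProb d) (C := 1)
    (f := fun y : sphere (0 : Ed d) 1 => (y : Ed d) 0 * Real.sin (r * (y : Ed d) 0))
    (Eventually.of_forall fun y => by
      rw [Real.norm_eq_abs, abs_mul]
      exact mul_le_one₀ (abs_coord_le y 0) (abs_nonneg _) (Real.abs_sin_le_one _))
  simpa [sphCos1] using this

/-- Decay of the Fourier transform of the sphere and of its radial derivative. -/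
theorem sphCos_decay : ∃ C : ℝ, 0 < C ∧ ∀ r : ℝ, 0 < r →
    r ^ (d - 1) * (sphCos d r ^ 2 + sphCos1 d r ^ 2) ≤ C := by
  obtain ⟨e, he⟩ : ∃ e, d = e + 3 := ⟨d - 3, by have := (Fact.out : 3 ≤ d); omega⟩
  have hde : (d : ℝ) - 1 = e + 2 := by rw [he]; push_cast; ring
  have hd1 : d - 1 = e + 2 := by omega
  set φ := sphCos d
  set φ1 := sphCos1 d
  set a : ℝ := e + 2 with ha
  have ha0 : 0 < a := by positivity
  let En : ℝ → ℝ := fun r => r ^ (e + 2) * (φ1 r ^ 2 + φ r ^ 2) + a * r ^ (e + 1) * (φ r * φ1 r)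
  have hEn : ∀ r, 0 < r → HasDerivAt En (-(a * r ^ e * (φ r * φ1 r))) r := by
    intro r hr
    have h0 := hasDerivAt_sphCos (d := d) r
    have h1 := hasDerivAt_sphCos1 (d := d) r
    rw [sphCos_ode hr, hde] at h1
    have := ((hasDerivAt_pow (e + 2) r).mul ((h1.pow 2).add (h0.pow 2))).add
      (((hasDerivAt_pow (e + 1) r).const_mul a).mul (h0.mul h1))
    refine HasDerivAt.congr_deriv (f := En) this ?_
    simp only [Pi.add_apply, Pi.pow_apply, Pi.mul_apply]
    push_cast
    simp only [φ, φ1]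
    rw [ha]
    field_simp
    ring
  have hlow : ∀ r, a ≤ r → r ^ (e + 2) * (φ r ^ 2 + φ1 r ^ 2) ≤ 2 * En r := by
    intro r hr
    have hr0 : 0 < r := ha0.trans_le hr
    have h1 : -(a * (φ r * φ1 r)) * 2 ≤ r * (φ r ^ 2 + φ1 r ^ 2) := by
      nlinarith [sq_nonneg (φ r + φ1 r), sq_nonneg (φ r), sq_nonneg (φ1 r),
        mul_nonneg ha0.le (sq_nonneg (φ r + φ1 r)), mul_nonneg (sub_nonneg.2 hr)
          (add_nonneg (sq_nonneg (φ r)) (sq_nonneg (φ1 r)))]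
    have h2 := mul_le_mul_of_nonneg_left h1 (pow_nonneg hr0.le (e + 1))
    simp only [En]
    have h3 : r ^ (e + 2) = r ^ (e + 1) * r := pow_succ _ _
    rw [h3]
    nlinarith
  have hanti : AntitoneOn (fun r => En r * Real.exp (a / r)) (Ici a) := by
    have hder : ∀ r, 0 < r → HasDerivAt (fun r => En r * Real.exp (a / r))
        (-(a * r ^ e * (φ r * φ1 r)) * Real.exp (a / r) +
          En r * (Real.exp (a / r) * (-(a / r ^ 2)))) r := by
      intro r hr
      have h1 : HasDerivAt (fun r => a / r) (-(a / r ^ 2)) r := by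
        have := (hasDerivAt_inv hr.ne').const_mul a
        exact this.congr_deriv (by rw [div_eq_mul_inv]; ring)
      exact (hEn r hr).mul h1.exp
    refine antitoneOn_of_deriv_nonpos (convex_Ici a) ?_ ?_ ?_
    · exact fun r hr => (hder r (ha0.trans_le hr)).continuousAt.continuousWithinAt
    · intro r hr
      rw [interior_Ici] at hr
      exact (hder r (ha0.trans hr)).differentiableAt.differentiableWithinAt
    · intro r hr
      rw [interior_Ici] at hr
      have hr : a < r := hr
      have hr0 := ha0.trans hr
      rw [(hder r hr0).deriv]
      have h2 := hlow r hr.le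
      have h3 : -(a * r ^ e * (φ r * φ1 r)) ≤ a / r ^ 2 * En r := by
        have h4 : a / r ^ 2 * (r ^ (e + 2) * (φ r ^ 2 + φ1 r ^ 2)) =
          a * r ^ e * (φ r ^ 2 + φ1 r ^ 2) := by
          rw [pow_add]; field_simp
        have h5 := mul_le_mul_of_nonneg_left h2 (show 0 ≤ a / r ^ 2 by positivity)
        rw [h4] at h5
        have h6 : 0 ≤ a * r ^ e := by positivity
        nlinarith [mul_nonneg h6 (sq_nonneg (φ r + φ1 r))]
      have := Real.exp_pos (a / r)
      nlinarith [mul_le_mul_of_nonneg_right h3 this.le]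
  have hφ : ∀ r, φ r ^ 2 + φ1 r ^ 2 ≤ 2 := by
    intro r
    have h1 := abs_sphCos_le (d := d) r
    have h2 := abs_sphCos1_le (d := d) r
    have h3 := (sq_le_one_iff_abs_le_one _).2 h1
    have h4 := (sq_le_one_iff_abs_le_one _).2 h2
    simp only [φ, φ1]; linarith
  refine ⟨a ^ (e + 2) * 2 + 2 * |En a * Real.exp (a / a)| + 1, by positivity, fun r hr => ?_⟩
  rw [hd1]
  rcases le_total r a with h | h
  · have h1 : r ^ (e + 2) * (φ r ^ 2 + φ1 r ^ 2) ≤ a ^ (e + 2) * 2 := by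
      gcongr; exact hφ r
    have := abs_nonneg (En a * Real.exp (a / a))
    linarith
  · have h1 := hlow r h
    have h2 : En r * Real.exp (a / r) ≤ En a * Real.exp (a / a) :=
      hanti (mem_Ici.2 le_rfl) (mem_Ici.2 h) h
    have h3 : 0 ≤ En r := by
      have : 0 ≤ r ^ (e + 2) * (φ r ^ 2 + φ1 r ^ 2) := by positivity
      linarith
    have h4 : En r ≤ En r * Real.exp (a / r) :=
      le_mul_of_one_le_right h3 (Real.one_le_exp (by positivity))
    have h5 := le_abs_self (En a * Real.exp (a / a))
    have h6 : 0 ≤ a ^ (e + 2) * 2 := by positivity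
    linarith

end

section

open FourierTransform

variable {d : ℕ}

/-- The Gaussian multiplier of the heat semigroup. -/
def gm (s : ℝ) (ξ : Ed d) : ℝ := Real.exp (-(4 * Real.pi ^ 2 * s * ‖ξ‖ ^ 2))

@[fun_prop]
theorem continuous_gm {s : ℝ} : Continuous (gm (d := d) s) := by
  unfold gm; fun_prop

theorem gm_pos (s : ℝ) (ξ : Ed d) : 0 < gm s ξ := Real.exp_pos _

theorem gm_eq_gk {s : ℝ} (hs : 0 < s) : ∃ a > 0, ∃ c : ℝ, ∀ ξ : Ed d, gm s ξ = c * gk d a ξ := by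
  have hπ := Real.pi_pos
  refine ⟨1 / (16 * Real.pi ^ 2 * s), by positivity,
    ((4 * Real.pi * (1 / (16 * Real.pi ^ 2 * s))) ^ (-(d : ℝ) / 2))⁻¹, fun ξ => ?_⟩
  unfold gm gk
  rw [← mul_assoc, inv_mul_cancel₀ (by positivity), one_mul]
  congr 2
  field_simp
  ring

theorem integrable_gm {s : ℝ} (hs : 0 < s) : Integrable (gm (d := d) s) := by
  obtain ⟨a, ha, c, h⟩ := gm_eq_gk (d := d) hs
  rw [show gm (d := d) s = fun ξ => c * gk d a ξ from funext h]
  exact (integrable_gk ha).const_mul c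

theorem continuous_fourier {G : Ed d → ℂ} (h : Integrable G) : Continuous (𝓕 G) :=
  VectorFourier.fourierIntegral_continuous Real.continuous_fourierChar
    (by exact continuous_inner) h

theorem norm_fourier_le (G : Ed d → ℂ) (ξ : Ed d) : ‖𝓕 G ξ‖ ≤ ∫ z, ‖G z‖ :=
  VectorFourier.norm_fourierIntegral_le_integral_norm _ _ _ _ _

theorem continuous_fourierInv {G : Ed d → ℂ} (h : Integrable G) : Continuous (𝓕⁻ G) := by
  rw [Real.fourierInv_eq_fourier_comp_neg]
  exact continuous_fourier h.comp_neg

theorem ofReal_heat_eq_fourierInv {s : ℝ} (hs : 0 < s) {v : Ed d → ℝ} (hv : Integrable v)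
    (x : Ed d) : (heat s v x : ℂ) =
      𝓕⁻ (fun ξ : Ed d => (gm s ξ : ℂ) * 𝓕 (fun z => (v z : ℂ)) ξ) x := by
  have hπ := Real.pi_pos
  set h : Ed d → ℂ := fun ξ => Complex.exp (-(4 * Real.pi ^ 2 * s : ℝ) * ‖ξ‖ ^ 2 +
    2 * Real.pi * Complex.I * (inner ℝ x ξ : ℝ)) with hh
  have hhg : ∀ ξ, h ξ = Complex.exp ((2 * Real.pi * inner ℝ ξ x : ℝ) * Complex.I) * (gm s ξ : ℂ) := by
    intro ξ
    simp only [hh, gm]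
    rw [Complex.ofReal_exp, ← Complex.exp_add, real_inner_comm]
    congr 1
    push_cast
    ring
  have hi : Integrable h := by
    have : h = fun ξ => Complex.exp ((2 * Real.pi * inner ℝ ξ x : ℝ) * Complex.I) * (gm s ξ : ℂ) :=
      funext hhg
    rw [this]
    refine (integrable_gm hs).ofReal.bdd_mul (c := 1) ?_ ?_
    · exact Continuous.aestronglyMeasurable (by fun_prop)
    · exact Eventually.of_forall fun ξ => (Complex.norm_exp_ofReal_mul_I _).le
  have key := VectorFourier.integral_fourierIntegral_smul_eq_flip (L := innerₗ (Ed d))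
    (μ := volume) (ν := volume) Real.continuous_fourierChar continuous_inner
    (f := fun z => (v z : ℂ)) (g := h) hv.ofReal hi
  have key' : ∫ ξ, 𝓕 (fun z => (v z : ℂ)) ξ * h ξ = ∫ z, (v z : ℂ) * 𝓕 h z := by
    simpa using! key
  have hF : ∀ z, 𝓕 h z = (gk d s (x - z) : ℂ) := by
    intro z
    have := fourier_gaussian_innerProductSpace' (V := Ed d) (b := ((4 * Real.pi ^ 2 * s : ℝ) : ℂ))
      (by rw [Complex.ofReal_re]; positivity) x z
    simp only [hh]
    rw [this]
    unfold gk
    rw [Complex.ofReal_mul ((4 * Real.pi * s) ^ (-(d : ℝ) / 2)), Complex.ofReal_exp]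
    congr 1
    · have e1 : ((Real.pi : ℂ) / ((4 * Real.pi ^ 2 * s : ℝ) : ℂ)) =
          (((4 * Real.pi * s)⁻¹ : ℝ) : ℂ) := by
        rw [← Complex.ofReal_div]
        congr 1
        field_simp
      rw [e1, finrank_euclideanSpace_fin]
      rw [show ((d : ℂ) / 2) = (((d : ℝ) / 2 : ℝ) : ℂ) by push_cast; ring,
        ← Complex.ofReal_cpow (by positivity)]
      congr 1
      rw [Real.inv_rpow (by positivity), ← Real.rpow_neg (by positivity)]
      congr 1
      ring
    · congr 1
      push_cast
      field_simp
  rw [Real.fourierInv_eq']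
  have e2 : ∀ ξ : Ed d, Complex.exp ((2 * Real.pi * inner ℝ ξ x : ℝ) * Complex.I) •
      ((gm s ξ : ℂ) * 𝓕 (fun z => (v z : ℂ)) ξ) = 𝓕 (fun z => (v z : ℂ)) ξ * h ξ := by
    intro ξ
    rw [hhg, smul_eq_mul]; ring
  simp_rw [e2]
  rw [key']
  unfold heat
  rw [← integral_complex_ofReal]
  congr 1; ext z
  rw [hF]
  push_cast; ring

/-- Averaging a family of bounded multipliers. -/
theorem integral_fourierInv_mul {α : Type*} [TopologicalSpace α] [SecondCountableTopology α]
    [MeasurableSpace α] [OpensMeasurableSpace α] (ν : Measure α) [IsFiniteMeasure ν]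
    {c : α → Ed d → ℂ} (hc : Continuous (Function.uncurry c)) (h1 : ∀ a ξ, ‖c a ξ‖ ≤ 1)
    {G : Ed d → ℂ} (hG : Integrable G) (x : Ed d) :
    ∫ a, 𝓕⁻ (fun ξ => c a ξ * G ξ) x ∂ν = 𝓕⁻ (fun ξ => (∫ a, c a ξ ∂ν) * G ξ) x := by
  simp_rw [Real.fourierInv_eq']
  rw [integral_integral_swap]
  · congr 1; ext ξ
    rw [integral_smul, integral_mul_const]
  · have h2 : Integrable (Function.uncurry fun (_ : α) (ξ : Ed d) => G ξ) (ν.prod volume) := by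
      have := (integrable_const (μ := ν) (1 : ℂ)).mul_prod hG
      simpa [Function.uncurry_def] using this
    have h3 := h2.bdd_mul (c := 1) (f := fun p : α × Ed d =>
      Complex.exp ((2 * Real.pi * inner ℝ p.2 x : ℝ) * Complex.I) * c p.1 p.2) ?_ ?_
    · refine h3.congr (Eventually.of_forall fun p => ?_)
      simp only [Function.uncurry, smul_eq_mul]; ring
    · have : Continuous fun p : α × Ed d => c p.1 p.2 := hc
      exact Continuous.aestronglyMeasurable (by fun_prop)
    · refine Eventually.of_forall fun p => ?_
      rw [norm_mul, Complex.norm_exp_ofReal_mul_I, one_mul]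
      exact h1 _ _

theorem integrable_gm_mul {s : ℝ} (hs : 0 < s) {v : Ed d → ℝ} (hv : Integrable v) :
    Integrable fun ξ : Ed d => (gm s ξ : ℂ) * 𝓕 (fun z => (v z : ℂ)) ξ := by
  have := (integrable_gm (d := d) hs).ofReal (𝕜 := ℂ) |>.bdd_mul (c := ∫ z, ‖(v z : ℂ)‖)
    (f := 𝓕 (fun z => (v z : ℂ))) (continuous_fourier hv.ofReal).aestronglyMeasurable
    (Eventually.of_forall fun ξ => norm_fourier_le _ ξ)
  exact this.congr (Eventually.of_forall fun ξ => mul_comm _ _)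

theorem ofReal_AHr_eq_fourierInv [Fact (3 ≤ d)] {s : ℝ} (hs : 0 < s) {t : ℝ} (ht : 0 ≤ t)
    {v : Ed d → ℝ} (hv : Integrable v) (x : Ed d) : (AHr t s v x : ℂ) =
      𝓕⁻ (fun ξ : Ed d => (sphCos d (t * (2 * Real.pi * ‖ξ‖)) : ℂ) * ((gm s ξ : ℂ) *
        𝓕 (fun z => (v z : ℂ)) ξ)) x := by
  have hπ := Real.pi_pos
  unfold AHr
  rw [← integral_complex_ofReal]
  simp_rw [ofReal_heat_eq_fourierInv hs hv]
  have h := integral_fourierInv_mul (sphereProb d)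
    (c := fun y ξ => Complex.exp ((-(2 * Real.pi * t) * inner ℝ (y : Ed d) ξ : ℝ) * Complex.I))
    (by simp only [Function.uncurry_def]; fun_prop)
    (fun y ξ => (Complex.norm_exp_ofReal_mul_I _).le) (integrable_gm_mul hs hv) x
  refine Eq.trans ?_ (h.trans ?_)
  · refine integral_congr_ae (Eventually.of_forall fun y => ?_)
    simp only [Real.fourierInv_eq']
    refine integral_congr_ae (Eventually.of_forall fun ξ => ?_)
    dsimp only
    rw [smul_eq_mul, smul_eq_mul, ← mul_assoc (Complex.exp _) (Complex.exp _), ← Complex.exp_add]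
    congr 2
    rw [inner_sub_right, inner_smul_right, real_inner_comm ξ]
    push_cast
    ring
  · refine congrArg (fun g : Ed d → ℂ => (𝓕⁻ g : Ed d → ℂ) x) (funext fun ξ => ?_)
    congr 1
    have := integral_cexp_inner (d := d) (-(2 * Real.pi * t) • ξ)
    rw [norm_smul, Real.norm_eq_abs, abs_neg, abs_of_nonneg (by positivity)] at this
    rw [show t * (2 * Real.pi * ‖ξ‖) = 2 * Real.pi * t * ‖ξ‖ by ring, ← this]
    congr 1; ext y
    rw [inner_smul_right, mul_comm]

end

section

open FourierTransform Polynomial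

variable {d : ℕ}

/-- The linear functional on polynomials with `X ^ j ↦ a j`. -/
def lam (a : ℕ → ℝ) (P : ℝ[X]) : ℝ := P.sum fun j p => p * a j

theorem lam_eq_sum (a : ℕ → ℝ) (P : ℝ[X]) : lam a P = ∑ j ∈ P.support, P.coeff j * a j := rfl

theorem lam_add (a : ℕ → ℝ) (P Q : ℝ[X]) : lam a (P + Q) = lam a P + lam a Q :=
  sum_add_index P Q _ (by simp) (by intros; ring)

theorem lam_neg (a : ℕ → ℝ) (P : ℝ[X]) : lam a (-P) = -lam a P := by
  have h := lam_add a P (-P)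
  rw [add_neg_cancel] at h
  have h0 : lam a 0 = 0 := sum_zero_index _
  linarith

theorem lam_sub (a : ℕ → ℝ) (P Q : ℝ[X]) : lam a (P - Q) = lam a P - lam a Q := by
  rw [sub_eq_add_neg, lam_add, lam_neg, sub_eq_add_neg]

theorem lam_C_mul_X_pow (a : ℕ → ℝ) (c : ℝ) (n : ℕ) : lam a (C c * X ^ n) = c * a n := by
  unfold lam
  rw [C_mul_X_pow_eq_monomial, sum_monomial_index _ _ (by simp)]

theorem lam_one (a : ℕ → ℝ) : lam a 1 = a 0 := by
  simpa using lam_C_mul_X_pow a 1 0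

theorem lam_X_mul (a : ℕ → ℝ) (P : ℝ[X]) : lam a (X * P) = lam (fun j => a (j + 1)) P := by
  induction P using Polynomial.induction_on' with
  | add p q hp hq => rw [mul_add, lam_add, lam_add, hp, hq]
  | monomial n c =>
    rw [← C_mul_X_pow_eq_monomial, lam_C_mul_X_pow, ← lam_C_mul_X_pow a c (n + 1)]
    congr 1
    ring

theorem lam_one_sub_X_mul (a : ℕ → ℝ) (P : ℝ[X]) :
    lam a ((1 - X) * P) = lam (fun j => a j - a (j + 1)) P := by
  rw [sub_mul, one_mul, lam_sub, lam_X_mul]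
  simp only [lam_eq_sum, ← Finset.sum_sub_distrib, mul_sub]

theorem lam_pow (P : ℝ[X]) (z : ℝ) : lam (fun j => z ^ j) P = P.eval z := by
  rw [eval_eq_sum]; rfl

theorem lam_const_mul (c : ℝ) (a : ℕ → ℝ) (P : ℝ[X]) :
    lam (fun j => c * a j) P = c * lam a P := by
  simp only [lam_eq_sum, Finset.mul_sum]
  exact Finset.sum_congr rfl fun j _ => by ring

/-- The polynomial `((1 + X + X² + X³)^d - 1) / X`. -/
def polyR (d : ℕ) : ℝ[X] := divX ((1 + X + X ^ 2 + X ^ 3) ^ d)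

/-- The polynomial encoding the frequency cut-off at a single dyadic scale. -/
def polyS (d : ℕ) : ℝ[X] := (1 - X) ^ (d - 1) * polyR d

theorem X_mul_polyR (d : ℕ) : X * polyR d = (1 + X + X ^ 2 + X ^ 3) ^ d - 1 := by
  have h := divX_mul_X_add ((1 + X + X ^ 2 + X ^ 3 : ℝ[X]) ^ d)
  have h0 : ((1 + X + X ^ 2 + X ^ 3 : ℝ[X]) ^ d).coeff 0 = 1 := by
    rw [coeff_zero_eq_eval_zero]; simp
  rw [h0, C_1] at h
  unfold polyR
  rw [mul_comm]
  exact eq_sub_of_add_eq h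

/-- The scale-`τ` piece of the spherical mean of radius `t`. -/
def Qop (t τ : ℝ) (v : Ed d → ℝ) (x : Ed d) : ℝ :=
  lam (fun j => AHr t ((j + 2 / 3) * τ) v x) (polyS d)

/-- The Fourier multiplier of the scale-`τ` frequency cut-off. -/
def Qm (τ : ℝ) (ξ : Ed d) : ℝ := lam (fun j => gm ((j + 2 / 3) * τ) ξ) (polyS d)

@[fun_prop]
theorem continuous_Qm {τ : ℝ} : Continuous (Qm (d := d) τ) := by
  unfold Qm
  simp only [lam_eq_sum]
  fun_prop

theorem Qm_eq (δ : ℝ) (ξ : Ed d) : Qm (δ ^ 2) ξ =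
    Real.exp (-(2 / 3 * (δ * (2 * Real.pi * ‖ξ‖)) ^ 2)) *
      (polyS d).eval (Real.exp (-(δ * (2 * Real.pi * ‖ξ‖)) ^ 2)) := by
  unfold Qm
  rw [← lam_pow, ← lam_const_mul]
  congr 1; ext j
  unfold gm
  rw [← Real.exp_nat_mul, ← Real.exp_add]
  congr 1
  ring

theorem abs_eval_polyS_le (d : ℕ) : ∃ C : ℝ, 0 < C ∧ ∀ y : ℝ, 0 ≤ y →
    |(polyS d).eval (Real.exp (-y))| ≤ C * min 1 y ^ (d - 1) := by
  obtain ⟨K, hK⟩ := (isCompact_Icc (a := (0 : ℝ)) (b := 1)).exists_bound_of_continuousOn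
    (f := fun z => (polyR d).eval z) (by fun_prop)
  refine ⟨|K| + 1, by positivity, fun y hy => ?_⟩
  have hz0 := Real.exp_pos (-y)
  have hz1 : Real.exp (-y) ≤ 1 := by rw [Real.exp_le_one_iff]; linarith
  have h1 := hK (Real.exp (-y)) ⟨hz0.le, hz1⟩
  unfold polyS
  rw [eval_mul, abs_mul, mul_comm]
  have h2 : |((1 - X : ℝ[X]) ^ (d - 1)).eval (Real.exp (-y))| ≤ min 1 y ^ (d - 1) := by
    rw [eval_pow, abs_pow]
    refine pow_le_pow_left₀ (abs_nonneg _) ?_ _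
    simp only [eval_sub, eval_one, eval_X]
    rw [abs_of_nonneg (by linarith)]
    refine le_min (by linarith) ?_
    have := Real.add_one_le_exp (-y)
    linarith
  refine mul_le_mul ?_ h2 (abs_nonneg _) (by positivity)
  have := le_abs_self K
  rw [Real.norm_eq_abs] at h1
  linarith

theorem Qm_sq_le (d : ℕ) : ∃ C : ℝ, 0 < C ∧ ∀ (δ : ℝ), 0 < δ → ∀ ξ : Ed d,
    (1 + (δ * (2 * Real.pi * ‖ξ‖)) ^ 2) * Qm (δ ^ 2) ξ ^ 2 ≤
      C * (δ * (2 * Real.pi * ‖ξ‖)) ^ (d - 1) := by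
  obtain ⟨C, hC, h⟩ := abs_eval_polyS_le d
  refine ⟨C ^ 2, by positivity, fun δ hδ ξ => ?_⟩
  rw [Qm_eq]
  have hζ : 0 ≤ δ * (2 * Real.pi * ‖ξ‖) := by have := Real.pi_pos; positivity
  generalize δ * (2 * Real.pi * ‖ξ‖) = ζ at hζ ⊢
  have h1 := h (ζ ^ 2) (by positivity)
  have h2 : (polyS d).eval (Real.exp (-ζ ^ 2)) ^ 2 ≤ C ^ 2 * ζ ^ (d - 1) := by
    rw [← sq_abs]
    calc |(polyS d).eval (Real.exp (-ζ ^ 2))| ^ 2 ≤ (C * min 1 (ζ ^ 2) ^ (d - 1)) ^ 2 := by gcongr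
      _ = C ^ 2 * ((min 1 (ζ ^ 2)) ^ 2) ^ (d - 1) := by ring
      _ ≤ C ^ 2 * ζ ^ (d - 1) := by
        gcongr
        rcases le_total ζ 1 with h | h
        · have h3 : min 1 (ζ ^ 2) ≤ ζ := (min_le_right _ _).trans (by nlinarith)
          have h4 : 0 ≤ min 1 (ζ ^ 2) := le_min zero_le_one (sq_nonneg _)
          nlinarith
        · have h3 : min 1 (ζ ^ 2) ≤ 1 := min_le_left _ _
          have h4 : 0 ≤ min 1 (ζ ^ 2) := le_min zero_le_one (sq_nonneg _)
          nlinarith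
  have h3 : (1 + ζ ^ 2) * Real.exp (-(2 / 3 * ζ ^ 2)) ^ 2 ≤ 1 := by
    rw [← Real.exp_nat_mul]
    have h4 := Real.add_one_le_exp (ζ ^ 2)
    have h5 : Real.exp (ζ ^ 2) * Real.exp ((2 : ℕ) * -(2 / 3 * ζ ^ 2)) ≤ 1 := by
      rw [← Real.exp_add, Real.exp_le_one_iff]
      push_cast
      nlinarith [sq_nonneg ζ]
    refine le_trans ?_ h5
    gcongr
    linarith
  calc _ = (1 + ζ ^ 2) * Real.exp (-(2 / 3 * ζ ^ 2)) ^ 2 *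
        (polyS d).eval (Real.exp (-ζ ^ 2)) ^ 2 := by ring
    _ ≤ 1 * (polyS d).eval (Real.exp (-ζ ^ 2)) ^ 2 := by gcongr
    _ ≤ _ := by rw [one_mul]; exact h2

theorem Qm_sq_mul_le [Fact (3 ≤ d)] : ∃ C : ℝ, 0 < C ∧ ∀ (δ : ℝ), 0 < δ → ∀ t, 0 < t → ∀ ξ : Ed d,
    (1 + (δ * (2 * Real.pi * ‖ξ‖)) ^ 2) * Qm (δ ^ 2) ξ ^ 2 *
      (sphCos d (t * (2 * Real.pi * ‖ξ‖)) ^ 2 + sphCos1 d (t * (2 * Real.pi * ‖ξ‖)) ^ 2) ≤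
      C * (δ / t) ^ (d - 1) := by
  obtain ⟨C1, hC1, h1⟩ := Qm_sq_le d
  obtain ⟨C2, hC2, h2⟩ := sphCos_decay (d := d)
  refine ⟨C1 * C2, by positivity, fun δ hδ t ht ξ => ?_⟩
  have hρ : 0 ≤ 2 * Real.pi * ‖ξ‖ := by have := Real.pi_pos; positivity
  have e1 := h1 δ hδ ξ
  generalize 2 * Real.pi * ‖ξ‖ = ρ at hρ e1 ⊢
  have hd : d - 1 ≠ 0 := by have := (Fact.out : 3 ≤ d); omega
  rcases hρ.eq_or_lt with h0 | h0
  · rw [← h0] at e1 ⊢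
    rw [mul_zero, zero_pow hd, mul_zero] at e1
    refine (mul_nonpos_of_nonpos_of_nonneg ?_ (by positivity)).trans (by positivity)
    simpa using e1
  · have e2 := h2 (t * ρ) (by positivity)
    calc _ ≤ C1 * (δ * ρ) ^ (d - 1) * (sphCos d (t * ρ) ^ 2 + sphCos1 d (t * ρ) ^ 2) := by gcongr
      _ = C1 * (δ / t) ^ (d - 1) *
          ((t * ρ) ^ (d - 1) * (sphCos d (t * ρ) ^ 2 + sphCos1 d (t * ρ) ^ 2)) := by
        rw [mul_pow, mul_pow, div_pow]
        field_simp
      _ ≤ C1 * (δ / t) ^ (d - 1) * C2 := by gcongr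
      _ = _ := by ring

theorem integrable_norm_mul_gm {s : ℝ} (hs : 0 < s) :
    Integrable fun ξ : Ed d => ‖ξ‖ * gm s ξ := by
  refine ((integrable_gm (d := d) (half_pos hs)).const_mul (1 + 2 / s)).mono'
    (Continuous.aestronglyMeasurable (by fun_prop)) (Eventually.of_forall fun ξ => ?_)
  rw [norm_mul, norm_norm, Real.norm_of_nonneg (gm_pos _ _).le]
  have e1 : gm s ξ = gm (s / 2) ξ * gm (s / 2) ξ := by
    unfold gm; rw [← Real.exp_add]; congr 1; ring
  rw [e1, ← mul_assoc]
  gcongr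
  · exact (gm_pos _ _).le
  have hπ : 1 ≤ Real.pi ^ 2 := by nlinarith [Real.pi_gt_three]
  have h1 : gm (s / 2) ξ * (1 + s / 2 * ‖ξ‖ ^ 2) ≤ 1 := by
    have h2 : 1 + s / 2 * ‖ξ‖ ^ 2 ≤ Real.exp (4 * Real.pi ^ 2 * (s / 2) * ‖ξ‖ ^ 2) := by
      have := Real.add_one_le_exp (4 * Real.pi ^ 2 * (s / 2) * ‖ξ‖ ^ 2)
      have h3 : 0 ≤ s / 2 * ‖ξ‖ ^ 2 := by positivity
      nlinarith
    unfold gm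
    calc _ ≤ Real.exp (-(4 * Real.pi ^ 2 * (s / 2) * ‖ξ‖ ^ 2)) *
        Real.exp (4 * Real.pi ^ 2 * (s / 2) * ‖ξ‖ ^ 2) := by gcongr
      _ = 1 := by rw [← Real.exp_add]; simp
  have h4 : ‖ξ‖ ≤ (1 + 2 / s) * (1 + s / 2 * ‖ξ‖ ^ 2) := by
    have : (1 + 2 / s) * (1 + s / 2 * ‖ξ‖ ^ 2) = 1 + 2 / s + s / 2 * ‖ξ‖ ^ 2 + ‖ξ‖ ^ 2 := by
      field_simp; ring
    rw [this]
    have : 0 ≤ 2 / s + s / 2 * ‖ξ‖ ^ 2 := by positivity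
    nlinarith [sq_nonneg (‖ξ‖ - 1)]
  calc ‖ξ‖ * gm (s / 2) ξ ≤ (1 + 2 / s) * (1 + s / 2 * ‖ξ‖ ^ 2) * gm (s / 2) ξ :=
        mul_le_mul_of_nonneg_right h4 (gm_pos _ _).le
    _ = (1 + 2 / s) * (gm (s / 2) ξ * (1 + s / 2 * ‖ξ‖ ^ 2)) := by ring
    _ ≤ (1 + 2 / s) * 1 := by gcongr
    _ = _ := mul_one _

theorem integrable_Qm {τ : ℝ} (hτ : 0 < τ) : Integrable (Qm (d := d) τ) := by
  unfold Qm
  simp only [lam_eq_sum]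
  exact integrable_finsetSum _ fun j _ => (integrable_gm (by positivity)).const_mul _

theorem integrable_norm_mul_Qm {τ : ℝ} (hτ : 0 < τ) :
    Integrable fun ξ : Ed d => ‖ξ‖ * Qm τ ξ := by
  unfold Qm
  simp only [lam_eq_sum, Finset.mul_sum]
  refine integrable_finsetSum _ fun j _ => ?_
  refine ((integrable_norm_mul_gm (d := d) (s := (j + 2 / 3) * τ) (by positivity)).const_mul
    ((polyS d).coeff j)).congr (Eventually.of_forall fun ξ => ?_)
  dsimp only
  ring

theorem integrable_mul_fourier {H : Ed d → ℝ} (hH : Integrable H) {v : Ed d → ℝ}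
    (hv : Integrable v) : Integrable fun ξ => (H ξ : ℂ) * 𝓕 (fun z => (v z : ℂ)) ξ := by
  have := hH.ofReal (𝕜 := ℂ) |>.bdd_mul (c := ∫ z, ‖(v z : ℂ)‖)
    (f := 𝓕 (fun z => (v z : ℂ))) (continuous_fourier hv.ofReal).aestronglyMeasurable
    (Eventually.of_forall fun ξ => norm_fourier_le _ ξ)
  exact this.congr (Eventually.of_forall fun ξ => mul_comm _ _)

theorem integrable_fourierChar_smul {G : Ed d → ℂ} (hG : Integrable G) (x : Ed d) :
    Integrable fun ξ => Real.fourierChar (inner ℝ ξ x) • G ξ := by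
  simpa using (Real.fourierIntegral_convergent_iff (f := G) (-x)).2 hG

@[fun_prop]
theorem continuous_sphCos [Fact (3 ≤ d)] : Continuous (sphCos d) :=
  continuous_iff_continuousAt.2 fun r => (hasDerivAt_sphCos r).continuousAt

@[fun_prop]
theorem continuous_sphCos1 [Fact (3 ≤ d)] : Continuous (sphCos1 d) :=
  continuous_iff_continuousAt.2 fun r => (hasDerivAt_sphCos1 r).continuousAt

theorem ofReal_Qop_eq_fourierInv [Fact (3 ≤ d)] {t τ : ℝ} (ht : 0 ≤ t) (hτ : 0 < τ)
    {v : Ed d → ℝ} (hv : Integrable v) (x : Ed d) : (Qop t τ v x : ℂ) =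
      𝓕⁻ (fun ξ : Ed d => (sphCos d (t * (2 * Real.pi * ‖ξ‖)) : ℂ) * ((Qm τ ξ : ℂ) *
        𝓕 (fun z => (v z : ℂ)) ξ)) x := by
  unfold Qop
  rw [lam_eq_sum]
  push_cast
  have hs : ∀ j : ℕ, 0 < ((j : ℝ) + 2 / 3) * τ := fun j => by positivity
  simp_rw [ofReal_AHr_eq_fourierInv (hs _) ht hv, Real.fourierInv_eq, ← integral_const_mul]
  rw [← integral_finsetSum]
  · refine integral_congr_ae (Eventually.of_forall fun ξ => ?_)
    simp only [Qm, lam_eq_sum, Circle.smul_def, smul_eq_mul]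
    push_cast
    rw [Finset.sum_mul, Finset.mul_sum, Finset.mul_sum]
    exact Finset.sum_congr rfl fun j _ => by ring
  · intro j _
    refine Integrable.const_mul (integrable_fourierChar_smul ?_ x) _
    refine (integrable_gm_mul (hs j) hv).bdd_mul (c := 1) ?_ ?_
    · exact Continuous.aestronglyMeasurable (by fun_prop)
    · refine Eventually.of_forall fun ξ => ?_
      rw [Complex.norm_real]
      exact abs_sphCos_le _

end

section

open FourierTransform

variable {d : ℕ}

theorem ennreal_add_sq_le (a b : ℝ≥0∞) : (a + b) ^ 2 ≤ 2 * a ^ 2 + 2 * b ^ 2 := by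
  rcases eq_or_ne a ⊤ with rfl | ha
  · simp
  rcases eq_or_ne b ⊤ with rfl | hb
  · simp
  lift a to ℝ≥0 using ha
  lift b to ℝ≥0 using hb
  norm_cast
  rw [← NNReal.coe_le_coe]
  push_cast
  nlinarith [sq_nonneg ((a : ℝ) - b)]

theorem sq_lintegral_le {α : Type*} [MeasurableSpace α] (ν : Measure α) {f : α → ℝ≥0∞}
    (hf : AEMeasurable f ν) : (∫⁻ a, f a ∂ν) ^ 2 ≤ ν univ * ∫⁻ a, f a ^ 2 ∂ν := by
  have h := ENNReal.lintegral_mul_le_Lp_mul_Lq ν Real.HolderConjugate.two_two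
    (aemeasurable_const (b := (1 : ℝ≥0∞))) hf
  simp only [Pi.mul_apply, one_mul, ENNReal.one_rpow, lintegral_const] at h
  have h2 := pow_le_pow_left₀ (zero_le) h 2
  refine h2.trans (le_of_eq ?_)
  rw [mul_pow, ← ENNReal.rpow_natCast, ← ENNReal.rpow_natCast, ← ENNReal.rpow_mul,
    ← ENNReal.rpow_mul]
  norm_num

theorem lintegral_fourierInv_le {H : Ed d → ℂ} (hH : Continuous H) (hi : Integrable H)
    {v : Ed d → ℝ} (hv : Integrable v) (hv2 : MemLp v 2) {B : ℝ} (hB : 0 ≤ B)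
    (h : ∀ ξ, ‖H ξ‖ ^ 2 ≤ B * ‖𝓕 (fun z => (v z : ℂ)) ξ‖ ^ 2) :
    ∫⁻ x, ‖𝓕⁻ H x‖ₑ ^ 2 ≤ ENNReal.ofReal B * ∫⁻ x, ‖v x‖ₑ ^ 2 := by
  have e1 : ∫⁻ x, ‖𝓕 (fun z => (v z : ℂ)) x‖ₑ ^ 2 = ∫⁻ x, ‖v x‖ₑ ^ 2 := by
    refine (lintegral_enorm_sq_fourier (G := fun z => (v z : ℂ)) hv.ofReal hv2.ofReal).trans ?_
    congr 1; ext x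
    rw [← ofReal_norm, Complex.norm_real, ofReal_norm]
  have e2 : ∀ ξ, ‖H ξ‖ₑ ^ 2 ≤ ENNReal.ofReal B * ‖𝓕 (fun z => (v z : ℂ)) ξ‖ₑ ^ 2 := by
    intro ξ
    rw [← ofReal_norm, ← ofReal_norm, ← ENNReal.ofReal_pow (norm_nonneg _),
      ← ENNReal.ofReal_pow (norm_nonneg _), ← ENNReal.ofReal_mul hB]
    exact ENNReal.ofReal_le_ofReal (h ξ)
  have e3 : ∫⁻ ξ, ‖H ξ‖ₑ ^ 2 ≤ ENNReal.ofReal B * ∫⁻ x, ‖v x‖ₑ ^ 2 := by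
    rw [← e1, ← lintegral_const_mul' _ _ ENNReal.ofReal_ne_top]
    exact lintegral_mono e2
  have hm : MemLp H 2 := by
    refine ⟨hH.aestronglyMeasurable, ?_⟩
    rw [eLpNorm_lt_top_iff_lintegral_rpow_enorm_lt_top two_ne_zero ENNReal.ofNat_ne_top]
    have := (eLpNorm_lt_top_iff_lintegral_rpow_enorm_lt_top two_ne_zero
      ENNReal.ofNat_ne_top).1 hv2.2
    simp only [ENNReal.toReal_ofNat, ENNReal.rpow_ofNat] at this ⊢
    exact e3.trans_lt (ENNReal.mul_lt_top ENNReal.ofReal_lt_top this)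
  rw [lintegral_enorm_sq_fourierInv hi hm]
  exact e3

variable [Fact (3 ≤ d)]

/-- The derivative in `t` of `Qop t τ v`. -/
def QopD (t τ : ℝ) (v : Ed d → ℝ) (x : Ed d) : ℂ :=
  𝓕⁻ (fun ξ : Ed d => (sphCos1 d (t * (2 * Real.pi * ‖ξ‖)) : ℂ) *
    (((2 * Real.pi * ‖ξ‖ * Qm τ ξ : ℝ) : ℂ) * 𝓕 (fun z => (v z : ℂ)) ξ)) x

theorem integrable_two_pi_norm_mul_Qm {τ : ℝ} (hτ : 0 < τ) :
    Integrable fun ξ : Ed d => 2 * Real.pi * ‖ξ‖ * Qm τ ξ := by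
  refine ((integrable_norm_mul_Qm (d := d) hτ).const_mul (2 * Real.pi)).congr
    (Eventually.of_forall fun ξ => ?_)
  dsimp only
  ring

theorem measurable_QopD {τ : ℝ} {v : Ed d → ℝ} (hv : Integrable v) :
    Measurable fun p : ℝ × Ed d => QopD p.1 τ v p.2 := by
  unfold QopD
  simp_rw [Real.fourierInv_eq']
  have hF : Continuous (𝓕 (fun z => (v z : ℂ))) := continuous_fourier hv.ofReal
  have : Continuous (Function.uncurry fun (p : ℝ × Ed d) (ξ : Ed d) =>
      Complex.exp (((2 * Real.pi * inner ℝ ξ p.2 : ℝ) : ℂ) * Complex.I) •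
      ((sphCos1 d (p.1 * (2 * Real.pi * ‖ξ‖)) : ℂ) *
    (((2 * Real.pi * ‖ξ‖ * Qm τ ξ : ℝ) : ℂ) * 𝓕 (fun z => (v z : ℂ)) ξ))) := by
    simp only [Function.uncurry_def]
    fun_prop
  exact (this.stronglyMeasurable.integral_prod_right (ν := volume)).measurable

theorem Qop_sub_eq {t₀ t τ : ℝ} (h0 : 0 ≤ t₀) (h : t₀ ≤ t) (hτ : 0 < τ)
    {v : Ed d → ℝ} (hv : Integrable v) (x : Ed d) :
    (Qop t τ v x : ℂ) - (Qop t₀ τ v x : ℂ) = ∫ s in Ioc t₀ t, QopD s τ v x := by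
  have hi := integrable_mul_fourier (integrable_Qm (d := d) hτ) hv
  have hc : ∀ s : ℝ, Integrable fun ξ : Ed d => (sphCos d (s * (2 * Real.pi * ‖ξ‖)) : ℂ) *
      ((Qm τ ξ : ℂ) * 𝓕 (fun z => (v z : ℂ)) ξ) := fun s => by
    refine hi.bdd_mul (c := 1) (Continuous.aestronglyMeasurable (by fun_prop)) ?_
    refine Eventually.of_forall fun ξ => ?_
    rw [Complex.norm_real]
    exact abs_sphCos_le _
  rw [ofReal_Qop_eq_fourierInv (h0.trans h) hτ hv, ofReal_Qop_eq_fourierInv h0 hτ hv]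
  unfold QopD
  rw [integral_fourierInv_mul (volume.restrict (Ioc t₀ t))
    (c := fun s ξ => (sphCos1 d (s * (2 * Real.pi * ‖ξ‖)) : ℂ))
    (by simp only [Function.uncurry_def]; fun_prop)
    (fun s ξ => by rw [Complex.norm_real]; exact abs_sphCos1_le _)
    (integrable_mul_fourier (integrable_two_pi_norm_mul_Qm hτ) hv)]
  simp_rw [Real.fourierInv_eq]
  rw [← integral_sub (integrable_fourierChar_smul (hc t) x)
    (integrable_fourierChar_smul (hc t₀) x)]
  refine integral_congr_ae (Eventually.of_forall fun ξ => ?_)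
  dsimp only
  rw [← smul_sub, ← sub_mul]
  congr 1
  have key : (∫ s in Ioc t₀ t, sphCos1 d (s * (2 * Real.pi * ‖ξ‖))) * (2 * Real.pi * ‖ξ‖) =
      sphCos d (t * (2 * Real.pi * ‖ξ‖)) - sphCos d (t₀ * (2 * Real.pi * ‖ξ‖)) := by
    rw [← integral_mul_const, ← intervalIntegral.integral_of_le h,
      intervalIntegral.integral_eq_sub_of_hasDerivAt
        (f := fun s => sphCos d (s * (2 * Real.pi * ‖ξ‖)))]
    · intro s _
      have h1 : HasDerivAt (fun s : ℝ => s * (2 * Real.pi * ‖ξ‖)) (2 * Real.pi * ‖ξ‖) s := by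
        simpa using (hasDerivAt_id s).mul_const (2 * Real.pi * ‖ξ‖)
      exact (hasDerivAt_sphCos _).comp s h1
    · exact Continuous.intervalIntegrable (by fun_prop) _ _
  rw [integral_complex_ofReal, ← Complex.ofReal_sub, ← key]
  push_cast
  ring

/-- A local maximal bound for `Qop` on an interval of radii of length `δ`. -/
theorem exists_local_maximal : ∃ C : ℝ, 0 < C ∧ ∀ (δ b t₀ : ℝ), 0 < δ → 0 < b → b ≤ t₀ →
    ∀ v : Ed d → ℝ, Integrable v → MemLp v 2 → ∃ Z : Ed d → ℝ≥0∞, Measurable Z ∧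
      (∀ x, ∀ t ∈ Icc t₀ (t₀ + δ), ‖Qop t (δ ^ 2) v x‖ₑ ^ 2 ≤ Z x) ∧
      ∫⁻ x, Z x ≤ ENNReal.ofReal (C * (δ / b) ^ (d - 1)) * ∫⁻ x, ‖v x‖ₑ ^ 2 := by
  obtain ⟨C, hC, hm⟩ := Qm_sq_mul_le (d := d)
  refine ⟨4 * C, by positivity, fun δ b t₀ hδ hb hbt v hv hv2 => ?_⟩
  have ht₀ := hb.trans_le hbt
  have hτ : 0 < δ ^ 2 := by positivity
  have hπ := Real.pi_pos
  have hF : Continuous (𝓕 (fun z => (v z : ℂ))) := continuous_fourier hv.ofReal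
  have hmb : ∀ t, t₀ ≤ t → ∀ ξ : Ed d, (1 + (δ * (2 * Real.pi * ‖ξ‖)) ^ 2) * Qm (δ ^ 2) ξ ^ 2 *
      (sphCos d (t * (2 * Real.pi * ‖ξ‖)) ^ 2 + sphCos1 d (t * (2 * Real.pi * ‖ξ‖)) ^ 2) ≤
      C * (δ / b) ^ (d - 1) := by
    intro t ht ξ
    refine (hm δ hδ t (ht₀.trans_le ht) ξ).trans ?_
    gcongr
    · exact div_nonneg hδ.le (ht₀.le.trans ht)
    · exact hbt.trans ht
  set B := C * (δ / b) ^ (d - 1)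
  have hB : 0 ≤ B := by positivity
  have l2Q : ∫⁻ x, ‖Qop t₀ (δ ^ 2) v x‖ₑ ^ 2 ≤ ENNReal.ofReal B * ∫⁻ x, ‖v x‖ₑ ^ 2 := by
    have hi := integrable_mul_fourier (integrable_Qm (d := d) hτ) hv
    have := lintegral_fourierInv_le (H := fun ξ : Ed d =>
      (sphCos d (t₀ * (2 * Real.pi * ‖ξ‖)) : ℂ) * ((Qm (δ ^ 2) ξ : ℂ) *
        𝓕 (fun z => (v z : ℂ)) ξ)) (by fun_prop) (hi.bdd_mul (c := 1)
          (Continuous.aestronglyMeasurable (by fun_prop)) (Eventually.of_forall fun ξ => by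
            rw [Complex.norm_real]; exact abs_sphCos_le _)) hv hv2 hB ?_
    · refine le_of_eq_of_le ?_ this
      congr 1; ext x
      rw [← ofReal_Qop_eq_fourierInv ht₀.le hτ hv, ← ofReal_norm, ← ofReal_norm,
        Complex.norm_real]
    · intro ξ
      rw [norm_mul, norm_mul, ← mul_assoc, mul_pow]
      gcongr
      rw [Complex.norm_real, Complex.norm_real, Real.norm_eq_abs, Real.norm_eq_abs, mul_pow,
        sq_abs, sq_abs]
      refine le_trans ?_ (hmb t₀ le_rfl ξ)
      have h1 : 0 ≤ (δ * (2 * Real.pi * ‖ξ‖)) ^ 2 := by positivity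
      rw [mul_comm]
      gcongr
      · exact le_mul_of_one_le_left (sq_nonneg _) (by linarith)
      · have := sq_nonneg (sphCos1 d (t₀ * (2 * Real.pi * ‖ξ‖)))
        linarith
  have l2D : ∀ s, t₀ ≤ s → ∫⁻ x, ‖QopD s (δ ^ 2) v x‖ₑ ^ 2 ≤
      ENNReal.ofReal (B / δ ^ 2) * ∫⁻ x, ‖v x‖ₑ ^ 2 := by
    intro s hs
    have hi := integrable_mul_fourier (integrable_two_pi_norm_mul_Qm (d := d) hτ) hv
    refine lintegral_fourierInv_le (by fun_prop) (hi.bdd_mul (c := 1)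
          (Continuous.aestronglyMeasurable (by fun_prop)) (Eventually.of_forall fun ξ => by
            rw [Complex.norm_real]; exact abs_sphCos1_le _)) hv hv2 (by positivity) ?_
    intro ξ
    rw [norm_mul, norm_mul, ← mul_assoc, mul_pow]
    gcongr
    rw [Complex.norm_real, Complex.norm_real, Real.norm_eq_abs, Real.norm_eq_abs, mul_pow,
        sq_abs, sq_abs, le_div_iff₀ hτ]
    refine le_trans ?_ (hmb s hs ξ)
    have e1 : sphCos1 d (s * (2 * Real.pi * ‖ξ‖)) ^ 2 * (2 * Real.pi * ‖ξ‖ * Qm (δ ^ 2) ξ) ^ 2 *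
      δ ^ 2 = (δ * (2 * Real.pi * ‖ξ‖)) ^ 2 * Qm (δ ^ 2) ξ ^ 2 *
        sphCos1 d (s * (2 * Real.pi * ‖ξ‖)) ^ 2 := by ring
    rw [e1]
    gcongr
    · linarith
    · have := sq_nonneg (sphCos d (s * (2 * Real.pi * ‖ξ‖)))
      linarith
  have hmD := measurable_QopD (τ := δ ^ 2) hv
  have hQc : Measurable fun x => ‖Qop t₀ (δ ^ 2) v x‖ₑ ^ 2 := by
    have hi := integrable_mul_fourier (integrable_Qm (d := d) hτ) hv
    have hc := continuous_fourierInv (hi.bdd_mul (c := 1)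
      (f := fun ξ : Ed d => (sphCos d (t₀ * (2 * Real.pi * ‖ξ‖)) : ℂ))
          (Continuous.aestronglyMeasurable (by fun_prop)) (Eventually.of_forall fun ξ => by
            rw [Complex.norm_real]; exact abs_sphCos_le _))
    have : (fun x => ‖Qop t₀ (δ ^ 2) v x‖ₑ ^ 2) = fun x => ‖𝓕⁻ (fun ξ : Ed d =>
      (sphCos d (t₀ * (2 * Real.pi * ‖ξ‖)) : ℂ) * ((Qm (δ ^ 2) ξ : ℂ) *
        𝓕 (fun z => (v z : ℂ)) ξ)) x‖ₑ ^ 2 := by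
      ext x
      rw [← ofReal_Qop_eq_fourierInv ht₀.le hτ hv, ← ofReal_norm, ← ofReal_norm,
        Complex.norm_real]
    rw [this]
    exact hc.measurable.enorm.pow_const 2
  have hmD' : Measurable fun p : Ed d × ℝ => ‖QopD p.2 (δ ^ 2) v p.1‖ₑ ^ 2 :=
    (hmD.comp measurable_swap).enorm.pow_const 2
  refine ⟨fun x => 2 * ‖Qop t₀ (δ ^ 2) v x‖ₑ ^ 2 + 2 * (ENNReal.ofReal δ *
    ∫⁻ s in Ioc t₀ (t₀ + δ), ‖QopD s (δ ^ 2) v x‖ₑ ^ 2), ?_, ?_, ?_⟩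
  · exact (hQc.const_mul 2).add ((hmD'.lintegral_prod_right'.const_mul _).const_mul 2)
  · intro x t ht
    have hDx : Measurable fun s => ‖QopD s (δ ^ 2) v x‖ₑ :=
      (hmD.comp (measurable_id.prodMk measurable_const)).enorm
    have e1 : ‖Qop t (δ ^ 2) v x‖ₑ ≤ ‖Qop t₀ (δ ^ 2) v x‖ₑ +
        ∫⁻ s in Ioc t₀ t, ‖QopD s (δ ^ 2) v x‖ₑ := by
      have h1 := Qop_sub_eq ht₀.le ht.1 hτ hv x
      have h2 : ((Qop t (δ ^ 2) v x - Qop t₀ (δ ^ 2) v x : ℝ) : ℂ) =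
        ∫ s in Ioc t₀ t, QopD s (δ ^ 2) v x := by rw [← h1]; push_cast; rfl
      have h3 : ‖Qop t (δ ^ 2) v x - Qop t₀ (δ ^ 2) v x‖ₑ ≤
          ∫⁻ s in Ioc t₀ t, ‖QopD s (δ ^ 2) v x‖ₑ := by
        rw [← ofReal_norm, ← Complex.norm_real, h2, ofReal_norm]
        exact enorm_integral_le_lintegral_enorm _
      calc ‖Qop t (δ ^ 2) v x‖ₑ = ‖Qop t₀ (δ ^ 2) v x +
            (Qop t (δ ^ 2) v x - Qop t₀ (δ ^ 2) v x)‖ₑ := by congr 1; ring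
        _ ≤ _ := (enorm_add_le _ _).trans (add_le_add le_rfl h3)
    have e2 : (∫⁻ s in Ioc t₀ t, ‖QopD s (δ ^ 2) v x‖ₑ) ^ 2 ≤ ENNReal.ofReal δ *
        ∫⁻ s in Ioc t₀ (t₀ + δ), ‖QopD s (δ ^ 2) v x‖ₑ ^ 2 := by
      have hsub : Ioc t₀ t ⊆ Ioc t₀ (t₀ + δ) := Ioc_subset_Ioc_right ht.2
      calc _ ≤ (∫⁻ s in Ioc t₀ (t₀ + δ), ‖QopD s (δ ^ 2) v x‖ₑ) ^ 2 := by
            exact pow_le_pow_left' (lintegral_mono_set hsub) 2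
        _ ≤ _ := sq_lintegral_le _ hDx.aemeasurable
        _ = _ := by simp
    calc _ ≤ (‖Qop t₀ (δ ^ 2) v x‖ₑ + ∫⁻ s in Ioc t₀ t, ‖QopD s (δ ^ 2) v x‖ₑ) ^ 2 := pow_le_pow_left' e1 2
      _ ≤ _ := ennreal_add_sq_le _ _
      _ ≤ _ := add_le_add le_rfl (mul_le_mul_right e2 2)
  · rw [lintegral_add_left (hQc.const_mul 2), lintegral_const_mul' _ _ (by simp),
      lintegral_const_mul' _ _ (by simp), lintegral_const_mul' _ _ ENNReal.ofReal_ne_top,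
      lintegral_lintegral_swap hmD'.aemeasurable]
    have e1 : ∫⁻ s in Ioc t₀ (t₀ + δ), ∫⁻ x, ‖QopD s (δ ^ 2) v x‖ₑ ^ 2 ≤
        ENNReal.ofReal δ * (ENNReal.ofReal (B / δ ^ 2) * ∫⁻ x, ‖v x‖ₑ ^ 2) := by
      calc _ ≤ ∫⁻ s in Ioc t₀ (t₀ + δ), (ENNReal.ofReal (B / δ ^ 2) * ∫⁻ x, ‖v x‖ₑ ^ 2) :=
            setLIntegral_mono measurable_const fun s hs => l2D s hs.1.le
        _ = _ := by rw [setLIntegral_const, Real.volume_Ioc, add_sub_cancel_left, mul_comm]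
    calc _ ≤ 2 * (ENNReal.ofReal B * ∫⁻ x, ‖v x‖ₑ ^ 2) + 2 * (ENNReal.ofReal δ *
          (ENNReal.ofReal δ * (ENNReal.ofReal (B / δ ^ 2) * ∫⁻ x, ‖v x‖ₑ ^ 2))) := by gcongr
      _ = (2 * ENNReal.ofReal B + 2 * (ENNReal.ofReal δ * ENNReal.ofReal δ *
          ENNReal.ofReal (B / δ ^ 2))) * ∫⁻ x, ‖v x‖ₑ ^ 2 := by ring
      _ = _ := by
        congr 1
        have e2 : ENNReal.ofReal δ * ENNReal.ofReal δ * ENNReal.ofReal (B / δ ^ 2) =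
            ENNReal.ofReal B := by
          rw [← ENNReal.ofReal_mul hδ.le, ← ENNReal.ofReal_mul (mul_nonneg hδ.le hδ.le)]
          congr 1
          field_simp
        rw [e2]
        rw [show 4 * C * (δ / b) ^ (d - 1) = 4 * B by simp only [B]; ring,
          ENNReal.ofReal_mul (p := 4) (q := B) (by norm_num)]
        rw [← add_mul]
        norm_num

end

section

open Polynomial

variable {d : ℕ}

theorem nonempty_covers (E : Set ℝ) (k : ℤ) (n : ℕ) :
    2 ^ n ∈ {m : ℕ | ∃ c : Fin m → ℝ, Ek E k ⊆ ⋃ i, Icc (c i) (c i + (2 : ℝ) ^ (k - (n : ℤ)))} := by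
  refine ⟨fun i => (2 : ℝ) ^ k + (i : ℕ) * (2 : ℝ) ^ (k - (n : ℤ)), fun t ht => ?_⟩
  obtain ⟨-, h1, h2⟩ := ht
  have hδ : (0 : ℝ) < (2 : ℝ) ^ (k - (n : ℤ)) := by positivity
  have hk : (2 : ℝ) ^ k = 2 ^ n * (2 : ℝ) ^ (k - (n : ℤ)) := by
    rw [← zpow_natCast, ← zpow_add₀ two_ne_zero]; congr 1; ring
  rw [zpow_add_one₀ two_ne_zero] at h2
  set δ := (2 : ℝ) ^ (k - (n : ℤ))
  have hnn : 0 ≤ (t - 2 ^ k) / δ := div_nonneg (by linarith) hδ.le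
  have hlt : ⌊(t - 2 ^ k) / δ⌋₊ < 2 ^ n := by
    rw [Nat.floor_lt hnn, div_lt_iff₀ hδ]
    push_cast
    linarith
  refine mem_iUnion.2 ⟨⟨_, hlt⟩, ?_⟩
  have h3 := Nat.floor_le hnn
  have h4 := Nat.lt_floor_add_one ((t - 2 ^ k) / δ)
  rw [le_div_iff₀ hδ] at h3
  rw [div_lt_iff₀ hδ] at h4
  constructor <;> dsimp only <;> linarith

theorem covN_le_two_pow (E : Set ℝ) (k : ℤ) (n : ℕ) :
    covN (Ek E k) ((2 : ℝ) ^ (k - (n : ℤ))) ≤ 2 ^ n :=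
  max_le Nat.one_le_two_pow (Nat.sInf_le (nonempty_covers E k n))

theorem exists_cover (E : Set ℝ) (k : ℤ) (n : ℕ) : ∃ (m : ℕ) (c : Fin m → ℝ),
    m ≤ covN (Ek E k) ((2 : ℝ) ^ (k - (n : ℤ))) ∧ (∀ i, (2 : ℝ) ^ k ≤ c i) ∧
      ∀ t ∈ Ek E k, ∃ i, t ∈ Icc (c i) (c i + (2 : ℝ) ^ (k - (n : ℤ))) := by
  obtain ⟨c, hc⟩ := Nat.sInf_mem ⟨_, nonempty_covers E k n⟩
  refine ⟨_, fun i => max (c i) (2 ^ k), le_max_right _ _, fun i => le_max_right _ _,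
    fun t ht => ?_⟩
  obtain ⟨i, hi⟩ := mem_iUnion.1 (hc ht)
  refine ⟨i, max_le hi.1 ht.2.1, hi.2.trans ?_⟩
  gcongr
  exact le_max_left _ _

theorem four_zpow (i : ℤ) : (4 : ℝ) ^ i = ((2 : ℝ) ^ i) ^ 2 := by
  rw [show (4 : ℝ) = 2 * 2 by norm_num, mul_zpow, sq]

variable [Fact (3 ≤ d)]

theorem enorm_lam_AHr_le (P : ℝ[X]) {s : ℝ} (hs : 0 < s) : ∃ C K : ℝ, 0 < C ∧ 0 < K ∧
    ∀ t τ, 0 < τ → ∀ v : Ed d → ℝ, Measurable v → ∀ x,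
      ‖lam (fun j => AHr t ((j + s) * τ) v x) P‖ₑ ≤
        ENNReal.ofReal C * AH t (K * τ) (fun z => ‖v z‖ₑ) x := by
  set K : ℝ := P.natDegree + s
  have hK : 0 < K := by positivity
  refine ⟨1 + ∑ j ∈ P.support, |P.coeff j| * (K / (j + s)) ^ ((d : ℝ) / 2), K, by positivity, hK,
    fun t τ hτ v hv x => ?_⟩
  rw [lam_eq_sum]
  have hv' : Measurable fun z => ‖v z‖ₑ := hv.enorm
  calc _ ≤ ∑ j ∈ P.support, ‖P.coeff j * AHr t ((j + s) * τ) v x‖ₑ := enorm_sum_le _ _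
    _ ≤ ∑ j ∈ P.support, ENNReal.ofReal (|P.coeff j| * (K / (j + s)) ^ ((d : ℝ) / 2)) *
          AH t (K * τ) (fun z => ‖v z‖ₑ) x := by
        refine Finset.sum_le_sum fun j hj => ?_
        have hj : (j : ℝ) ≤ P.natDegree := by exact_mod_cast le_natDegree_of_mem_supp j hj
        rw [enorm_mul, ENNReal.ofReal_mul (abs_nonneg _), mul_assoc,
          ← Real.norm_eq_abs, ofReal_norm]
        gcongr
        refine (enorm_AHr_le (by positivity) _ _).trans ((AH_le_AH_of_le (b := K * τ) (by positivity)
          (by gcongr; simp only [K]; linarith) hv' x).trans (le_of_eq ?_))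
        congr 3
        field_simp
    _ = ENNReal.ofReal (∑ j ∈ P.support, |P.coeff j| * (K / (j + s)) ^ ((d : ℝ) / 2)) *
          AH t (K * τ) (fun z => ‖v z‖ₑ) x := by
        rw [ENNReal.ofReal_sum_of_nonneg (fun j _ => by positivity), Finset.sum_mul]
    _ ≤ _ := by
        gcongr
        linarith

theorem exists_sup_AH {K : ℝ} (hK : 0 < K) : ∃ C : ℝ, 0 < C ∧ ∀ (E : Set ℝ) (k : ℤ) (n : ℕ)
    (v : Ed d → ℝ≥0∞), Measurable v → ∃ Y : Ed d → ℝ≥0∞, Measurable Y ∧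
      (∀ x, ∀ t ∈ Ek E k, AH t (K * 4 ^ (k - (n : ℤ))) v x ≤ Y x) ∧
      ∫⁻ x, Y x ≤ ENNReal.ofReal C * covN (Ek E k) ((2 : ℝ) ^ (k - (n : ℤ))) * ∫⁻ x, v x := by
  refine ⟨2 ^ ((d : ℝ) / 2) * Real.exp (1 / (2 * (2 * K))), by positivity,
    fun E k n v hv => ?_⟩
  set C := (2 : ℝ) ^ ((d : ℝ) / 2) * Real.exp (1 / (2 * (2 * K)))
  obtain ⟨m, c, hm, hc, hcov⟩ := exists_cover E k n
  set τ : ℝ := 4 ^ (k - (n : ℤ)) with hτd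
  have hτ : 0 < τ := by positivity
  rw [four_zpow] at hτd
  set δ : ℝ := 2 ^ (k - (n : ℤ))
  refine ⟨fun x => ∑ i, ENNReal.ofReal C * AH (c i) (2 * K * τ) v x,
    Finset.measurable_fun_sum _ fun i _ => (measurable_AH hv).const_mul _, fun x t ht => ?_, ?_⟩
  · obtain ⟨i, hi⟩ := hcov t ht
    refine le_trans ?_ (Finset.single_le_sum (f := fun i => ENNReal.ofReal C *
      AH (c i) (2 * K * τ) v x) (fun _ _ => zero_le) (Finset.mem_univ i))
    have := AH_le_mul_AH (t := t) (t' := c i) (a := K * τ) (b := 2 * K * τ) (x := x) (x' := x)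
      (c := 1 / (2 * (2 * K))) (by positivity) (by positivity) hv (fun y z _ => ?_)
    · refine this.trans (le_of_eq ?_)
      congr 4
      field_simp
    · have h1 : ‖x - c i • (y : Ed d) - z‖ ≤ ‖x - t • (y : Ed d) - z‖ + δ := by
        have h2 : x - c i • (y : Ed d) - z = (x - t • (y : Ed d) - z) + (t - c i) • (y : Ed d) := by
          rw [sub_smul]; abel
        rw [h2]
        refine (norm_add_le _ _).trans ?_
        gcongr
        rw [norm_smul, norm_eq_of_mem_sphere, mul_one, Real.norm_eq_abs, abs_of_nonneg]
        · linarith [hi.2]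
        · linarith [hi.1]
      have h3 : ‖x - c i • (y : Ed d) - z‖ ^ 2 ≤ 2 * ‖x - t • (y : Ed d) - z‖ ^ 2 + 2 * τ := by
        refine (pow_le_pow_left₀ (norm_nonneg _) h1 2).trans ?_
        rw [hτd]
        nlinarith [sq_nonneg (‖x - t • (y : Ed d) - z‖ - δ)]
      calc _ ≤ (2 * ‖x - t • (y : Ed d) - z‖ ^ 2 + 2 * τ) / (4 * (2 * K * τ)) := by gcongr
        _ = _ := by field_simp; ring
  · rw [lintegral_finsetSum _ fun i _ => (measurable_AH hv).const_mul _]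
    simp_rw [lintegral_const_mul' _ _ ENNReal.ofReal_ne_top,
      lintegral_AH (show 0 < 2 * K * τ by positivity) hv]
    rw [Finset.sum_const, Finset.card_univ, Fintype.card_fin, nsmul_eq_mul, ← mul_assoc,
      mul_comm (m : ℝ≥0∞)]
    gcongr

theorem exists_sup_Qop : ∃ C : ℝ, 0 < C ∧ ∀ (E : Set ℝ) (k : ℤ) (n : ℕ)
    (v : Ed d → ℝ), Integrable v → MemLp v 2 → ∃ Z : Ed d → ℝ≥0∞, Measurable Z ∧
      (∀ x, ∀ t ∈ Ek E k, ‖Qop t (4 ^ (k - (n : ℤ))) v x‖ₑ ^ 2 ≤ Z x) ∧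
      ∫⁻ x, Z x ≤ ENNReal.ofReal (C * (2 ^ (n * (d - 1)))⁻¹) *
        covN (Ek E k) ((2 : ℝ) ^ (k - (n : ℤ))) * ∫⁻ x, ‖v x‖ₑ ^ 2 := by
  obtain ⟨C, hC, H⟩ := exists_local_maximal (d := d)
  refine ⟨C, hC, fun E k n v hv hv2 => ?_⟩
  obtain ⟨m, c, hm, hc, hcov⟩ := exists_cover E k n
  have hr : (2 : ℝ) ^ (k - (n : ℤ)) / 2 ^ k = (2 ^ n)⁻¹ := by
    rw [zpow_sub₀ two_ne_zero, zpow_natCast]; field_simp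
  choose Z hZm hZ hZi using fun i => H (2 ^ (k - (n : ℤ))) (2 ^ k) (c i) (by positivity)
    (by positivity) (hc i) v hv hv2
  refine ⟨fun x => ∑ i, Z i x, Finset.measurable_fun_sum _ fun i _ => hZm i, fun x t ht => ?_, ?_⟩
  · obtain ⟨i, hi⟩ := hcov t ht
    rw [four_zpow]
    exact (hZ i x t hi).trans (Finset.single_le_sum (f := fun i => Z i x) (fun _ _ => zero_le)
      (Finset.mem_univ i))
  · rw [lintegral_finsetSum _ fun i _ => hZm i]
    refine (Finset.sum_le_sum fun i _ => hZi i).trans ?_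
    rw [hr, inv_pow, ← pow_mul, Finset.sum_const, Finset.card_univ, Fintype.card_fin, nsmul_eq_mul,
      ← mul_assoc, mul_comm (m : ℝ≥0∞)]
    gcongr

end

section

open Polynomial

variable {d : ℕ}

/-- Heat extension at the dyadic scale `2 ^ i`. -/
def uh (i : ℤ) (g : Ed d → ℝ) : Ed d → ℝ := heat (4 ^ i / 3) g

/-- Difference of heat extensions at consecutive dyadic scales. -/
def wh (i : ℤ) (g : Ed d → ℝ) (z : Ed d) : ℝ := uh i g z - uh (i + 1) g z

/-- The polynomial encoding the low frequency part. -/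
def polyL (d : ℕ) : ℝ[X] := divX (1 - (1 - X) ^ d)

theorem lam_expand_four (a : ℕ → ℝ) (P : ℝ[X]) :
    lam a (expand ℝ 4 P) = lam (fun j => a (4 * j)) P := by
  induction P using Polynomial.induction_on' with
  | add p q hp hq => rw [map_add, lam_add, lam_add, hp, hq]
  | monomial n c =>
    rw [expand_monomial, ← C_mul_X_pow_eq_monomial, ← C_mul_X_pow_eq_monomial,
      lam_C_mul_X_pow, lam_C_mul_X_pow, mul_comm n]

variable [Fact (3 ≤ d)]

theorem X_mul_polyL : X * polyL d = 1 - (1 - X) ^ d := by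
  have h := divX_mul_X_add (1 - (1 - X : ℝ[X]) ^ d)
  have h0 : (1 - (1 - X : ℝ[X]) ^ d).coeff 0 = 0 := by
    rw [coeff_zero_eq_eval_zero]; simp
  rw [h0, C_0, add_zero] at h
  rw [mul_comm]
  exact h

theorem one_sub_X_pow_four_sub : (1 - X ^ 4 : ℝ[X]) ^ d - (1 - X) ^ d =
    X * ((1 - X) * polyS d) := by
  have hd : 1 ≤ d := by have := (Fact.out : 3 ≤ d); omega
  have h1 : (1 - X ^ 4 : ℝ[X]) = (1 - X) * (1 + X + X ^ 2 + X ^ 3) := by ring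
  have h2 : (1 - X : ℝ[X]) ^ d = (1 - X) * (1 - X) ^ (d - 1) := by
    rw [← pow_succ', Nat.sub_add_cancel hd]
  rw [h1, mul_pow, polyS]
  linear_combination (1 - X) ^ d * -(X_mul_polyR d) + X * polyR d * h2

/-- Heat-regularised spherical means at the heights `j * τ`, including the unregularised one. -/
def aseq (t τ : ℝ) (g : Ed d → ℝ) (x : Ed d) (j : ℕ) : ℝ :=
  if j = 0 then ∫ y : sphere (0 : Ed d) 1, g (x - t • (y : Ed d)) ∂(sphereProb d)
  else AHr t (j * τ) g x

/-- The high frequency remainder of a spherical mean. -/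
def erem (t : ℝ) (i : ℤ) (g : Ed d → ℝ) (x : Ed d) : ℝ := lam (aseq t (4 ^ i) g x) ((1 - X) ^ d)

/-- The low frequency part of a spherical mean. -/
def Top (t τ : ℝ) (g : Ed d → ℝ) (x : Ed d) : ℝ :=
  lam (fun j => AHr t ((j + 1) * τ) g x) (polyL d)

theorem mean_eq_Top_add_erem (t : ℝ) (i : ℤ) (g : Ed d → ℝ) (x : Ed d) :
    ∫ y : sphere (0 : Ed d) 1, g (x - t • (y : Ed d)) ∂(sphereProb d) =
      Top t (4 ^ i) g x + erem t i g x := by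
  have h : lam (aseq t (4 ^ i) g x) (X * polyL d + (1 - X) ^ d) = aseq t (4 ^ i) g x 0 := by
    rw [X_mul_polyL, sub_add_cancel, lam_one]
  rw [lam_add, lam_X_mul] at h
  unfold Top erem
  rw [show aseq t (4 ^ i) g x 0 = ∫ y : sphere (0 : Ed d) 1, g (x - t • (y : Ed d))
    ∂(sphereProb d) from if_pos rfl] at h
  rw [← h]
  congr 2
  ext j
  simp [aseq]

theorem erem_succ_sub (t : ℝ) (i : ℤ) {g : Ed d → ℝ} (hg : Integrable g) (x : Ed d) :
    erem t (i + 1) g x - erem t i g x = Qop t (4 ^ i) (wh i g) x := by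
  have hτ : (0 : ℝ) < 4 ^ i := by positivity
  have h1 : aseq t (4 ^ (i + 1)) g x = fun j => aseq t (4 ^ i) g x (4 * j) := by
    ext j
    simp only [aseq, mul_eq_zero, OfNat.ofNat_ne_zero, false_or]
    split_ifs
    · rfl
    · rw [zpow_add_one₀ (by norm_num)]
      congr 1
      push_cast
      ring
  unfold erem
  rw [h1, ← lam_expand_four, ← lam_sub]
  have h2 : expand ℝ 4 ((1 - X) ^ d) = (1 - X ^ 4 : ℝ[X]) ^ d := by simp
  rw [h2, one_sub_X_pow_four_sub, lam_X_mul, lam_one_sub_X_mul, Qop]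
  congr 1
  ext j
  unfold wh uh
  rw [AHr_sub (by positivity) (integrable_heat (by positivity) hg)
    (integrable_heat (by positivity) hg), AHr_heat (by positivity) (by positivity) hg,
    AHr_heat (by positivity) (by positivity) hg, zpow_add_one₀ (by norm_num)]
  simp only [aseq, Nat.add_eq_zero_iff, one_ne_zero, and_false, if_false]
  congr 2 <;> (push_cast; ring)

theorem tendsto_erem {g : Ed d → ℝ} (hc : Continuous g) (hi : Integrable g) {B : ℝ}
    (hB : ∀ z, |g z| ≤ B) (t : ℝ) (k : ℤ) (x : Ed d) :
    Tendsto (fun n : ℕ => erem t (k - n) g x) atTop (𝓝 0) := by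
  set m := ∫ y : sphere (0 : Ed d) 1, g (x - t • (y : Ed d)) ∂(sphereProb d) with hm
  have h0 : lam (fun _ => m) ((1 - X : ℝ[X]) ^ d) = 0 := by
    have h1 := lam_const_mul m (fun j => (1 : ℝ) ^ j) ((1 - X : ℝ[X]) ^ d)
    rw [lam_pow] at h1
    simp only [one_pow, mul_one] at h1
    rw [h1]
    simp [NeZero.ne d]
  have h4 : Tendsto (fun n : ℕ => (4 : ℝ) ^ (k - (n : ℤ))) atTop (𝓝 0) := by
    have h5 := (tendsto_pow_atTop_nhds_zero_of_lt_one (r := (1 / 4 : ℝ)) (by norm_num)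
      (by norm_num)).const_mul ((4 : ℝ) ^ k)
    rw [mul_zero] at h5
    refine h5.congr fun n => ?_
    rw [zpow_sub₀ (by norm_num), zpow_natCast, one_div, inv_pow]
    rfl
  unfold erem
  rw [← h0]
  simp only [lam_eq_sum]
  refine tendsto_finsetSum _ fun j _ => Tendsto.const_mul _ ?_
  unfold aseq
  split_ifs with hj
  · exact tendsto_const_nhds
  · refine (tendsto_AHr_zero hc hi hB t x).comp (tendsto_nhdsWithin_iff.2 ⟨?_, ?_⟩)
    · simpa using h4.const_mul (j : ℝ)
    · exact Eventually.of_forall fun n => by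
        have : (0 : ℝ) < j := by exact_mod_cast Nat.pos_of_ne_zero hj
        exact mem_Ioi.2 (by positivity)

theorem erem_eq_sum (t : ℝ) (k : ℤ) {g : Ed d → ℝ} (hg : Integrable g) (x : Ed d) (J m : ℕ) :
    erem t (k - J) g x = (∑ n ∈ Finset.Ioc J (J + m), Qop t (4 ^ (k - (n : ℤ))) (wh (k - n) g) x) +
      erem t (k - ((J + m : ℕ) : ℤ)) g x := by
  induction m with
  | zero => simp
  | succ m ih =>
    rw [ih, ← Nat.add_assoc, Finset.sum_Ioc_succ_top (by omega), add_assoc]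
    congr 1
    have := erem_succ_sub t (k - ((J + m + 1 : ℕ) : ℤ)) hg x
    rw [show k - ((J + m + 1 : ℕ) : ℤ) + 1 = k - ((J + m : ℕ) : ℤ) by push_cast; ring] at this
    linarith

theorem enorm_mean_le {g : Ed d → ℝ} (hc : Continuous g) (hi : Integrable g) {B : ℝ}
    (hB : ∀ z, |g z| ≤ B) (t : ℝ) (k : ℤ) (x : Ed d) (J : ℕ) (b : ℕ → ℝ≥0∞)
    (hb : ∀ n, J < n → ‖Qop t (4 ^ (k - (n : ℤ))) (wh (k - n) g) x‖ₑ ≤ b n) :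
    ‖∫ y : sphere (0 : Ed d) 1, g (x - t • (y : Ed d)) ∂(sphereProb d)‖ₑ ≤
      ‖Top t (4 ^ (k - (J : ℤ))) g x‖ₑ + ∑' n, b n := by
  rw [mean_eq_Top_add_erem t (k - J)]
  refine (enorm_add_le _ _).trans ?_
  gcongr
  have h1 : ∀ m : ℕ, ‖erem t (k - J) g x‖ₑ ≤
      (∑' n, b n) + ‖erem t (k - ((J + m : ℕ) : ℤ)) g x‖ₑ := fun m => by
    rw [erem_eq_sum t k hi x J m]
    refine (enorm_add_le _ _).trans ?_
    gcongr
    refine (enorm_sum_le _ _).trans ((Finset.sum_le_sum fun n hn => hb n ?_).trans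
      (ENNReal.sum_le_tsum _))
    exact (Finset.mem_Ioc.1 hn).1
  have h2 : Tendsto (fun m : ℕ => (∑' n, b n) + ‖erem t (k - ((J + m : ℕ) : ℤ)) g x‖ₑ) atTop
      (𝓝 ((∑' n, b n) + 0)) := by
    refine tendsto_const_nhds.add ?_
    have h3 := (tendsto_erem hc hi hB t k x).comp
      (tendsto_atTop_mono (fun m => Nat.le_add_left m J) tendsto_id)
    have h4 := (continuous_enorm.tendsto (0 : ℝ)).comp h3
    rwa [enorm_zero] at h4
  rw [add_zero] at h2
  exact ge_of_tendsto' h2 h1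

end

section

variable {d : ℕ}

/-- The convex function used for the truncated square function. -/
def Phi (l u : ℝ) : ℝ := u ^ 2 / (l + u)

theorem Phi_nonneg {l u : ℝ} (hl : 0 < l) (hu : 0 ≤ u) : 0 ≤ Phi l u := by
  unfold Phi; positivity

theorem Phi_le {l u : ℝ} (hl : 0 < l) (hu : 0 ≤ u) : Phi l u ≤ u := by
  unfold Phi
  rw [div_le_iff₀ (by positivity)]
  nlinarith [mul_nonneg hl.le hu]

/-- The Bregman distance of `Phi`. -/
def breg (l m y : ℝ) : ℝ :=
  Phi l y - Phi l m - (m ^ 2 + 2 * l * m) / (l + m) ^ 2 * (y - m)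

theorem breg_eq {l m y : ℝ} (hl : 0 < l) (hm : 0 ≤ m) (hy : 0 ≤ y) :
    breg l m y = l ^ 2 * (y - m) ^ 2 / ((l + y) * (l + m) ^ 2) := by
  unfold breg Phi
  field_simp
  ring

theorem breg_nonneg {l m y : ℝ} (hl : 0 < l) (hm : 0 ≤ m) (hy : 0 ≤ y) : 0 ≤ breg l m y := by
  rw [breg_eq hl hm hy]; positivity

theorem sq_sub_le_breg {l m y Q : ℝ} (hl : 0 < l) (hm : 0 ≤ m) (hml : m ≤ l) (hy : 0 ≤ y)
    (hQ : 1 ≤ Q) (hyQ : y ≤ Q * m) : (y - m) ^ 2 ≤ 8 * Q * l * breg l m y := by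
  rw [breg_eq hl hm hy, mul_div_assoc', le_div_iff₀ (by positivity)]
  have h1 : (l + y) * (l + m) ^ 2 ≤ 8 * Q * l * l ^ 2 := by
    have h2 : l + y ≤ 2 * Q * l := by nlinarith
    have h3 : (l + m) ^ 2 ≤ (2 * l) ^ 2 := by gcongr; linarith
    calc _ ≤ 2 * Q * l * (2 * l) ^ 2 := by gcongr
      _ = _ := by ring
  calc _ ≤ (y - m) ^ 2 * (8 * Q * l * l ^ 2) := by gcongr
    _ = _ := by ring

theorem heat_le_mul_heat {a b c : ℝ} (ha : 0 < a) (hb : 0 < b) {v : Ed d → ℝ} {x x' : Ed d}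
    (hv : Integrable v) (h0 : ∀ z, 0 ≤ v z)
    (h : ∀ z, ‖x' - z‖ ^ 2 / (4 * b) ≤ ‖x - z‖ ^ 2 / (4 * a) + c) :
    heat a v x ≤ (b / a) ^ ((d : ℝ) / 2) * Real.exp c * heat b v x' := by
  unfold heat
  rw [← integral_const_mul]
  refine integral_mono (integrable_gk_mul ha hv x) ((integrable_gk_mul hb hv x').const_mul _)
    fun z => ?_
  dsimp only
  rw [← mul_assoc]
  exact mul_le_mul_of_nonneg_right (gk_le_mul_gk ha hb (h z)) (h0 z)

theorem heat_le_heat_of_le {a b : ℝ} (ha : 0 < a) (hab : a ≤ b) {v : Ed d → ℝ}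
    (hv : Integrable v) (h0 : ∀ z, 0 ≤ v z) (x : Ed d) :
    heat a v x ≤ (b / a) ^ ((d : ℝ) / 2) * heat b v x := by
  have := heat_le_mul_heat (c := 0) ha (ha.trans_le hab) (x := x) (x' := x) hv h0
    (fun z => by rw [add_zero]; gcongr)
  simpa using this

theorem harnack_sq {b : ℝ} (hb : 0 < b) (x y z : Ed d) :
    ‖x - z‖ ^ 2 / (4 * (16 * b)) ≤ ‖y - z‖ ^ 2 / (4 * b) + ‖x - y‖ ^ 2 / (60 * b) := by
  have h1 : ‖x - z‖ ≤ ‖x - y‖ + ‖y - z‖ := norm_sub_le_norm_sub_add_norm_sub x y z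
  have h2 : ‖x - z‖ ^ 2 ≤ 16 / 15 * ‖x - y‖ ^ 2 + 16 * ‖y - z‖ ^ 2 := by
    refine (pow_le_pow_left₀ (norm_nonneg _) h1 2).trans ?_
    nlinarith [sq_nonneg (‖x - y‖ - 15 * ‖y - z‖)]
  calc _ ≤ (16 / 15 * ‖x - y‖ ^ 2 + 16 * ‖y - z‖ ^ 2) / (4 * (16 * b)) := by gcongr
    _ = _ := by field_simp; ring

theorem sq_integral_gk_mul_le {τ : ℝ} (hτ : 0 < τ) (x : Ed d) {f : Ed d → ℝ}
    (hf : Integrable fun y => gk d τ (x - y) * f y)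
    (hf2 : Integrable fun y => gk d τ (x - y) * f y ^ 2) :
    (∫ y, gk d τ (x - y) * f y) ^ 2 ≤ ∫ y, gk d τ (x - y) * f y ^ 2 := by
  set A := ∫ y, gk d τ (x - y) * f y with hA
  have hg : Integrable fun y => gk d τ (x - y) := (integrable_gk hτ).comp_sub_left x
  have h1 : ∫ y, gk d τ (x - y) = 1 := by
    rw [integral_sub_left_eq_self (fun y => gk d τ y), integral_gk hτ]
  have h2 : 0 ≤ ∫ y, gk d τ (x - y) * (f y - A) ^ 2 :=
    integral_nonneg fun y => mul_nonneg (gk_nonneg hτ _) (sq_nonneg _)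
  have h3 : ∫ y, gk d τ (x - y) * (f y - A) ^ 2 =
      (∫ y, gk d τ (x - y) * f y ^ 2) - A ^ 2 := by
    have h4 : ∀ y, gk d τ (x - y) * (f y - A) ^ 2 = gk d τ (x - y) * f y ^ 2 -
      2 * A * (gk d τ (x - y) * f y) + A ^ 2 * gk d τ (x - y) := fun y => by ring
    have h5 : Integrable fun y => gk d τ (x - y) * f y ^ 2 - 2 * A * (gk d τ (x - y) * f y) :=
      hf2.sub (hf.const_mul _)
    simp_rw [h4]
    rw [integral_add h5 (hg.const_mul _),
      integral_sub hf2 (hf.const_mul _), integral_const_mul, integral_const_mul, h1, ← hA]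
    ring
  linarith

/-- Pointwise comparison of a difference of heat extensions with a telescoping quantity. -/
theorem sq_heat_sub_le {b l : ℝ} (hb : 0 < b) (hl : 0 < l) {g : Ed d → ℝ} (hg : Integrable g)
    (h0 : ∀ z, 0 ≤ g z) {B : ℝ} (hB : ∀ z, |g z| ≤ B) (x : Ed d) :
    0 ≤ heat (15 * b) (fun y => Phi l (heat b g y)) x - Phi l (heat (16 * b) g x) ∧
    (heat (16 * b) g x ≤ l → (heat (4 * b) g x - heat (16 * b) g x) ^ 2 ≤
      8 * (16 : ℝ) ^ ((d : ℝ) / 2) * (5 : ℝ) ^ ((d : ℝ) / 2) * l *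
        (heat (15 * b) (fun y => Phi l (heat b g y)) x - Phi l (heat (16 * b) g x))) := by
  set v := heat b g with hv
  set m := heat (16 * b) g x with hm
  have hvi : Integrable v := integrable_heat hb hg
  have hvc : Continuous v := continuous_heat hb hg
  have hv0 : ∀ y, 0 ≤ v y := heat_nonneg hb h0
  have hvB : ∀ y, |v y| ≤ B := abs_heat_le hb hB
  have hm0 : 0 ≤ m := heat_nonneg (by positivity) h0 x
  have hmv : heat (15 * b) v x = m := by
    rw [hv, heat_heat (by positivity) hb hg, hm]; congr 1; ring
  have hPc : Continuous fun y => Phi l (v y) := by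
    unfold Phi
    exact (hvc.pow 2).div (by fun_prop) fun y => by have := hv0 y; positivity
  have hPi : Integrable fun y => Phi l (v y) := by
    refine hvi.mono' hPc.aestronglyMeasurable (Eventually.of_forall fun y => ?_)
    rw [Real.norm_eq_abs, abs_of_nonneg (Phi_nonneg hl (hv0 y))]
    exact Phi_le hl (hv0 y)
  have hgi : ∀ τ, 0 < τ → Integrable fun y => gk d τ (x - y) := fun τ hτ =>
    (integrable_gk hτ).comp_sub_left x
  have hg1 : ∀ τ, 0 < τ → ∫ y, gk d τ (x - y) = 1 := fun τ hτ => by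
    rw [integral_sub_left_eq_self (fun y => gk d τ y), integral_gk hτ]
  have h15 : 0 < 15 * b := by positivity
  have h3 : 0 < 3 * b := by positivity
  set D := (m ^ 2 + 2 * l * m) / (l + m) ^ 2
  have e : ∀ y, gk d (15 * b) (x - y) * breg l m (v y) = gk d (15 * b) (x - y) * Phi l (v y) -
      Phi l m * gk d (15 * b) (x - y) - D * (gk d (15 * b) (x - y) * v y -
      m * gk d (15 * b) (x - y)) := fun y => by unfold breg; ring
  have hi1 := integrable_gk_mul h15 hPi x
  have hi2 := integrable_gk_mul h15 hvi x
  have hi3 : Integrable fun y => gk d (15 * b) (x - y) * Phi l (v y) -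
      Phi l m * gk d (15 * b) (x - y) := hi1.sub ((hgi _ h15).const_mul _)
  have hi4 : Integrable fun y => gk d (15 * b) (x - y) * v y - m * gk d (15 * b) (x - y) :=
    hi2.sub ((hgi _ h15).const_mul _)
  have hbi : Integrable fun y => gk d (15 * b) (x - y) * breg l m (v y) := by
    simp_rw [e]
    exact hi3.sub (hi4.const_mul _)
  have hkey : ∫ y, gk d (15 * b) (x - y) * breg l m (v y) =
      heat (15 * b) (fun y => Phi l (v y)) x - Phi l m := by
    simp_rw [e]
    rw [integral_sub hi3 (hi4.const_mul _), integral_sub hi1 ((hgi _ h15).const_mul _),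
      integral_const_mul, integral_const_mul, integral_sub hi2 ((hgi _ h15).const_mul _),
      integral_const_mul, hg1 _ h15]
    unfold heat at hmv ⊢
    rw [hmv]
    ring
  rw [← hkey]
  refine ⟨integral_nonneg fun y => mul_nonneg (gk_nonneg h15 _) (breg_nonneg hl hm0 (hv0 y)),
    fun hml => ?_⟩
  have hu : heat (4 * b) g x - m = ∫ y, gk d (3 * b) (x - y) * (v y - m) := by
    simp_rw [mul_sub]
    rw [integral_sub (integrable_gk_mul h3 hvi x) ((hgi _ h3).mul_const _), integral_mul_const,
      hg1 _ h3, one_mul]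
    congr 1
    have := heat_heat (a := 3 * b) h3 hb hg x
    rw [show 3 * b + b = 4 * b by ring] at this
    rw [← this]; rfl
  have hf1 : Integrable fun y => gk d (3 * b) (x - y) * (v y - m) := by
    simp_rw [mul_sub]
    exact (integrable_gk_mul h3 hvi x).sub ((hgi _ h3).mul_const _)
  have hf2 : Integrable fun y => gk d (3 * b) (x - y) * (v y - m) ^ 2 := by
    refine (hgi _ h3).mul_bdd (c := (B + m) ^ 2) (Continuous.aestronglyMeasurable (by fun_prop))
      (Eventually.of_forall fun y => ?_)
    rw [Real.norm_eq_abs, abs_of_nonneg (sq_nonneg _), ← sq_abs]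
    gcongr
    refine (abs_sub _ _).trans ?_
    rw [abs_of_nonneg hm0]
    gcongr
    exact hvB y
  rw [hu]
  refine (sq_integral_gk_mul_le h3 x hf1 hf2).trans ?_
  rw [← integral_const_mul]
  refine integral_mono hf2 (hbi.const_mul _) fun y => ?_
  dsimp only
  set Q := (16 : ℝ) ^ ((d : ℝ) / 2) * Real.exp (‖x - y‖ ^ 2 / (60 * b)) with hQ
  have hQ1 : 1 ≤ Q := by
    have h1 : (1 : ℝ) ≤ (16 : ℝ) ^ ((d : ℝ) / 2) := Real.one_le_rpow (by norm_num) (by positivity)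
    have h2 : 1 ≤ Real.exp (‖x - y‖ ^ 2 / (60 * b)) := Real.one_le_exp (by positivity)
    exact one_le_mul_of_one_le_of_one_le h1 h2
  have hvm : v y ≤ Q * m := by
    have := heat_le_mul_heat (x := y) (x' := x) (a := b) (b := 16 * b)
      (c := ‖x - y‖ ^ 2 / (60 * b)) hb (by positivity) hg h0 (harnack_sq hb x y)
    rwa [mul_div_assoc, div_self hb.ne', mul_one] at this
  have hs := sq_sub_le_breg hl hm0 hml (hv0 y) hQ1 hvm
  have hb0 := breg_nonneg hl hm0 (hv0 y)
  have hgk : gk d (3 * b) (x - y) * Real.exp (‖x - y‖ ^ 2 / (60 * b)) ≤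
      (5 : ℝ) ^ ((d : ℝ) / 2) * gk d (15 * b) (x - y) := by
    have := gk_le_mul_gk (d := d) (a := 3 * b) (b := 15 * b) (x := x - y) (x' := x - y)
      (c := -(‖x - y‖ ^ 2 / (60 * b))) h3 h15 (by
        have : 0 ≤ ‖x - y‖ ^ 2 / b := by positivity
        have e1 : ‖x - y‖ ^ 2 / (4 * (15 * b)) = ‖x - y‖ ^ 2 / b / 60 := by field_simp; ring
        have e2 : ‖x - y‖ ^ 2 / (4 * (3 * b)) = ‖x - y‖ ^ 2 / b / 12 := by field_simp; ring
        have e3 : ‖x - y‖ ^ 2 / (60 * b) = ‖x - y‖ ^ 2 / b / 60 := by field_simp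
        rw [e1, e2, e3]
        linarith)
    rw [show 15 * b / (3 * b) = 5 by field_simp; norm_num] at this
    calc _ ≤ (5 : ℝ) ^ ((d : ℝ) / 2) * Real.exp (-(‖x - y‖ ^ 2 / (60 * b))) *
          gk d (15 * b) (x - y) * Real.exp (‖x - y‖ ^ 2 / (60 * b)) := by gcongr
      _ = (5 : ℝ) ^ ((d : ℝ) / 2) * gk d (15 * b) (x - y) *
          (Real.exp (-(‖x - y‖ ^ 2 / (60 * b))) * Real.exp (‖x - y‖ ^ 2 / (60 * b))) := by ring
      _ = _ := by rw [← Real.exp_add]; simp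
  calc gk d (3 * b) (x - y) * (v y - m) ^ 2 ≤ gk d (3 * b) (x - y) *
        (8 * Q * l * breg l m (v y)) := by
        gcongr
        exact gk_nonneg h3 _
    _ = 8 * (16 : ℝ) ^ ((d : ℝ) / 2) * l * breg l m (v y) *
        (gk d (3 * b) (x - y) * Real.exp (‖x - y‖ ^ 2 / (60 * b))) := by rw [hQ]; ring
    _ ≤ 8 * (16 : ℝ) ^ ((d : ℝ) / 2) * l * breg l m (v y) *
        ((5 : ℝ) ^ ((d : ℝ) / 2) * gk d (15 * b) (x - y)) := by gcongr
    _ = _ := by ring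

end

section

variable {d : ℕ}

theorem tsum_int_le_of_telescope {c : ℤ → ℝ≥0∞} {I : ℤ → ℝ} {K G : ℝ} (hK : 0 ≤ K)
    (hI : ∀ i, 0 ≤ I i) (hG : ∀ i, I i ≤ G) (hd : ∀ i, I (i + 1) ≤ I (i - 1))
    (hc : ∀ i, c i ≤ ENNReal.ofReal (K * (I (i - 1) - I (i + 1)))) :
    ∑' i, c i ≤ ENNReal.ofReal (K * (2 * G)) := by
  rw [ENNReal.tsum_eq_iSup_sum]
  refine iSup_le fun s => ?_
  have hb : ∀ (m : ℤ) (n : ℕ), ∑ j ∈ Finset.range n, (I (m + j - 1) - I (m + j + 1)) =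
      I (m - 1) + I m - I (m + n - 1) - I (m + n) := by
    intro m n
    induction n with
    | zero => simp
    | succ n ih =>
      rw [Finset.sum_range_succ, ih]
      push_cast
      rw [show m + (n + 1 : ℤ) - 1 = m + n by ring, ← add_assoc]
      ring
  obtain ⟨m, hm⟩ := s.bddBelow
  obtain ⟨M, hM⟩ := s.bddAbove
  have hs : s ⊆ (Finset.range (M - m + 1).toNat).image fun j : ℕ => m + (j : ℤ) := by
    intro i hi
    have h1 := hm hi
    have h2 := hM hi
    refine Finset.mem_image.2 ⟨(i - m).toNat, ?_, ?_⟩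
    · rw [Finset.mem_range]; omega
    · omega
  calc ∑ i ∈ s, c i ≤ ∑ i ∈ (Finset.range (M - m + 1).toNat).image fun j : ℕ => m + (j : ℤ), c i :=
        Finset.sum_le_sum_of_subset hs
    _ = ∑ j ∈ Finset.range (M - m + 1).toNat, c (m + j) :=
        Finset.sum_image fun _ _ _ _ h => by simpa using h
    _ ≤ ∑ j ∈ Finset.range (M - m + 1).toNat,
          ENNReal.ofReal (K * (I (m + j - 1) - I (m + j + 1))) := Finset.sum_le_sum fun j _ => hc _
    _ = ENNReal.ofReal (K * ∑ j ∈ Finset.range (M - m + 1).toNat,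
          (I (m + j - 1) - I (m + j + 1))) := by
        rw [Finset.mul_sum, ENNReal.ofReal_sum_of_nonneg]
        intro j _
        exact mul_nonneg hK (sub_nonneg.2 (hd _))
    _ ≤ _ := by
        rw [hb]
        gcongr
        have := hI (m + (M - m + 1).toNat - 1)
        have := hI (m + (M - m + 1).toNat)
        have := hG (m - 1)
        have := hG m
        linarith

theorem truncated_square : ∃ C : ℝ, 0 < C ∧ ∀ (g : Ed d → ℝ) (B l : ℝ), Continuous g →
    Integrable g → (∀ z, 0 ≤ g z) → (∀ z, |g z| ≤ B) → 0 < l →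
    ∑' i : ℤ, ∫⁻ x in {x | uh (i + 1) g x ≤ l}, ‖wh i g x‖ₑ ^ 2 ≤
      ENNReal.ofReal (C * l) * ∫⁻ x, ENNReal.ofReal (g x) := by
  set K : ℝ := 8 * (16 : ℝ) ^ ((d : ℝ) / 2) * (5 : ℝ) ^ ((d : ℝ) / 2)
  have hK : 0 < K := by positivity
  refine ⟨K * 2, by positivity, fun g B l hgc hgi h0 hB hl => ?_⟩
  have hp : ∀ i : ℤ, (0 : ℝ) < 4 ^ i / 3 := fun i => by positivity
  have hui : ∀ i, Integrable (uh i g) := fun i => integrable_heat (hp i) hgi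
  have huc : ∀ i, Continuous (uh i g) := fun i => continuous_heat (hp i) hgi
  have hu0 : ∀ i x, 0 ≤ uh i g x := fun i => heat_nonneg (hp i) h0
  have hPc : ∀ i, Continuous fun y => Phi l (uh i g y) := fun i => by
    unfold Phi
    exact ((huc i).pow 2).div (by have := huc i; fun_prop)
      fun y => by have := hu0 i y; positivity
  have hPi : ∀ i, Integrable fun y => Phi l (uh i g y) := fun i => by
    refine (hui i).mono' (hPc i).aestronglyMeasurable (Eventually.of_forall fun y => ?_)
    rw [Real.norm_eq_abs, abs_of_nonneg (Phi_nonneg hl (hu0 i y))]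
    exact Phi_le hl (hu0 i y)
  set D : ℤ → Ed d → ℝ := fun i x => heat (15 * (4 ^ i / 12)) (fun y => Phi l (uh (i - 1) g y)) x -
    Phi l (uh (i + 1) g x) with hD
  have key : ∀ i x, 0 ≤ D i x ∧ (uh (i + 1) g x ≤ l → wh i g x ^ 2 ≤ K * l * D i x) := by
    intro i x
    have h := sq_heat_sub_le (b := 4 ^ i / 12) (by positivity) hl hgi h0 hB x
    have e1 : (16 : ℝ) * (4 ^ i / 12) = 4 ^ (i + 1) / 3 := by
      rw [zpow_add_one₀ (by norm_num)]; ring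
    have e2 : (4 : ℝ) * (4 ^ i / 12) = 4 ^ i / 3 := by ring
    have e3 : (4 : ℝ) ^ i / 12 = 4 ^ (i - 1) / 3 := by
      rw [zpow_sub_one₀ (by norm_num)]; ring
    rw [e1, e2] at h
    simp only [hD, wh, uh]
    rw [← e3]
    exact h
  have hDi : ∀ i, Integrable (D i) := fun i =>
    (integrable_heat (by positivity) (hPi (i - 1))).sub (hPi (i + 1))
  have hDI : ∀ i, ∫ x, D i x =
      (∫ x, Phi l (uh (i - 1) g x)) - ∫ x, Phi l (uh (i + 1) g x) := fun i => by
    simp only [hD]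
    rw [integral_sub (integrable_heat (by positivity) (hPi (i - 1))) (hPi (i + 1)),
      integral_heat (by positivity) (hPi (i - 1)) (fun z => Phi_nonneg hl (hu0 _ z))
      (hPc _).measurable]
  have hmain := tsum_int_le_of_telescope (c := fun i => ∫⁻ x in {x | uh (i + 1) g x ≤ l},
      ‖wh i g x‖ₑ ^ 2) (I := fun i => ∫ x, Phi l (uh i g x)) (K := K * l) (G := ∫ x, g x)
      (by positivity) (fun i => integral_nonneg fun x => Phi_nonneg hl (hu0 i x)) (fun i => ?_)
      (fun i => ?_) (fun i => ?_)
  · refine hmain.trans (le_of_eq ?_)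
    rw [← ofReal_integral_eq_lintegral_ofReal hgi (Eventually.of_forall h0),
      ← ENNReal.ofReal_mul (by positivity)]
    congr 1; ring
  · rw [← integral_heat (hp i) hgi h0 hgc.measurable]
    exact integral_mono (hPi i) (hui i) fun x => Phi_le hl (hu0 i x)
  · have h1 := hDI i
    have h2 : 0 ≤ ∫ x, D i x := integral_nonneg fun x => (key i x).1
    linarith
  · rw [← hDI i, ← integral_const_mul, ofReal_integral_eq_lintegral_ofReal ((hDi i).const_mul _)
      (Eventually.of_forall fun x => mul_nonneg (by positivity) (key i x).1)]
    refine (setLIntegral_mono_ae' (measurableSet_le (huc _).measurable measurable_const)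
      (g := fun x => ENNReal.ofReal (K * l * D i x)) (Eventually.of_forall fun x hx => ?_)).trans
      (setLIntegral_le_lintegral _ _)
    rw [Real.enorm_eq_ofReal_abs, ← ENNReal.ofReal_pow (abs_nonneg _), sq_abs]
    exact ENNReal.ofReal_le_ofReal ((key i x).2 hx)

end

section

variable {d : ℕ}

theorem exists_gk_superlevel {τ : ℝ} (hτ : 0 < τ) (x : Ed d) {s : ℝ} (hs : 0 < s) :
    ∃ ρ : ℝ, {z | s < gk d τ (x - z)} = ball x ρ := by
  set c := (4 * Real.pi * τ) ^ (-(d : ℝ) / 2) with hc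
  have hc0 : 0 < c := by have := Real.pi_pos; positivity
  have key : ∀ z, s < gk d τ (x - z) ↔ ‖x - z‖ ^ 2 < 4 * τ * Real.log (c / s) := fun z => by
    unfold gk
    rw [← hc, mul_comm, ← div_lt_iff₀ hc0, ← Real.log_lt_iff_lt_exp (by positivity),
      lt_neg, ← Real.log_inv, inv_div, div_lt_iff₀ (by positivity), mul_comm (Real.log _)]
  rcases le_or_gt (4 * τ * Real.log (c / s)) 0 with h | h
  · refine ⟨0, ?_⟩
    rw [ball_zero]
    ext z
    simp only [mem_ofPred_eq, key, mem_empty_iff_false, iff_false, not_lt]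
    exact h.trans (sq_nonneg _)
  · refine ⟨√(4 * τ * Real.log (c / s)), ?_⟩
    ext z
    rw [mem_ofPred_eq, key, mem_ball, dist_comm, dist_eq_norm, Real.lt_sqrt (norm_nonneg _)]

theorem Hl_indicator_le {τ : ℝ} (hτ : 0 < τ) {x : Ed d} {F : Set (Ed d)} (hF : MeasurableSet F)
    {A : ℝ≥0∞} (h : ∀ R, volume (F ∩ ball x R) ≤ A * volume (ball x R)) :
    Hl τ (F.indicator 1) x ≤ A := by
  have hgc : Continuous fun z => gk d τ (x - z) := continuous_gk.comp (by fun_prop)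
  have e1 : Hl τ (F.indicator 1) x = ∫⁻ z in F, ENNReal.ofReal (gk d τ (x - z)) := by
    unfold Hl
    rw [← lintegral_indicator hF]
    congr 1; ext z
    by_cases hz : z ∈ F <;> simp [hz]
  have h0 : ∀ μ : Measure (Ed d), 0 ≤ᵐ[μ] fun z => gk d τ (x - z) := fun μ =>
    Eventually.of_forall fun z => gk_nonneg hτ _
  have e2 : ∫⁻ z, ENNReal.ofReal (gk d τ (x - z)) = 1 := by
    rw [lintegral_sub_left_eq_self (fun z => ENNReal.ofReal (gk d τ z)), lintegral_gk hτ]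
  rw [lintegral_eq_lintegral_meas_lt volume (h0 _) hgc.aemeasurable] at e2
  rw [e1, lintegral_eq_lintegral_meas_lt _ (h0 _) hgc.aemeasurable]
  have hm : Measurable fun s : ℝ => volume {z | s < gk d τ (x - z)} :=
    Antitone.measurable fun a b hab => measure_mono fun z hz => lt_of_le_of_lt hab hz
  calc _ ≤ ∫⁻ s in Ioi (0 : ℝ), A * volume {z | s < gk d τ (x - z)} := by
        refine setLIntegral_mono (hm.const_mul A) fun s hs => ?_
        obtain ⟨ρ, hρ⟩ := exists_gk_superlevel (d := d) hτ x hs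
        rw [hρ, Measure.restrict_apply measurableSet_ball, inter_comm]
        exact h ρ
    _ = A := by rw [lintegral_const_mul _ hm, e2, mul_one]

variable [Fact (3 ≤ d)]

theorem exists_exceptional {φ : Ed d → ℝ≥0∞} (hφ : ∫⁻ x, φ x ≠ ⊤) :
    ∃ Ω : Set (Ed d), IsOpen Ω ∧ volume Ω ≤ ENNReal.ofReal (5 ^ d) * ∫⁻ x, φ x ∧
      ∀ x ∉ Ω, ∀ R, ∫⁻ z in ball x R, φ z ≤ volume (ball x R) := by
  set T : Set (Ed d × ℝ) := {q | 0 < q.2 ∧ volume (ball q.1 q.2) < ∫⁻ z in ball q.1 q.2, φ z}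
  set V := volume (ball (0 : Ed d) 1)
  have hV0 : V ≠ 0 := (measure_ball_pos _ _ one_pos).ne'
  have hVt : V ≠ ⊤ := measure_ball_lt_top.ne
  have hd : 1 ≤ d := by have := (Fact.out : 3 ≤ d); omega
  have hball : ∀ (c : Ed d) {r : ℝ}, 0 < r → volume (ball c r) = ENNReal.ofReal (r ^ d) * V := by
    intro c r hr
    rw [Measure.addHaar_ball_of_pos _ _ hr, finrank_euclideanSpace_fin]
  set M := ((∫⁻ x, φ x) / V).toReal
  have hM : (∫⁻ x, φ x) / V ≠ ⊤ := ENNReal.div_ne_top hφ hV0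
  have hR : ∀ q ∈ T, q.2 ≤ 1 + M := by
    intro q hq
    have h1 : ENNReal.ofReal (q.2 ^ d) * V ≤ ∫⁻ x, φ x := by
      rw [← hball q.1 hq.1]
      exact hq.2.le.trans (setLIntegral_le_lintegral _ _)
    rw [← ENNReal.le_div_iff_mul_le (Or.inl hV0) (Or.inl hVt),
      ENNReal.ofReal_le_iff_le_toReal hM] at h1
    have hM0 : 0 ≤ M := ENNReal.toReal_nonneg
    rcases le_or_gt q.2 1 with h2 | h2
    · linarith
    · have := le_self_pow₀ h2.le (n := d) (by omega)
      linarith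
  obtain ⟨u, huT, hdis, hcov⟩ := Vitali.exists_disjoint_subfamily_covering_enlargement_ball T
    (fun q => q.1) (fun q => q.2) (1 + M) hR 5 (by norm_num)
  have hu : u.Countable := hdis.countable_of_isOpen (fun _ _ => isOpen_ball)
    fun q hq => nonempty_ball.2 (huT hq).1
  refine ⟨⋃ q ∈ T, ball q.1 q.2, isOpen_biUnion fun _ _ => isOpen_ball, ?_, ?_⟩
  · have := hu.to_subtype
    calc volume (⋃ q ∈ T, ball q.1 q.2) ≤ volume (⋃ q ∈ u, ball q.1 (5 * q.2)) := by
          refine measure_mono (iUnion₂_subset fun q hq => ?_)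
          obtain ⟨b, hb, hqb⟩ := hcov q hq
          exact hqb.trans (subset_biUnion_of_mem (u := fun b : Ed d × ℝ => ball b.1 (5 * b.2)) hb)
      _ ≤ ∑' q : u, volume (ball q.1.1 (5 * q.1.2)) := measure_biUnion_le _ hu _
      _ ≤ ∑' q : u, ENNReal.ofReal (5 ^ d) * ∫⁻ z in ball q.1.1 q.1.2, φ z := by
          refine ENNReal.tsum_le_tsum fun q => ?_
          have hq := huT q.2
          rw [hball _ (by have := hq.1; positivity), mul_pow, ENNReal.ofReal_mul (by positivity),
            mul_assoc, ← hball q.1.1 hq.1]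
          gcongr
          exact hq.2.le
      _ = ENNReal.ofReal (5 ^ d) * ∫⁻ z in ⋃ q ∈ u, ball q.1 q.2, φ z := by
          rw [ENNReal.tsum_mul_left, lintegral_biUnion hu (fun _ _ => measurableSet_ball) hdis]
      _ ≤ _ := by
          gcongr
          exact Measure.restrict_le_self
  · intro x hx R
    rcases le_or_gt R 0 with hR0 | hR0
    · simp [ball_eq_empty.2 hR0]
    · by_contra! hlt
      exact hx (mem_biUnion (show (x, R) ∈ T from ⟨hR0, hlt⟩) (mem_ball_self hR0))

end

section

variable {d : ℕ}

section

variable {Ω : Set (Ed d)} {v w : Ed d → ℝ≥0∞} {A : ℝ≥0∞}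

theorem Hl_le_of_infDist_lt (hv : Measurable v) (hne : Ωᶜ.Nonempty)
    (H : ∀ x ∉ Ω, ∀ τ > 0, Hl τ v x ≤ A) {y : Ed d} {τ R b : ℝ} (hτ : 0 < τ)
    (hy : infDist y Ωᶜ < R) (h1 : τ ≤ b) (h2 : R ^ 2 ≤ b) :
    Hl τ v y ≤ ENNReal.ofReal ((2 * b / τ) ^ ((d : ℝ) / 2) * Real.exp (1 / 4)) * A := by
  obtain ⟨x, hx, hxy⟩ := (infDist_lt_iff hne).1 hy
  have hb : 0 < b := hτ.trans_le h1
  refine (Hl_le_mul_Hl (x' := x) (b := 2 * b) (c := 1 / 4) hτ (by positivity) hv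
    fun z _ => ?_).trans (mul_le_mul_right (H x hx _ (by positivity)) _)
  have e1 : ‖x - z‖ ≤ dist y x + ‖y - z‖ := by
    rw [← dist_eq_norm, ← dist_eq_norm, dist_comm y x]; exact dist_triangle _ _ _
  have e2 : ‖x - z‖ ^ 2 ≤ 2 * b + 2 * ‖y - z‖ ^ 2 := by
    have h3 : dist y x ^ 2 ≤ b := (pow_le_pow_left₀ dist_nonneg hxy.le 2).trans h2
    have h4 := pow_le_pow_left₀ (norm_nonneg _) e1 2
    nlinarith [sq_nonneg (dist y x - ‖y - z‖)]
  calc ‖x - z‖ ^ 2 / (4 * (2 * b)) ≤ (2 * b + 2 * ‖y - z‖ ^ 2) / (4 * (2 * b)) := by gcongr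
    _ = ‖y - z‖ ^ 2 / (4 * b) + 1 / 4 := by field_simp; ring
    _ ≤ _ := by gcongr

theorem exists_pow_mul_exp_le (m : ℕ) {c : ℝ} (hc : 0 < c) :
    ∃ C : ℝ, 0 < C ∧ ∀ q : ℝ, 0 ≤ q → (2 + q) ^ m * Real.exp (-(c * q)) ≤ C := by
  refine ⟨(m.factorial : ℝ) / c ^ m * Real.exp (2 * c), by positivity, fun q hq => ?_⟩
  have h := Real.pow_div_factorial_le_exp (c * (2 + q)) (by positivity) m
  rw [div_le_iff₀ (by positivity), mul_pow] at h
  have h2 : (2 + q) ^ m ≤ (m.factorial : ℝ) / c ^ m * Real.exp (c * (2 + q)) := by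
    rw [div_mul_eq_mul_div, le_div_iff₀ (by positivity)]; linarith
  calc _ ≤ (m.factorial : ℝ) / c ^ m * Real.exp (c * (2 + q)) * Real.exp (-(c * q)) := by gcongr
    _ = _ := by rw [mul_assoc, ← Real.exp_add]; ring_nf

theorem exists_Hl_le_of_far (d : ℕ) : ∃ C : ℝ, 0 < C ∧ ∀ (Ω : Set (Ed d)) (v w : Ed d → ℝ≥0∞)
    (A : ℝ≥0∞), Measurable v → Measurable w → Ωᶜ.Nonempty → (∀ x ∉ Ω, ∀ τ > 0, Hl τ v x ≤ A) →
    (∀ z, w z ≤ v z) → ∀ (y : Ed d) (τ s R : ℝ), 0 < τ → 0 < s → τ ≤ s ^ 2 → 0 < R →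
    (∀ z, w z ≠ 0 → R / 2 ≤ ‖y - z‖ ∧ infDist z Ωᶜ ≤ R) →
    Hl τ w y ≤ ENNReal.ofReal (C * (s / R)) * A := by
  obtain ⟨C₀, hC₀, hC⟩ := exists_pow_mul_exp_le (d + 1) (c := 1 / 512) (by norm_num)
  refine ⟨2 ^ ((d : ℝ) / 2) * Real.exp (1 / 4) * C₀, by positivity, ?_⟩
  intro Ω v w A hv hw hne H hwv y τ s R hτ hs hτs hR hsupp
  set r := infDist y Ωᶜ with hr
  have hr0 : 0 ≤ r := infDist_nonneg
  obtain ⟨R', hR', hR4, hrR⟩ : ∃ R' : ℝ, r < R' ∧ 4 * R ≤ R' ∧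
      ∀ z, w z ≠ 0 → R' / 8 ≤ ‖y - z‖ := by
    refine ⟨max (4 * R) (2 * r), ?_, le_max_left _ _, fun z hz => ?_⟩
    · rcases hr0.eq_or_lt with h | h
      · rw [← h]; exact lt_max_of_lt_left (by positivity)
      · exact lt_max_of_lt_right (by linarith)
    · obtain ⟨h1, h2⟩ := hsupp z hz
      have h3 : r ≤ infDist z Ωᶜ + dist y z := infDist_le_infDist_add_dist
      rw [dist_eq_norm] at h3
      rcases max_cases (4 * R) (2 * r) with ⟨h, _⟩ | ⟨h, _⟩ <;> rw [h] <;> linarith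
  have hR'0 : 0 < R' := by linarith
  have h1 := Hl_le_mul_Hl (x := y) (x' := y) (b := 2 * τ) (c := -(R' ^ 2 / (512 * τ))) hτ
    (by positivity) hw fun z hz => by
      have h2 : (R' / 8) ^ 2 ≤ ‖y - z‖ ^ 2 := pow_le_pow_left₀ (by positivity) (hrR z hz) 2
      have h3 : R' ^ 2 / (512 * τ) ≤ ‖y - z‖ ^ 2 / (8 * τ) := by
        rw [div_le_div_iff₀ (by positivity) (by positivity)]
        nlinarith
      have h4 : ‖y - z‖ ^ 2 / (4 * τ) = ‖y - z‖ ^ 2 / (8 * τ) + ‖y - z‖ ^ 2 / (8 * τ) := by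
        field_simp; ring
      rw [show 4 * (2 * τ) = 8 * τ by ring, h4]
      linarith
  have h2 := Hl_le_of_infDist_lt hv hne H (τ := 2 * τ) (b := 2 * τ + R' ^ 2) (by positivity) hR'
    (by nlinarith [sq_nonneg R']) (by linarith)
  refine (h1.trans (mul_le_mul_right ((Hl_mono hwv y).trans h2) _)).trans ?_
  rw [← mul_assoc, ← ENNReal.ofReal_mul (by positivity)]
  refine mul_le_mul_left (ENNReal.ofReal_le_ofReal ?_) _
  have e1 : 2 * τ / τ = 2 := by field_simp
  set q := R' ^ 2 / τ with hq
  have e2 : 2 * (2 * τ + R' ^ 2) / (2 * τ) = 2 + q := by rw [hq]; field_simp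
  have e3 : -(R' ^ 2 / (512 * τ)) = -(1 / 512 * q) := by rw [hq]; field_simp
  rw [e1, e2, e3]
  have hq0 : 0 ≤ q := by positivity
  have hRs : R / s ≤ 2 + q := by
    have h5 : (R / s) ^ 2 ≤ q := by
      rw [div_pow, hq]
      gcongr
      linarith
    nlinarith [sq_nonneg (R / s - 1)]
  have h6 : (2 + q) ^ ((d : ℝ) / 2) ≤ (2 + q) ^ d := by
    rw [← Real.rpow_natCast]
    exact Real.rpow_le_rpow_of_exponent_le (by linarith)
      (half_le_self (Nat.cast_nonneg d))
  have h7 : (2 + q) ^ ((d : ℝ) / 2) ≤ s / R * (2 + q) ^ (d + 1) := by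
    have : 1 ≤ s / R * (2 + q) := by
      calc (1:ℝ) = s / R * (R / s) := by field_simp
        _ ≤ _ := by gcongr
    calc _ ≤ (2 + q) ^ d * 1 := by rw [mul_one]; exact h6
      _ ≤ (2 + q) ^ d * (s / R * (2 + q)) := by gcongr
      _ = _ := by ring
  calc _ ≤ 2 ^ ((d : ℝ) / 2) * Real.exp (-(1 / 512 * q)) *
        (s / R * (2 + q) ^ (d + 1) * Real.exp (1 / 4)) := by gcongr
    _ = 2 ^ ((d : ℝ) / 2) * Real.exp (1 / 4) * (s / R) *
        ((2 + q) ^ (d + 1) * Real.exp (-(1 / 512 * q))) := by ring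
    _ ≤ 2 ^ ((d : ℝ) / 2) * Real.exp (1 / 4) * (s / R) * C₀ := by gcongr; exact hC q hq0
    _ = _ := by ring

theorem exists_Hl_indicator_infDist_le (d : ℕ) {K : ℝ} (hK : 0 < K) :
    ∃ C : ℝ, 0 < C ∧ ∀ (Ω : Set (Ed d)) (v : Ed d → ℝ≥0∞)
    (A : ℝ≥0∞), Measurable v → Ωᶜ.Nonempty → (∀ x ∉ Ω, ∀ τ > 0, Hl τ v x ≤ A) →
    ∀ R > 0, ∀ y, Hl (K * R ^ 2) ({z | infDist z Ωᶜ ≤ R}.indicator v) y ≤ ENNReal.ofReal C * A := by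
  obtain ⟨C₀, hC₀, hC⟩ := exists_Hl_le_of_far d
  refine ⟨max ((2 * (K + 4) / K) ^ ((d : ℝ) / 2) * Real.exp (1 / 4)) (C₀ * (1 + K)),
    lt_max_of_lt_left (by positivity), ?_⟩
  intro Ω v A hv hne H R hR y
  have hm : Measurable ({z | infDist z Ωᶜ ≤ R}.indicator v) :=
    hv.indicator (measurableSet_le (continuous_infDist_pt _).measurable measurable_const)
  have hle : ∀ z, {z | infDist z Ωᶜ ≤ R}.indicator v z ≤ v z := fun z => indicator_le_self _ _ z
  rcases lt_or_ge (infDist y Ωᶜ) (2 * R) with h | h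
  · refine ((Hl_mono hle y).trans (Hl_le_of_infDist_lt hv hne H (b := K * R ^ 2 + 4 * R ^ 2)
      (by positivity) h (by nlinarith [sq_nonneg R]) (by nlinarith [sq_nonneg R]))).trans ?_
    refine mul_le_mul_left (ENNReal.ofReal_le_ofReal ?_) _
    refine le_trans (le_of_eq ?_) (le_max_left _ _)
    congr 2; field_simp
  · refine (hC Ω v _ A hv hm hne H hle y (K * R ^ 2) ((1 + K) * R) R (by positivity)
      (by positivity) ?_ hR ?_).trans ?_
    · rw [mul_pow]; gcongr; nlinarith
    · intro z hz
      have hz' : infDist z Ωᶜ ≤ R := by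
        by_contra hc; exact hz (indicator_of_notMem (s := {z | infDist z Ωᶜ ≤ R}) hc _)
      have h3 : infDist y Ωᶜ ≤ infDist z Ωᶜ + dist y z := infDist_le_infDist_add_dist
      rw [dist_eq_norm] at h3
      exact ⟨by linarith, hz'⟩
    · refine mul_le_mul_left (ENNReal.ofReal_le_ofReal ?_) _
      refine le_trans (le_of_eq ?_) (le_max_right _ _)
      field_simp

end

theorem AH_le_of_far [Fact (3 ≤ d)] {Ω : Set (Ed d)} {v w : Ed d → ℝ≥0∞} {A : ℝ≥0∞}
    (hw : Measurable w)
    (H : ∀ x ∉ Ω, ∀ τ > 0, Hl τ v x ≤ A) (hwv : ∀ z, w z ≤ v z) {x : Ed d} (hx : x ∉ Ω)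
    {t s : ℝ} (ht : 0 < t) (hs : 0 < s) (hsupp : ∀ z, w z ≠ 0 → 8 * t ≤ infDist z Ωᶜ) :
    AH t s w x ≤ ENNReal.ofReal (2 ^ ((d : ℝ) / 2) * (s / (4 * t ^ 2))) * A := by
  have h1 := AH_le_mul_AH (t := t) (t' := 0) (x := x) (x' := x) (b := 2 * s)
    (c := -(4 * t ^ 2 / s)) hs (by positivity) hw fun y z hz => by
      have h2 : 8 * t ≤ ‖x - z‖ := by
        refine (hsupp z hz).trans ?_
        rw [← dist_eq_norm, dist_comm]
        exact infDist_le_dist_of_mem hx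
      have hy : ‖t • (y : Ed d)‖ = t := by
        rw [norm_smul, Real.norm_of_nonneg ht.le, mem_sphere_zero_iff_norm.1 y.2, mul_one]
      have h3 : ‖x - z‖ ≤ ‖x - t • (y : Ed d) - z‖ + t := by
        calc ‖x - z‖ = ‖(x - t • (y : Ed d) - z) + t • (y : Ed d)‖ := by congr 1; abel
          _ ≤ _ := (norm_add_le _ _).trans_eq (by rw [hy])
      have h4 : 7 / 8 * ‖x - z‖ ≤ ‖x - t • (y : Ed d) - z‖ := by linarith
      have h5 := pow_le_pow_left₀ (by positivity) h4 2
      have h6 := pow_le_pow_left₀ (by positivity) h2 2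
      rw [zero_smul, sub_zero, ← sub_eq_add_neg, le_sub_iff_add_le, div_add_div _ _ (by positivity)
        (by positivity), div_le_div_iff₀ (by positivity) (by positivity)]
      have : ‖x - z‖ ^ 2 / 8 + 4 * t ^ 2 ≤ ‖x - t • (y : Ed d) - z‖ ^ 2 / 4 := by nlinarith
      have := mul_le_mul_of_nonneg_right this (show 0 ≤ 32 * s ^ 3 by positivity)
      nlinarith
  refine h1.trans ?_
  have h2 : AH 0 (2 * s) w x ≤ A := by
    unfold AH
    simp only [zero_smul, sub_zero]
    simpa using (Hl_mono hwv x).trans (H x hx (2 * s) (by positivity))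
  refine mul_le_mul' (ENNReal.ofReal_le_ofReal ?_) h2
  rw [show 2 * s / s = 2 by field_simp]
  gcongr
  have h3 := Real.add_one_le_exp (4 * t ^ 2 / s)
  rw [Real.exp_neg, inv_le_comm₀ (Real.exp_pos _) (by positivity), inv_div]
  linarith

end

section

open Polynomial

variable {d : ℕ}

/-- A function `g` with values in `[0, 1]` dominated by `v`, whose heat averages are at most `A` at
the points outside `Ω`. -/
structure Controlled (Ω : Set (Ed d)) (A : ℝ) (v : Ed d → ℝ≥0∞) (g : Ed d → ℝ) : Prop where
  nonempty : Ωᶜ.Nonempty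
  A_nonneg : 0 ≤ A
  measurable : Measurable v
  Hl_le : ∀ x ∉ Ω, ∀ τ > 0, Hl τ v x ≤ ENNReal.ofReal A
  continuous : Continuous g
  integrable : Integrable g
  nonneg : ∀ z, 0 ≤ g z
  le_one : ∀ z, g z ≤ 1
  le : ∀ z, ENNReal.ofReal (g z) ≤ v z

/-- Points whose distance to the complement of `Ω` lies in `(a, b]`. -/
def shell (Ω : Set (Ed d)) (a b : ℝ) : Set (Ed d) :=
  {z | a < infDist z Ωᶜ ∧ infDist z Ωᶜ ≤ b}

theorem measurableSet_shell (Ω : Set (Ed d)) (a b : ℝ) : MeasurableSet (shell Ω a b) :=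
  (measurableSet_lt measurable_const (continuous_infDist_pt _).measurable).inter
    (measurableSet_le (continuous_infDist_pt _).measurable measurable_const)

theorem tsum_indicator_shell_le (Ω : Set (Ed d)) (J : ℕ) (v : Ed d → ℝ≥0∞) (z : Ed d) :
    ∑' k : ℤ, (shell Ω (2 ^ (k - (J : ℤ)) / 2) (2 ^ (k + 4))).indicator v z ≤
      ((J + 5 : ℕ) : ℝ≥0∞) * v z := by
  rcases (infDist_nonneg (x := z) (s := Ωᶜ)).eq_or_lt with h0 | h0
  · rw [ENNReal.tsum_eq_zero.2 fun k => ?_]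
    · exact zero_le
    · refine indicator_of_notMem (fun h => ?_) _
      have h1 := h.1
      rw [← h0] at h1
      have : (0 : ℝ) < 2 ^ (k - (J : ℤ)) / 2 := by positivity
      linarith
  · obtain ⟨m, hm⟩ := exists_mem_Ioc_zpow h0 (one_lt_two (α := ℝ))
    rw [tsum_eq_sum (s := Finset.Icc (m - 3) (m + J + 1))]
    · refine (Finset.sum_le_card_nsmul _ _ (v z) fun k _ => indicator_le_self _ _ z).trans ?_
      rw [nsmul_eq_mul, Int.card_Icc]
      gcongr
      omega
    · intro k hk
      refine indicator_of_notMem (fun h => hk ?_) _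
      have h1 : (2 : ℝ) ^ (k - (J : ℤ) - 1) < 2 ^ (m + 1) := by
        rw [zpow_sub_one₀ two_ne_zero, ← div_eq_mul_inv]
        exact h.1.trans_le hm.2
      have h2 : (2 : ℝ) ^ m < 2 ^ (k + 4) := hm.1.trans_le h.2
      rw [zpow_lt_zpow_iff_right₀ one_lt_two] at h1 h2
      rw [Finset.mem_Icc]
      omega

theorem tsum_lintegral_indicator_shell_le (Ω : Set (Ed d)) (J : ℕ) {v : Ed d → ℝ≥0∞}
    (hv : Measurable v) :
    ∑' k : ℤ, ∫⁻ z, (shell Ω (2 ^ (k - (J : ℤ)) / 2) (2 ^ (k + 4))).indicator v z ≤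
      ((J + 5 : ℕ) : ℝ≥0∞) * ∫⁻ z, v z := by
  rw [← lintegral_tsum fun k => (hv.indicator (measurableSet_shell _ _ _)).aemeasurable,
    ← lintegral_const_mul _ hv]
  exact lintegral_mono fun z => tsum_indicator_shell_le Ω J v z

variable {Ω : Set (Ed d)} {A : ℝ} {v : Ed d → ℝ≥0∞} {g : Ed d → ℝ}

namespace Controlled

theorem abs_le_one (h : Controlled Ω A v g) (z : Ed d) : |g z| ≤ 1 := by
  rw [abs_of_nonneg (h.nonneg z)]; exact h.le_one z

theorem uh_nonneg (h : Controlled Ω A v g) (i : ℤ) (y : Ed d) : 0 ≤ uh i g y :=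
  heat_nonneg (by positivity) h.nonneg y

theorem uh_le_one (h : Controlled Ω A v g) (i : ℤ) (y : Ed d) : uh i g y ≤ 1 :=
  (le_abs_self _).trans (abs_heat_le (by positivity) h.abs_le_one y)

theorem ofReal_uh_le (h : Controlled Ω A v g) (i : ℤ) (y : Ed d) :
    ENNReal.ofReal (uh i g y) ≤ Hl (4 ^ i / 3) v y := by
  unfold uh
  rw [ofReal_heat (by positivity) h.integrable h.nonneg]
  exact Hl_mono h.le y

theorem enorm_wh_le (h : Controlled Ω A v g) (i : ℤ) (y : Ed d) :
    ‖wh i g y‖ₑ ≤ ENNReal.ofReal (2 ^ d) * ENNReal.ofReal (uh (i + 1) g y) := by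
  rw [← ENNReal.ofReal_mul (by positivity), Real.enorm_eq_ofReal_abs]
  refine ENNReal.ofReal_le_ofReal ?_
  have h1 : uh i g y ≤ 2 ^ d * uh (i + 1) g y := by
    have h2 := heat_le_heat_of_le (a := 4 ^ i / 3) (b := 4 ^ (i + 1) / 3) (by positivity)
      (by gcongr <;> norm_num) h.integrable h.nonneg y
    have h3 : (4 : ℝ) ^ (i + 1) / 3 / (4 ^ i / 3) = 2 ^ (2 : ℝ) := by
      rw [zpow_add_one₀ (by norm_num)]; field_simp; norm_num
    rw [h3, ← Real.rpow_mul (by norm_num), mul_div_cancel₀ _ two_ne_zero,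
      Real.rpow_natCast] at h2
    exact h2
  have h4 := h.uh_nonneg i y
  have h5 := h.uh_nonneg (i + 1) y
  have h6 : (1 : ℝ) ≤ 2 ^ d := one_le_pow₀ one_le_two
  unfold wh
  rw [_root_.abs_le]
  constructor <;> nlinarith

theorem uh_le (h : Controlled Ω A v g) {J n : ℕ} (hJ : J ≤ n) (k : ℤ) {y : Ed d}
    (hy : infDist y Ωᶜ ≤ 2 ^ (k - (J : ℤ))) :
    uh (k - n + 1) g y ≤ 6 ^ ((d : ℝ) / 2) * Real.exp (1 / 4) * 2 ^ ((n - J) * d) * A := by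
  set R : ℝ := 2 ^ (k - (J : ℤ)) with hR
  have hR0 : 0 < R := by positivity
  have e1 : (2 : ℝ) ^ (n - J) * 2 ^ (k - (n : ℤ)) = R := by
    rw [hR, ← zpow_natCast, ← zpow_add₀ two_ne_zero]; congr 1; push_cast [hJ]; ring
  have h1 := Hl_le_of_infDist_lt h.measurable h.nonempty h.Hl_le (τ := 4 ^ (k - n + 1 : ℤ) / 3)
    (b := 4 * R ^ 2) (R := 2 * R) (by positivity) (y := y) (by linarith) (by
      rw [zpow_add_one₀ (by norm_num), four_zpow, ← e1, mul_pow]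
      have : (1 : ℝ) ≤ 2 ^ (n - J) := one_le_pow₀ one_le_two
      have : (1 : ℝ) ≤ (2 ^ (n - J)) ^ 2 := one_le_pow₀ this
      have h0 : 0 < ((2 : ℝ) ^ (k - (n : ℤ))) ^ 2 := by positivity
      nlinarith) (by linarith)
  have h2 := (h.ofReal_uh_le _ y).trans h1
  rw [← ENNReal.ofReal_mul (by positivity), ENNReal.ofReal_le_ofReal_iff
    (mul_nonneg (by positivity) h.A_nonneg)] at h2
  refine h2.trans (le_of_eq ?_)
  congr 1
  have e2 : 2 * (4 * R ^ 2) / (4 ^ (k - n + 1 : ℤ) / 3) = 6 * (2 ^ (n - J)) ^ (2 : ℝ) := by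
    rw [zpow_add_one₀ (by norm_num), four_zpow, ← e1, Real.rpow_two]
    field_simp; norm_num
  rw [e2, Real.mul_rpow (by norm_num) (by positivity), ← Real.rpow_mul (by positivity),
    mul_div_cancel₀ _ two_ne_zero, Real.rpow_natCast, ← pow_mul]
  ring

end Controlled

/-- The part of `wh` at scale `k - n` above height `l` which is caused by the middle shell. -/
def mid (Ω : Set (Ed d)) (v : Ed d → ℝ≥0∞) (g : Ed d → ℝ) (J n : ℕ) (l : ℝ) (k : ℤ) :
    Ed d → ℝ≥0∞ :=
  {y | l < uh (k - n + 1) g y ∧ ENNReal.ofReal (uh (k - n + 1) g y) ≤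
    2 * Hl (4 ^ (k - n + 1 : ℤ) / 3)
      ((shell Ω (2 ^ (k - (J : ℤ)) / 2) (2 ^ (k + 4))).indicator v) y}.indicator
    fun y => ‖wh (k - n) g y‖ₑ

theorem mid_le {J n : ℕ} {l : ℝ} {k : ℤ} {y : Ed d} {b : ℝ≥0∞}
    (h : l < uh (k - n + 1) g y → ENNReal.ofReal (uh (k - n + 1) g y) ≤
      2 * Hl (4 ^ (k - n + 1 : ℤ) / 3)
        ((shell Ω (2 ^ (k - (J : ℤ)) / 2) (2 ^ (k + 4))).indicator v) y → ‖wh (k - n) g y‖ₑ ≤ b) :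
    mid Ω v g J n l k y ≤ b := by
  unfold mid
  rw [indicator_apply]
  split_ifs with hy
  · exact h hy.1 hy.2
  · exact zero_le

namespace Controlled

theorem continuous_uh (h : Controlled Ω A v g) (i : ℤ) : Continuous (uh i g) :=
  continuous_heat (by positivity) h.integrable

theorem integrable_uh (h : Controlled Ω A v g) (i : ℤ) : Integrable (uh i g) :=
  integrable_heat (by positivity) h.integrable

theorem continuous_wh (h : Controlled Ω A v g) (i : ℤ) : Continuous (wh i g) :=
  (h.continuous_uh i).sub (h.continuous_uh (i + 1))

theorem integrable_wh (h : Controlled Ω A v g) (i : ℤ) : Integrable (wh i g) :=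
  (h.integrable_uh i).sub (h.integrable_uh (i + 1))

theorem measurable_mid (h : Controlled Ω A v g) (J n : ℕ) (l : ℝ) (k : ℤ) :
    Measurable (mid Ω v g J n l k) := by
  refine Measurable.indicator (h.continuous_wh _).measurable.enorm ?_
  refine (measurableSet_lt measurable_const (h.continuous_uh _).measurable).inter
    (measurableSet_le (h.continuous_uh _).measurable.ennreal_ofReal ?_)
  exact (measurable_Hl (h.measurable.indicator (measurableSet_shell _ _ _))).const_mul _

theorem tsum_lintegral_mid_le (h : Controlled Ω A v g) (J n : ℕ) (l : ℝ) :
    ∑' k : ℤ, ∫⁻ y, mid Ω v g J n l k y ≤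
      ENNReal.ofReal (2 ^ d * 2 * (J + 5)) * ∫⁻ z, v z := by
  have h1 : ∀ k : ℤ, ∫⁻ y, mid Ω v g J n l k y ≤ ENNReal.ofReal (2 ^ d * 2) *
      ∫⁻ z, (shell Ω (2 ^ (k - (J : ℤ)) / 2) (2 ^ (k + 4))).indicator v z := fun k => by
    have hm := h.measurable.indicator
      (measurableSet_shell Ω (2 ^ (k - (J : ℤ)) / 2) (2 ^ (k + 4)))
    rw [← lintegral_Hl (τ := 4 ^ (k - n + 1 : ℤ) / 3) (by positivity) hm,
      ← lintegral_const_mul _ (measurable_Hl hm)]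
    refine lintegral_mono fun y => ?_
    refine mid_le fun hy1 hy2 => ?_
    refine (h.enorm_wh_le _ y).trans ?_
    rw [ENNReal.ofReal_mul (by positivity), mul_assoc]
    refine mul_le_mul_right (hy2.trans_eq ?_) _
    simp
  refine (ENNReal.tsum_le_tsum h1).trans ?_
  rw [ENNReal.tsum_mul_left, ENNReal.ofReal_mul (p := 2 ^ d * 2) (by positivity), mul_assoc]
  refine mul_le_mul_right ((tsum_lintegral_indicator_shell_le Ω J h.measurable).trans_eq ?_) _
  rw [← ENNReal.ofReal_natCast]; push_cast; rfl

theorem mid_eq_zero (h : Controlled Ω A v g) (J n : ℕ) {l : ℝ} (hl : 1 ≤ l) (k : ℤ) (y : Ed d) :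
    mid Ω v g J n l k y = 0 :=
  indicator_of_notMem (fun hy => absurd hy.1 ((h.uh_le_one _ y).trans hl).not_gt) _

end Controlled

theorem exists_tsum_lintegral_mid_le [Fact (3 ≤ d)] : ∃ C : ℝ, 0 < C ∧ ∀ (Ω : Set (Ed d)) (A : ℝ)
    (v : Ed d → ℝ≥0∞) (g : Ed d → ℝ), Controlled Ω A v g → ∀ (J n : ℕ) (l θ : ℝ), 0 < l → 0 < θ →
    ∑' k : ℤ, ∫⁻ y, mid Ω v g J n l k y ≤
      ENNReal.ofReal (C * (θ + (J + 5) / (θ * l))) * ∫⁻ z, v z := by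
  obtain ⟨C₀, hC₀, hC⟩ := truncated_square (d := d)
  refine ⟨C₀ + 2, by positivity, fun Ω A v g h J n l θ hl hθ => ?_⟩
  have h1 : ∀ k : ℤ, ∫⁻ y, mid Ω v g J n l k y ≤
      ENNReal.ofReal θ * (∫⁻ x in {x | uh (k - n + 1) g x ≤ 1}, ‖wh (k - n) g x‖ₑ ^ 2) +
      ENNReal.ofReal (2 / (θ * l)) *
      ∫⁻ z, (shell Ω (2 ^ (k - (J : ℤ)) / 2) (2 ^ (k + 4))).indicator v z := fun k => by
    have hm := h.measurable.indicator
      (measurableSet_shell Ω (2 ^ (k - (J : ℤ)) / 2) (2 ^ (k + 4)))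
    have huniv : {x | uh (k - n + 1) g x ≤ 1} = univ := eq_univ_of_forall (h.uh_le_one _)
    rw [huniv, Measure.restrict_univ, ← lintegral_const_mul _
      ((h.continuous_wh _).measurable.enorm.pow_const 2),
      ← lintegral_Hl (τ := 4 ^ (k - n + 1 : ℤ) / 3) (by positivity) hm,
      ← lintegral_const_mul _ (measurable_Hl hm),
      ← lintegral_add_left (((h.continuous_wh _).measurable.enorm.pow_const 2).const_mul _)]
    refine lintegral_mono fun y => ?_
    refine mid_le fun hy1 hy2 => ?_
    have e1 : ENNReal.ofReal (1 / θ) ≤ ENNReal.ofReal (2 / (θ * l)) * Hl (4 ^ (k - n + 1 : ℤ) / 3)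
        ((shell Ω (2 ^ (k - (J : ℤ)) / 2) (2 ^ (k + 4))).indicator v) y := by
      have e2 : ENNReal.ofReal (2 / (θ * l)) = ENNReal.ofReal (1 / (θ * l)) * 2 := by
        rw [show 2 / (θ * l) = 1 / (θ * l) * 2 by ring, ENNReal.ofReal_mul (by positivity)]; simp
      rw [e2, mul_assoc]
      refine le_trans ?_ (mul_le_mul_right hy2 _)
      rw [← ENNReal.ofReal_mul (by positivity)]
      refine ENNReal.ofReal_le_ofReal ?_
      calc 1 / θ = 1 / (θ * l) * l := by field_simp
        _ ≤ _ := by gcongr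
    refine le_trans ?_ (add_le_add le_rfl e1)
    rw [Real.enorm_eq_ofReal_abs, ← ENNReal.ofReal_pow (abs_nonneg _),
      ← ENNReal.ofReal_mul hθ.le, ← ENNReal.ofReal_add (by positivity) (by positivity)]
    refine ENNReal.ofReal_le_ofReal ?_
    set a := |wh (k - n) g y|
    have : a * θ ≤ θ * a ^ 2 * θ + 1 := by nlinarith [sq_nonneg (a * θ - 1)]
    rw [← sub_nonneg] at this ⊢
    have e3 : θ * a ^ 2 + 1 / θ - a = (θ * a ^ 2 * θ + 1 - a * θ) / θ := by field_simp
    rw [e3]; positivity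
  refine (ENNReal.tsum_le_tsum h1).trans ?_
  rw [ENNReal.tsum_add, ENNReal.tsum_mul_left, ENNReal.tsum_mul_left]
  have h2 : ∑' k : ℤ, ∫⁻ x in {x | uh (k - n + 1) g x ≤ 1}, ‖wh (k - n) g x‖ₑ ^ 2 ≤
      ENNReal.ofReal (C₀ * 1) * ∫⁻ z, v z := by
    refine le_trans (le_of_eq ?_) ((hC g 1 1 h.continuous h.integrable h.nonneg h.abs_le_one
      one_pos).trans (mul_le_mul_right (lintegral_mono h.le) _))
    exact (Equiv.subRight (n : ℤ)).tsum_eq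
      fun i => ∫⁻ x in {x | uh (i + 1) g x ≤ 1}, ‖wh i g x‖ₑ ^ 2
  refine (add_le_add (mul_le_mul_right h2 _) (mul_le_mul_right
    (tsum_lintegral_indicator_shell_le Ω J h.measurable) _)).trans ?_
  rw [← mul_assoc, ← mul_assoc, ← add_mul, ← ENNReal.ofReal_mul hθ.le, ← ENNReal.ofReal_natCast,
    ← ENNReal.ofReal_mul (by positivity), ← ENNReal.ofReal_add (by positivity) (by positivity)]
  refine mul_le_mul_left (ENNReal.ofReal_le_ofReal ?_) _
  push_cast
  have : 0 ≤ C₀ * ((J + 5) / (θ * l)) := by positivity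
  have e : 2 / (θ * l) * ((J : ℝ) + 5) = 2 * ((J + 5) / (θ * l)) := by ring
  rw [e]
  nlinarith

end

section

open Polynomial

variable {d : ℕ} {Ω : Set (Ed d)} {A : ℝ} {v : Ed d → ℝ≥0∞} {g : Ed d → ℝ}

theorem measurable_far (hv : Measurable v) (b : ℝ) :
    Measurable ({z | b < infDist z Ωᶜ}.indicator v) :=
  hv.indicator (measurableSet_lt measurable_const (continuous_infDist_pt _).measurable)

theorem measurable_near (hv : Measurable v) (b : ℝ) :
    Measurable ({z | infDist z Ωᶜ ≤ b}.indicator v) :=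
  hv.indicator (measurableSet_le (continuous_infDist_pt _).measurable measurable_const)

theorem le_near_add_shell_add_far (a b : ℝ) (z : Ed d) :
    v z ≤ {z | infDist z Ωᶜ ≤ a}.indicator v z +
      ((shell Ω a b).indicator v z + {z | b < infDist z Ωᶜ}.indicator v z) := by
  rcases le_or_gt (infDist z Ωᶜ) a with h | h
  · rw [indicator_of_mem (s := {z | infDist z Ωᶜ ≤ a}) h]
    exact le_self_add
  · rcases le_or_gt (infDist z Ωᶜ) b with h' | h'
    · rw [indicator_of_mem (show z ∈ shell Ω a b from ⟨h, h'⟩)]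
      exact le_self_add.trans le_add_self
    · rw [indicator_of_mem (s := {z | b < infDist z Ωᶜ}) h']
      exact le_add_self.trans le_add_self

variable [Fact (3 ≤ d)]

theorem Qop_add {t τ : ℝ} (hτ : 0 < τ) {v w : Ed d → ℝ} (hv : Integrable v) (hw : Integrable w)
    (x : Ed d) : Qop t τ (fun z => v z + w z) x = Qop t τ v x + Qop t τ w x := by
  unfold Qop
  rw [lam_eq_sum, lam_eq_sum, lam_eq_sum, ← Finset.sum_add_distrib]
  refine Finset.sum_congr rfl fun j _ => ?_
  rw [AHr_add (by positivity) hv hw, mul_add]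

theorem AH_le_of_Hl_le {t τ : ℝ} {v : Ed d → ℝ≥0∞} {c : ℝ≥0∞} (h : ∀ y, Hl τ v y ≤ c) (x : Ed d) :
    AH t τ v x ≤ c := by
  unfold AH
  calc _ ≤ ∫⁻ _ : sphere (0 : Ed d) 1, c ∂(sphereProb d) := lintegral_mono fun _ => h _
    _ = c := by simp

theorem Controlled.AH_far_le (h : Controlled Ω A v g) {E : Set ℝ} {x : Ed d} (hx : x ∉ Ω) {k : ℤ}
    {t s M : ℝ} (ht : t ∈ Ek E k) (hs : 0 < s) (hM : s ≤ M * 4 ^ k) :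
    AH t s ({z | 2 ^ (k + 4) < infDist z Ωᶜ}.indicator v) x ≤
      ENNReal.ofReal (2 ^ ((d : ℝ) / 2) * M) * ENNReal.ofReal A := by
  have hk : (0 : ℝ) < 2 ^ k := by positivity
  have ht0 : 0 < t := hk.trans_le ht.2.1
  refine (AH_le_of_far (measurable_far h.measurable _) h.Hl_le (fun z => indicator_le_self _ _ z)
    hx ht0 hs fun z hz => ?_).trans ?_
  · have h1 : (2 : ℝ) ^ (k + 4) < infDist z Ωᶜ := by
      by_contra hc
      exact hz (indicator_of_notMem (s := {z | 2 ^ (k + 4) < infDist z Ωᶜ}) hc _)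
    have h2 := ht.2.2
    rw [zpow_add_one₀ two_ne_zero] at h2
    rw [zpow_add₀ two_ne_zero] at h1
    norm_num at h1
    linarith
  · refine mul_le_mul_left (ENNReal.ofReal_le_ofReal ?_) _
    gcongr
    rw [div_le_iff₀ (by positivity)]
    rw [four_zpow] at hM
    have h3 : ((2 : ℝ) ^ k) ^ 2 ≤ t ^ 2 := pow_le_pow_left₀ hk.le ht.2.1 2
    have hM0 : 0 ≤ M := by
      by_contra hc
      have : M * ((2 : ℝ) ^ k) ^ 2 ≤ 0 :=
        mul_nonpos_of_nonpos_of_nonneg (not_le.1 hc).le (by positivity)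
      linarith
    nlinarith [mul_le_mul_of_nonneg_left h3 hM0, mul_nonneg hM0 (sq_nonneg t)]

theorem exists_low (d : ℕ) [Fact (3 ≤ d)] : ∃ C : ℝ, 0 < C ∧ ∀ (E : Set ℝ) (Ω : Set (Ed d)) (A : ℝ)
    (v : Ed d → ℝ≥0∞) (g : Ed d → ℝ), Controlled Ω A v g → ∀ (J : ℕ) (N : ℝ≥0∞),
    (∀ k : ℤ, (covN (Ek E k) ((2 : ℝ) ^ (k - (J : ℤ))) : ℝ≥0∞) ≤ N) →
    ∃ G : Ed d → ℝ≥0∞, Measurable G ∧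
      (∀ x ∉ Ω, ∀ k : ℤ, ∀ t ∈ Ek E k,
        ‖Top t (4 ^ (k - (J : ℤ))) g x‖ₑ ≤ ENNReal.ofReal (C * A) + G x) ∧
      ∫⁻ x, G x ≤ ENNReal.ofReal (C * (J + 5)) * N * ∫⁻ z, v z := by
  obtain ⟨C₁, K, hC₁, hK, H₁⟩ := enorm_lam_AHr_le (d := d) (polyL d) (s := 1) one_pos
  obtain ⟨C₂, hC₂, H₂⟩ := exists_Hl_indicator_infDist_le d hK
  obtain ⟨C₃, hC₃, H₃⟩ := exists_sup_AH (d := d) hK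
  refine ⟨C₁ * (C₂ + 2 ^ ((d : ℝ) / 2) * K) + C₁ * C₃, by positivity, ?_⟩
  intro E Ω A v g h J N hN
  have hm2 : ∀ k : ℤ, Measurable ((shell Ω (2 ^ (k - (J : ℤ)) / 2) (2 ^ (k + 4))).indicator v) :=
    fun k => h.measurable.indicator (measurableSet_shell _ _ _)
  choose Y hYm hY hYi using fun k => H₃ E k J _ (hm2 k)
  refine ⟨fun x => ENNReal.ofReal C₁ * ∑' k, Y k x, (Measurable.tsum hYm).const_mul _,
    fun x hx k t ht => ?_, ?_⟩
  · set R : ℝ := 2 ^ (k - (J : ℤ)) with hR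
    have hR0 : 0 < R := by positivity
    have e1 : (4 : ℝ) ^ (k - (J : ℤ)) = R ^ 2 := four_zpow _
    have hle : ∀ z, ‖g z‖ₑ ≤ {z | infDist z Ωᶜ ≤ R}.indicator v z +
        ((shell Ω (R / 2) (2 ^ (k + 4))).indicator v z +
          {z | 2 ^ (k + 4) < infDist z Ωᶜ}.indicator v z) := fun z => by
      rw [Real.enorm_eq_ofReal (h.nonneg z)]
      refine (h.le z).trans ((le_near_add_shell_add_far (Ω := Ω) R (2 ^ (k + 4)) z).trans ?_)
      refine add_le_add le_rfl (add_le_add ?_ le_rfl)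
      exact indicator_le_indicator_of_subset (show shell Ω R (2 ^ (k + 4)) ⊆ shell Ω (R / 2) _ from
        fun z hz => ⟨by linarith [hz.1], hz.2⟩) (fun _ => zero_le) z
    have h1 : AH t (K * 4 ^ (k - (J : ℤ))) (fun z => ‖g z‖ₑ) x ≤
        ENNReal.ofReal C₂ * ENNReal.ofReal A + (Y k x +
          ENNReal.ofReal (2 ^ ((d : ℝ) / 2) * K) * ENNReal.ofReal A) := by
      refine (AH_mono hle x).trans ?_
      rw [AH_add (measurable_near h.measurable _), AH_add (hm2 k)]
      refine add_le_add ?_ (add_le_add (hY k x t ht) ?_)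
      · rw [e1]
        exact AH_le_of_Hl_le (H₂ Ω v _ h.measurable h.nonempty h.Hl_le R hR0) x
      · refine h.AH_far_le hx ht (by positivity) ?_
        gcongr
        · norm_num
        · omega
    refine (H₁ t _ (by positivity) g h.continuous.measurable x).trans ?_
    refine (mul_le_mul_right h1 _).trans ?_
    have h2 : Y k x ≤ ∑' k, Y k x := ENNReal.le_tsum k
    calc _ = ENNReal.ofReal (C₁ * (C₂ + 2 ^ ((d : ℝ) / 2) * K) * A) +
          ENNReal.ofReal C₁ * Y k x := by
          rw [ENNReal.ofReal_mul (p := C₁ * (C₂ + 2 ^ ((d : ℝ) / 2) * K)) (by positivity),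
            ENNReal.ofReal_mul hC₁.le, ENNReal.ofReal_add hC₂.le (by positivity)]
          ring
      _ ≤ _ := by
          refine add_le_add (ENNReal.ofReal_le_ofReal ?_) (mul_le_mul_right h2 _)
          have := h.A_nonneg
          gcongr
          have : 0 < C₁ * C₃ := by positivity
          linarith
  · rw [lintegral_const_mul _ (Measurable.tsum hYm),
      lintegral_tsum fun k => (hYm k).aemeasurable]
    have h1 : ∑' k, ∫⁻ x, Y k x ≤ ENNReal.ofReal C₃ * N *
        (((J + 5 : ℕ) : ℝ≥0∞) * ∫⁻ z, v z) := by
      refine (ENNReal.tsum_le_tsum fun k => (hYi k).trans (mul_le_mul_left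
        (mul_le_mul_right (hN k) _) _)).trans ?_
      rw [ENNReal.tsum_mul_left]
      exact mul_le_mul_right (tsum_lintegral_indicator_shell_le Ω J h.measurable) _
    refine (mul_le_mul_right h1 _).trans ?_
    rw [← ENNReal.ofReal_natCast]
    calc _ = ENNReal.ofReal (C₁ * C₃ * (J + 5)) * N * ∫⁻ z, v z := by
          rw [ENNReal.ofReal_mul (p := C₁ * C₃) (by positivity), ENNReal.ofReal_mul hC₁.le]
          push_cast
          ring
      _ ≤ _ := by
          gcongr
          have : 0 < C₁ * (C₂ + 2 ^ ((d : ℝ) / 2) * K) := by positivity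
          linarith

theorem Controlled.enorm_wh_indicator_le (h : Controlled Ω A v g) {C : ℝ}
    (hC : ∀ (w : Ed d → ℝ≥0∞), Measurable w → (∀ z, w z ≤ v z) → ∀ (y : Ed d) (τ s R : ℝ),
      0 < τ → 0 < s → τ ≤ s ^ 2 → 0 < R →
      (∀ z, w z ≠ 0 → R / 2 ≤ ‖y - z‖ ∧ infDist z Ωᶜ ≤ R) →
      Hl τ w y ≤ ENNReal.ofReal (C * (s / R)) * ENNReal.ofReal A)
    {J n : ℕ} {l : ℝ} {k : ℤ}
    (hl : ∀ y, infDist y Ωᶜ ≤ 2 ^ (k - (J : ℤ)) → uh (k - n + 1) g y ≤ l) (y : Ed d) :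
    ‖{y | l < uh (k - n + 1) g y}.indicator (wh (k - n) g) y‖ₑ ≤
      ENNReal.ofReal (2 ^ d * 2) *
        (ENNReal.ofReal (C * (2 ^ (k - n + 1 : ℤ) / 2 ^ (k - (J : ℤ)))) * ENNReal.ofReal A +
        Hl (4 ^ (k - n + 1 : ℤ) / 3) ({z | 2 ^ (k + 4) < infDist z Ωᶜ}.indicator v) y) +
      mid Ω v g J n l k y := by
  by_cases hy : l < uh (k - n + 1) g y
  swap
  · rw [indicator_of_notMem (s := {y | l < uh (k - n + 1) g y}) hy]; simp
  rw [indicator_of_mem (s := {y | l < uh (k - n + 1) g y}) hy]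
  set R : ℝ := 2 ^ (k - (J : ℤ)) with hR
  set τ : ℝ := 4 ^ (k - n + 1 : ℤ) / 3 with hτ
  set u := ENNReal.ofReal (uh (k - n + 1) g y)
  set U₂ := Hl τ ((shell Ω (R / 2) (2 ^ (k + 4))).indicator v) y
  by_cases hu : u ≤ 2 * U₂
  · refine le_trans (le_of_eq ?_) le_add_self
    unfold mid
    exact (indicator_of_mem (s := {y | l < uh (k - n + 1) g y ∧ ENNReal.ofReal
      (uh (k - n + 1) g y) ≤ 2 * Hl τ ((shell Ω (R / 2) (2 ^ (k + 4))).indicator v) y})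
      ⟨hy, hu⟩ (fun y => ‖wh (k - n) g y‖ₑ)).symm
  refine le_trans ?_ le_self_add
  have hrR : R < infDist y Ωᶜ := by
    by_contra hc
    exact absurd (hl y (not_lt.1 hc)) (not_le.2 hy)
  have hm2 := h.measurable.indicator (measurableSet_shell Ω (R / 2) (2 ^ (k + 4)))
  have hm1 := measurable_near (Ω := Ω) h.measurable (R / 2)
  have h1 : Hl τ ({z | infDist z Ωᶜ ≤ R / 2}.indicator v) y ≤
      ENNReal.ofReal (C * (2 ^ (k - n + 1 : ℤ) / R)) * ENNReal.ofReal A := by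
    refine hC _ hm1 (fun z => indicator_le_self _ _ z) y τ _ R (by positivity) (by positivity) ?_
      (by positivity) fun z hz => ?_
    · rw [hτ, four_zpow]
      have : 0 ≤ ((2 : ℝ) ^ (k - n + 1 : ℤ)) ^ 2 := by positivity
      linarith
    · have hz' : infDist z Ωᶜ ≤ R / 2 := by
        by_contra hc
        exact hz (indicator_of_notMem (s := {z | infDist z Ωᶜ ≤ R / 2}) hc _)
      have h3 : infDist y Ωᶜ ≤ infDist z Ωᶜ + dist y z := infDist_le_infDist_add_dist
      rw [dist_eq_norm] at h3
      constructor
      · linarith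
      · have : 0 < R := by positivity
        linarith
  have h2 : u ≤ Hl τ ({z | infDist z Ωᶜ ≤ R / 2}.indicator v) y +
      (U₂ + Hl τ ({z | 2 ^ (k + 4) < infDist z Ωᶜ}.indicator v) y) := by
    refine (h.ofReal_uh_le _ y).trans
      ((Hl_mono (le_near_add_shell_add_far (Ω := Ω) (R / 2) (2 ^ (k + 4))) y).trans ?_)
    rw [Hl_add hm1, Hl_add hm2]
  set U₁ := Hl τ ({z | infDist z Ωᶜ ≤ R / 2}.indicator v) y
  set U₃ := Hl τ ({z | 2 ^ (k + 4) < infDist z Ωᶜ}.indicator v) y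
  have h3 : u ≤ 2 * (U₁ + U₃) := by
    by_contra hc
    have h4 := ENNReal.add_lt_add (not_le.1 hu) (not_le.1 hc)
    have h5 : u + u ≤ 2 * U₂ + 2 * (U₁ + U₃) := by
      rw [← two_mul]
      refine (mul_le_mul_right h2 2).trans (le_of_eq ?_)
      ring
    exact absurd h5 (not_le.2 h4)
  refine (h.enorm_wh_le _ y).trans ((mul_le_mul_right h3 _).trans ?_)
  rw [ENNReal.ofReal_mul (p := 2 ^ d) (by positivity), mul_assoc]
  refine mul_le_mul_right ?_ _
  rw [show ENNReal.ofReal 2 = 2 by simp]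
  exact mul_le_mul_right (add_le_add h1 le_rfl) _

end

section

open Polynomial

variable {d : ℕ} [Fact (3 ≤ d)]

theorem exists_high (d : ℕ) [Fact (3 ≤ d)] : ∃ C : ℝ, 0 < C ∧ ∀ (E : Set ℝ) (Ω : Set (Ed d))
    (A : ℝ) (v : Ed d → ℝ≥0∞) (g : Ed d → ℝ), Controlled Ω A v g →
    ∀ (J n : ℕ) (l c : ℝ) (N S : ℝ≥0∞), J ≤ n → 0 < l → 0 < c →
    (∀ (k : ℤ) (y : Ed d), infDist y Ωᶜ ≤ 2 ^ (k - (J : ℤ)) → uh (k - n + 1) g y ≤ l) →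
    (∀ k : ℤ, (covN (Ek E k) ((2 : ℝ) ^ (k - (n : ℤ))) : ℝ≥0∞) ≤ N) →
    ∑' k : ℤ, ∫⁻ y, mid Ω v g J n l k y ≤ S →
    ∃ G : Ed d → ℝ≥0∞, Measurable G ∧
      (∀ x ∉ Ω, ∀ k : ℤ, ∀ t ∈ Ek E k, ‖Qop t (4 ^ (k - (n : ℤ))) (wh (k - n) g) x‖ₑ ≤
        ENNReal.ofReal (c + C * A * (2 ^ (n - J))⁻¹) + G x) ∧
      ∫⁻ x, G x ≤ ENNReal.ofReal C * N *
        (ENNReal.ofReal ((2 ^ (n * (d - 1)))⁻¹ * l / c) * (∫⁻ z, v z) + S) := by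
  obtain ⟨C₁, K, hC₁, hK, H₁⟩ := enorm_lam_AHr_le (d := d) (polyS d) (s := 2 / 3) (by norm_num)
  obtain ⟨C₂, hC₂, H₂⟩ := exists_Hl_le_of_far d
  obtain ⟨C₃, hC₃, H₃⟩ := exists_sup_AH (d := d) hK
  obtain ⟨C₄, hC₄, H₄⟩ := exists_sup_Qop (d := d)
  obtain ⟨C₅, hC₅, H₅⟩ := truncated_square (d := d)
  set C₆ : ℝ := C₁ * (2 ^ d * 2) * (2 * C₂ + 2 ^ ((d : ℝ) / 2) * (K + 2)) with hC₆
  have hC₆0 : 0 < C₆ := by positivity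
  refine ⟨C₆ + C₄ * C₅ + C₁ * C₃, by positivity, ?_⟩
  intro E Ω A v g h J n l c N S hJ hl hc hlam hN hS
  have hset : ∀ k : ℤ, MeasurableSet {y | uh (k - n + 1) g y ≤ l} := fun k =>
    measurableSet_le (h.continuous_uh _).measurable measurable_const
  have hset' : ∀ k : ℤ, MeasurableSet {y | l < uh (k - n + 1) g y} := fun k =>
    measurableSet_lt measurable_const (h.continuous_uh _).measurable
  have hlo : ∀ k : ℤ, Integrable ({y | uh (k - n + 1) g y ≤ l}.indicator (wh (k - n) g)) :=
    fun k => (h.integrable_wh _).indicator (hset k)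
  have hhi : ∀ k : ℤ, Integrable ({y | l < uh (k - n + 1) g y}.indicator (wh (k - n) g)) :=
    fun k => (h.integrable_wh _).indicator (hset' k)
  have hlo2 : ∀ k : ℤ, MemLp ({y | uh (k - n + 1) g y ≤ l}.indicator (wh (k - n) g)) 2 := fun k => by
    refine MemLp.indicator (hset k) ?_
    rw [memLp_two_iff_integrable_sq (h.continuous_wh _).aestronglyMeasurable]
    refine (h.integrable_wh (k - n)).abs.mono' ((h.continuous_wh _).pow 2).aestronglyMeasurable
      (Eventually.of_forall fun y => ?_)
    have h1 := h.uh_nonneg (k - n) y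
    have h2 := h.uh_nonneg (k - n + 1) y
    have h3 := h.uh_le_one (k - n) y
    have h4 := h.uh_le_one (k - n + 1) y
    have h5 : |wh (k - n) g y| ≤ 1 := by
      unfold wh; rw [_root_.abs_le]; constructor <;> linarith
    rw [Real.norm_of_nonneg (sq_nonneg _), ← sq_abs]
    nlinarith [abs_nonneg (wh (k - n) g y)]
  choose Y hYm hY hYi using fun k => H₃ E k n _ (h.measurable_mid J n l k)
  choose Z hZm hZ hZi using fun k => H₄ E k n _ (hlo k) (hlo2 k)
  have hJn : (2 : ℝ) ^ (n - J) * 2 ^ J = 2 ^ n := by rw [← pow_add]; congr 1; omega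
  refine ⟨fun x => ENNReal.ofReal (1 / c) * ∑' k, Z k x + ENNReal.ofReal C₁ * ∑' k, Y k x,
    ((Measurable.tsum hZm).const_mul _).add ((Measurable.tsum hYm).const_mul _),
    fun x hx k t ht => ?_, ?_⟩
  · set τ : ℝ := 4 ^ (k - (n : ℤ)) with hτ
    have hτ0 : 0 < τ := by positivity
    have hsplit : wh (k - n) g = fun z => {y | uh (k - n + 1) g y ≤ l}.indicator (wh (k - n) g) z +
        {y | l < uh (k - n + 1) g y}.indicator (wh (k - n) g) z := by
      funext z
      by_cases hz : uh (k - n + 1) g z ≤ l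
      · rw [indicator_of_mem (s := {y | uh (k - n + 1) g y ≤ l}) hz,
          indicator_of_notMem (s := {y | l < uh (k - n + 1) g y}) (not_lt.2 hz), add_zero]
      · rw [indicator_of_notMem (s := {y | uh (k - n + 1) g y ≤ l}) hz,
          indicator_of_mem (s := {y | l < uh (k - n + 1) g y}) (not_le.1 hz), zero_add]
    have hQlo : ‖Qop t τ ({y | uh (k - n + 1) g y ≤ l}.indicator (wh (k - n) g)) x‖ₑ ≤
        ENNReal.ofReal c + ENNReal.ofReal (1 / c) * ∑' k, Z k x := by
      have h1 := (hZ k x t ht).trans (ENNReal.le_tsum (f := fun k => Z k x) k)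
      refine le_trans ?_ (add_le_add le_rfl (mul_le_mul_right h1 _))
      set q := Qop t τ ({y | uh (k - n + 1) g y ≤ l}.indicator (wh (k - n) g)) x
      rw [Real.enorm_eq_ofReal_abs, ← ENNReal.ofReal_pow (abs_nonneg _),
        ← ENNReal.ofReal_mul (by positivity), ← ENNReal.ofReal_add hc.le (by positivity)]
      refine ENNReal.ofReal_le_ofReal ?_
      rcases le_total |q| c with h2 | h2
      · have : 0 ≤ 1 / c * |q| ^ 2 := by positivity
        linarith
      · have : |q| ≤ 1 / c * |q| ^ 2 := by
          rw [one_div_mul_eq_div, le_div_iff₀ hc, sq]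
          gcongr
        linarith
    have hQhi : ‖Qop t τ ({y | l < uh (k - n + 1) g y}.indicator (wh (k - n) g)) x‖ₑ ≤
        ENNReal.ofReal (C₆ * A * (2 ^ (n - J))⁻¹) + ENNReal.ofReal C₁ * ∑' k, Y k x := by
      have h1 := H₁ t τ hτ0 ({y | l < uh (k - n + 1) g y}.indicator (wh (k - n) g))
        ((h.continuous_wh _).measurable.indicator (hset' k)) x
      refine h1.trans ?_
      have hm3 := measurable_far (Ω := Ω) h.measurable (2 ^ (k + 4))
      have h2 : AH t (K * τ) (fun z =>
          ‖{y | l < uh (k - n + 1) g y}.indicator (wh (k - n) g) z‖ₑ) x ≤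
          ENNReal.ofReal (2 ^ d * 2) * (ENNReal.ofReal (2 * C₂ * (2 ^ (n - J))⁻¹) *
            ENNReal.ofReal A +
            ENNReal.ofReal (2 ^ ((d : ℝ) / 2) * ((K + 2) * (2 ^ (n - J))⁻¹)) * ENNReal.ofReal A) +
            Y k x := by
        refine (AH_mono (h.enorm_wh_indicator_le (H₂ Ω v · _ h.measurable · h.nonempty h.Hl_le)
          (hlam k)) x).trans ?_
        have hm4 : Measurable (Hl (4 ^ (k - n + 1 : ℤ) / 3)
          ({z | 2 ^ (k + 4) < infDist z Ωᶜ}.indicator v)) := measurable_Hl hm3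
        rw [AH_add (by fun_prop), AH_const_mul _ (by fun_prop), AH_add measurable_const]
        refine add_le_add (mul_le_mul_right (add_le_add ?_ ?_) _) (hY k x t ht)
        · refine (AH_le_const (by positivity) (fun _ => le_rfl) x).trans (le_of_eq ?_)
          congr 2
          rw [zpow_add_one₀ two_ne_zero, zpow_sub₀ two_ne_zero, zpow_sub₀ two_ne_zero,
            zpow_natCast, zpow_natCast, ← hJn]
          field_simp
        · rw [AH_Hl (by positivity) (by positivity) hm3]
          refine h.AH_far_le hx ht (by positivity) ?_
          have e1 : (4 : ℝ) ^ (k - n + 1 : ℤ) = 4 * τ := by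
            rw [zpow_add_one₀ (by norm_num), mul_comm]
          have e2 : τ = (4 ^ n)⁻¹ * 4 ^ k := by
            rw [hτ, zpow_sub₀ (by norm_num), zpow_natCast]; field_simp
          have e3 : ((4 : ℝ) ^ n)⁻¹ ≤ (2 ^ (n - J))⁻¹ := by
            gcongr ?_⁻¹
            calc (2 : ℝ) ^ (n - J) ≤ 2 ^ n := pow_le_pow_right₀ one_le_two (by omega)
              _ ≤ 4 ^ n := by gcongr; norm_num
          rw [e1]
          calc K * τ + 4 * τ / 3 ≤ (K + 2) * τ := by linarith
            _ = (K + 2) * (4 ^ n)⁻¹ * 4 ^ k := by rw [e2]; ring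
            _ ≤ _ := by gcongr
      refine (mul_le_mul_right h2 _).trans ?_
      have h3 : Y k x ≤ ∑' k, Y k x := ENNReal.le_tsum k
      rw [mul_add]
      refine add_le_add (le_of_eq ?_) (mul_le_mul_right h3 _)
      have := h.A_nonneg
      rw [← ENNReal.ofReal_mul (by positivity), ← ENNReal.ofReal_mul (by positivity),
        ← ENNReal.ofReal_add (by positivity) (by positivity), ← ENNReal.ofReal_mul (by positivity),
        ← ENNReal.ofReal_mul (by positivity)]
      congr 1
      rw [hC₆]; ring
    rw [hsplit, Qop_add hτ0 (hlo k) (hhi k)]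
    refine (enorm_add_le _ _).trans ((add_le_add hQlo hQhi).trans ?_)
    have := h.A_nonneg
    calc _ = ENNReal.ofReal (c + C₆ * A * (2 ^ (n - J))⁻¹) +
          (ENNReal.ofReal (1 / c) * ∑' k, Z k x + ENNReal.ofReal C₁ * ∑' k, Y k x) := by
          rw [ENNReal.ofReal_add hc.le (by positivity)]; ring
      _ ≤ _ := by
          refine add_le_add (ENNReal.ofReal_le_ofReal ?_) le_rfl
          gcongr
          have : 0 < C₄ * C₅ + C₁ * C₃ := by positivity
          linarith
  · rw [lintegral_add_left ((Measurable.tsum hZm).const_mul _),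
      lintegral_const_mul _ (Measurable.tsum hYm), lintegral_const_mul _ (Measurable.tsum hZm),
      lintegral_tsum fun k => (hYm k).aemeasurable, lintegral_tsum fun k => (hZm k).aemeasurable]
    have h1 : ∑' k, ∫⁻ x, Y k x ≤ ENNReal.ofReal C₃ * N * S := by
      refine (ENNReal.tsum_le_tsum fun k => (hYi k).trans (mul_le_mul_left
        (mul_le_mul_right (hN k) _) _)).trans ?_
      rw [ENNReal.tsum_mul_left]
      exact mul_le_mul_right hS _
    have h2 : ∑' k, ∫⁻ x, Z k x ≤ ENNReal.ofReal (C₄ * (2 ^ (n * (d - 1)))⁻¹) * N *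
        (ENNReal.ofReal (C₅ * l) * ∫⁻ z, v z) := by
      refine (ENNReal.tsum_le_tsum fun k => (hZi k).trans (mul_le_mul_left
        (mul_le_mul_right (hN k) _) _)).trans ?_
      rw [ENNReal.tsum_mul_left]
      refine mul_le_mul_right ?_ _
      refine le_trans (le_of_eq ?_) ((H₅ g 1 l h.continuous h.integrable h.nonneg h.abs_le_one
        hl).trans (mul_le_mul_right (lintegral_mono h.le) _))
      rw [← (Equiv.subRight (n : ℤ)).tsum_eq
        fun i => ∫⁻ x in {x | uh (i + 1) g x ≤ l}, ‖wh i g x‖ₑ ^ 2]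
      refine tsum_congr fun k => ?_
      rw [Equiv.subRight_apply, ← lintegral_indicator (hset k)]
      congr 1; funext y
      simp only [indicator_apply]
      split_ifs <;> simp
    refine (add_le_add (mul_le_mul_right h2 _) (mul_le_mul_right h1 _)).trans ?_
    calc _ = ENNReal.ofReal (C₄ * C₅) * N *
          (ENNReal.ofReal ((2 ^ (n * (d - 1)))⁻¹ * l / c) * ∫⁻ z, v z) +
          ENNReal.ofReal (C₁ * C₃) * N * S := by
          rw [ENNReal.ofReal_mul hC₁.le]
          have : ENNReal.ofReal (1 / c) * ENNReal.ofReal (C₄ * (2 ^ (n * (d - 1)))⁻¹) *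
              ENNReal.ofReal (C₅ * l) = ENNReal.ofReal (C₄ * C₅) *
              ENNReal.ofReal ((2 ^ (n * (d - 1)))⁻¹ * l / c) := by
            rw [← ENNReal.ofReal_mul (by positivity), ← ENNReal.ofReal_mul (by positivity),
              ← ENNReal.ofReal_mul (by positivity)]
            congr 1; ring
          rw [mul_comm (ENNReal.ofReal (C₄ * C₅)) N, mul_assoc N, ← mul_assoc (ENNReal.ofReal (C₄ * C₅)),
            ← this]
          ring
      _ ≤ ENNReal.ofReal (C₆ + C₄ * C₅ + C₁ * C₃) * N *
          (ENNReal.ofReal ((2 ^ (n * (d - 1)))⁻¹ * l / c) * ∫⁻ z, v z) +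
          ENNReal.ofReal (C₆ + C₄ * C₅ + C₁ * C₃) * N * S := by
          have : 0 < C₄ * C₅ := by positivity
          have : 0 < C₁ * C₃ := by positivity
          refine add_le_add (mul_le_mul_left (mul_le_mul_left (ENNReal.ofReal_le_ofReal ?_) _) _)
            (mul_le_mul_left (mul_le_mul_left (ENNReal.ofReal_le_ofReal ?_) _) _) <;> linarith
      _ = _ := by ring

end

section

variable {d ℓ s₀ s j : ℕ} {q B K S₀ β x : ℝ}

theorem four_pow_mul_le (hd : 1 ≤ d) (hq8 : q ^ 8 = ℓ + 1) (h1 : s₀ * (d + 1) ≤ ℓ) :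
    (4 : ℝ) ^ s₀ * 2 ^ ℓ * q ^ 16 ≤ (2 ^ (3 * (ℓ + 1))) ^ (d + 2) := by
  have e1 : (4 : ℝ) ^ s₀ ≤ 2 ^ (ℓ + 1) := by
    rw [show (4 : ℝ) = 2 ^ 2 by norm_num, ← pow_mul]
    exact pow_le_pow_right₀ one_le_two (by nlinarith)
  have e2 : q ^ 16 ≤ (2 ^ (ℓ + 1)) ^ 2 := by
    rw [show q ^ 16 = (q ^ 8) ^ 2 by ring, hq8]
    have : ((ℓ + 1 : ℕ) : ℝ) ≤ 2 ^ (ℓ + 1) := by exact_mod_cast Nat.lt_two_pow_self.le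
    push_cast at this
    gcongr
  have e3 : (2 : ℝ) ^ ℓ ≤ 2 ^ (ℓ + 1) := pow_le_pow_right₀ one_le_two (by omega)
  have hq0 : 0 ≤ q ^ 16 := by positivity
  calc (4 : ℝ) ^ s₀ * 2 ^ ℓ * q ^ 16 ≤ 2 ^ (ℓ + 1) * 2 ^ (ℓ + 1) * (2 ^ (ℓ + 1)) ^ 2 := by gcongr
    _ = 2 ^ ((ℓ + 1) * 4) := by ring
    _ ≤ _ := by
        rw [← pow_mul]
        exact pow_le_pow_right₀ one_le_two (by nlinarith)

theorem choice_below (hd : 1 ≤ d) (hq : 1 ≤ q) (hq8 : q ^ 8 = ℓ + 1) (h1 : s₀ * (d + 1) ≤ ℓ)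
    (hK : 0 < K) (hS : 0 ≤ S₀) (hβ1 : β ≤ 1)
    (hβ : β ≤ B * (3 / 2) ^ j / (2 ^ s₀ * q ^ 8)) (hx : x = 2 ^ s₀ / 2 ^ j) :
    β * x * (K * (x / 2 ^ (3 * (ℓ + 1))) ^ (d + 2) * (2 ^ ℓ * q ^ 9 * (4 / 3) ^ j) / x ^ (d + 1) +
      S₀ * (4 * q ^ 8)) ≤ (K + 4 * B * S₀) * (3 / 4) ^ j := by
  have hx0 : 0 < x := by rw [hx]; positivity
  have hq0 : 0 < q := by linarith
  have hF := four_pow_mul_le hd hq8 h1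
  have e1 : β * x * (S₀ * (4 * q ^ 8)) ≤ 4 * B * S₀ * (3 / 4) ^ j := by
    calc _ ≤ B * (3 / 2) ^ j / (2 ^ s₀ * q ^ 8) * x * (S₀ * (4 * q ^ 8)) := by gcongr
      _ = 4 * B * S₀ * ((3 / 2) ^ j / 2 ^ j) := by rw [hx]; field_simp
      _ = _ := by rw [← div_pow]; norm_num
  set P : ℝ := (2 ^ (3 * (ℓ + 1))) ^ (d + 2) with hP
  have hP0 : 0 < P := by positivity
  have e2 : β * x * (K * (x / 2 ^ (3 * (ℓ + 1))) ^ (d + 2) * (2 ^ ℓ * q ^ 9 * (4 / 3) ^ j) /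
      x ^ (d + 1)) ≤ K * (3 / 4) ^ j := by
    calc _ ≤ 1 * x * (K * (x / 2 ^ (3 * (ℓ + 1))) ^ (d + 2) * (2 ^ ℓ * q ^ 9 * (4 / 3) ^ j) /
          x ^ (d + 1)) := by gcongr
      _ = K * (x ^ 2 * (4 / 3) ^ j) * (2 ^ ℓ * q ^ 9) / P := by
          rw [div_pow, ← hP]; field_simp; ring
      _ = K * (1 / 3) ^ j * ((4 ^ s₀ * 2 ^ ℓ * q ^ 9) / P) := by
          have : x ^ 2 * (4 / 3) ^ j = 4 ^ s₀ * (1 / 3) ^ j := by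
            rw [hx, div_pow, div_pow, div_pow, ← pow_mul, ← pow_mul, mul_comm s₀, mul_comm j,
              pow_mul, pow_mul]
            norm_num
            field_simp
          rw [this]; ring
      _ ≤ K * (3 / 4) ^ j * 1 := by
          refine mul_le_mul (mul_le_mul_of_nonneg_left (pow_le_pow_left₀ (by norm_num)
            (by norm_num) j) hK.le) ((div_le_one hP0).2 (le_trans ?_ hF)) (by positivity)
            (by positivity)
          exact mul_le_mul_of_nonneg_left (pow_le_pow_right₀ hq (by norm_num)) (by positivity)
      _ = _ := mul_one _
  rw [mul_add, add_mul]
  exact add_le_add e2 e1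

theorem two_pow_le_mul (hq : 1 ≤ q) (hj : (2 : ℝ) ^ j ≤ q ^ 2) : (8 / 3 : ℝ) ^ j ≤ q ^ 3 := by
  refine (pow_le_pow_iff_left₀ (by positivity) (by positivity) two_ne_zero).1 ?_
  calc ((8 / 3 : ℝ) ^ j) ^ 2 = (64 / 9) ^ j := by rw [← pow_mul, mul_comm, pow_mul]; norm_num
    _ ≤ 8 ^ j := pow_le_pow_left₀ (by norm_num) (by norm_num) j
    _ = (2 ^ j) ^ 3 := by rw [← pow_mul, mul_comm, pow_mul]; norm_num
    _ ≤ (q ^ 2) ^ 3 := by gcongr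
    _ = _ := by ring

theorem mid_and_high_aux (hd : 1 ≤ d) (hq : 1 ≤ q) (h2 : ℓ ≤ s₀ * (d + 1) + (d + 1))
    (hB : 0 ≤ B) {l : ℝ} (hl : 0 ≤ l)
    (hβ : β ≤ B / (2 ^ s₀ * q ^ 8)) (hx : x = 2 ^ s₀ * 2 ^ j) :
    β * x * (l * (2 ^ ℓ * q ^ 9 * (4 / 3) ^ j) / x ^ (d + 1)) ≤
      B * 2 ^ (d + 1) * (l * q * (2 / 3) ^ j) := by
  have hx0 : 0 < x := by rw [hx]; positivity
  have hq0 : 0 < q := by linarith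
  have e1 : (2 : ℝ) ^ ℓ ≤ (2 ^ s₀) ^ (d + 1) * 2 ^ (d + 1) := by
    rw [← pow_mul, ← pow_add]; exact pow_le_pow_right₀ one_le_two h2
  have e2 : (2 : ℝ) ^ j ≤ (2 ^ j) ^ d := le_self_pow₀ (one_le_pow₀ one_le_two) (by omega)
  calc _ ≤ B / (2 ^ s₀ * q ^ 8) * x * (l * ((2 ^ s₀) ^ (d + 1) * 2 ^ (d + 1) * q ^ 9 *
        (4 / 3) ^ j) / x ^ (d + 1)) := by gcongr
    _ = B * 2 ^ (d + 1) * (l * q * ((4 / 3) ^ j / (2 ^ j) ^ d)) := by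
        rw [hx]; field_simp; ring
    _ ≤ B * 2 ^ (d + 1) * (l * q * ((4 / 3) ^ j / 2 ^ j)) := by gcongr
    _ = _ := by rw [← div_pow]; norm_num

theorem choice_middle (hd : 1 ≤ d) (hq : 1 ≤ q) (hq8 : q ^ 8 = ℓ + 1) (h1 : s₀ * (d + 1) ≤ ℓ)
    (h2 : ℓ ≤ s₀ * (d + 1) + (d + 1)) (hj : (2 : ℝ) ^ j ≤ q ^ 2)
    (hK : 0 < K) (hS : 0 ≤ S₀) (hB : 0 ≤ B) (hβ1 : β ≤ 1)
    (hβ : β ≤ B / (2 ^ s₀ * q ^ 8)) (hx : x = 2 ^ s₀ * 2 ^ j) :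
    β * x * ((1 / q ^ 2 + K * (x / 2 ^ (3 * (ℓ + 1))) ^ (d + 2)) *
      (2 ^ ℓ * q ^ 9 * (4 / 3) ^ j) / x ^ (d + 1) +
      S₀ * (5 * q ^ 5)) ≤ (K + B * 2 ^ (d + 1) + 5 * B * S₀) * (3 / 4) ^ j := by
  have hx0 : 0 < x := by rw [hx]; positivity
  have hq0 : 0 < q := by linarith
  have hF := four_pow_mul_le hd hq8 h1
  have h83 := two_pow_le_mul hq hj
  have e1 : β * x * (S₀ * (5 * q ^ 5)) ≤ 5 * B * S₀ * (3 / 4) ^ j := by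
    calc _ ≤ B / (2 ^ s₀ * q ^ 8) * x * (S₀ * (5 * q ^ 5)) := by gcongr
      _ = 5 * B * S₀ * ((8 / 3 * (3 / 4)) ^ j / q ^ 3) := by
          rw [hx]; norm_num; field_simp
      _ ≤ 5 * B * S₀ * (3 / 4) ^ j := by
          gcongr
          rw [mul_pow, div_le_iff₀ (by positivity), mul_comm]
          gcongr
  have e2 : β * x * (1 / q ^ 2 * (2 ^ ℓ * q ^ 9 * (4 / 3) ^ j) / x ^ (d + 1)) ≤
      B * 2 ^ (d + 1) * (3 / 4) ^ j := by
    refine (mid_and_high_aux hd hq h2 hB (by positivity) hβ hx).trans ?_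
    have : 1 / q ^ 2 * q ≤ 1 := by
      rw [one_div_mul_eq_div, div_le_one (by positivity)]; nlinarith
    have h23 : (2 / 3 : ℝ) ^ j ≤ (3 / 4) ^ j :=
      pow_le_pow_left₀ (by norm_num) (by norm_num) j
    calc _ ≤ B * 2 ^ (d + 1) * (1 * (3 / 4) ^ j) := by gcongr
      _ = _ := by ring
  set P : ℝ := (2 ^ (3 * (ℓ + 1))) ^ (d + 2) with hP
  have hP0 : 0 < P := by positivity
  have e3 : β * x * (K * (x / 2 ^ (3 * (ℓ + 1))) ^ (d + 2) * (2 ^ ℓ * q ^ 9 * (4 / 3) ^ j) /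
      x ^ (d + 1)) ≤ K * (3 / 4) ^ j := by
    calc _ ≤ 1 * x * (K * (x / 2 ^ (3 * (ℓ + 1))) ^ (d + 2) * (2 ^ ℓ * q ^ 9 * (4 / 3) ^ j) /
          x ^ (d + 1)) := by gcongr
      _ = K * (x ^ 2 * (4 / 3) ^ j) * (2 ^ ℓ * q ^ 9) / P := by
          rw [div_pow, ← hP]; field_simp; ring
      _ = K * (3 / 4) ^ j * (((8 / 3) ^ j) ^ 2 * (4 ^ s₀ * 2 ^ ℓ * q ^ 9) / P) := by
          have : x ^ 2 * (4 / 3) ^ j = 4 ^ s₀ * ((3 / 4) ^ j * ((8 / 3) ^ j) ^ 2) := by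
            rw [hx, mul_pow, ← pow_mul, ← pow_mul, ← pow_mul, mul_comm s₀, mul_comm j, pow_mul,
              pow_mul, pow_mul, mul_assoc, ← mul_pow, ← mul_pow]
            norm_num
          rw [this]; ring
      _ ≤ K * (3 / 4) ^ j * 1 := by
          gcongr
          rw [div_le_one hP0]
          refine le_trans ?_ hF
          calc _ ≤ (q ^ 3) ^ 2 * (4 ^ s₀ * 2 ^ ℓ * q ^ 9) := by gcongr
            _ = 4 ^ s₀ * 2 ^ ℓ * q ^ 15 := by ring
            _ ≤ _ := mul_le_mul_of_nonneg_left (pow_le_pow_right₀ hq (by norm_num)) (by positivity)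
      _ = _ := mul_one _
  calc _ = β * x * (K * (x / 2 ^ (3 * (ℓ + 1))) ^ (d + 2) * (2 ^ ℓ * q ^ 9 * (4 / 3) ^ j) /
      x ^ (d + 1)) + β * x * (1 / q ^ 2 * (2 ^ ℓ * q ^ 9 * (4 / 3) ^ j) / x ^ (d + 1)) +
      β * x * (S₀ * (5 * q ^ 5)) := by ring
    _ ≤ K * (3 / 4) ^ j + B * 2 ^ (d + 1) * (3 / 4) ^ j + 5 * B * S₀ * (3 / 4) ^ j := by gcongr
    _ = _ := by ring

theorem choice_above (hd : 1 ≤ d) (hq : 1 ≤ q)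
    (h2 : ℓ ≤ s₀ * (d + 1) + (d + 1)) (hj : q ^ 2 ≤ (2 : ℝ) ^ j) (hB : 0 ≤ B)
    (hβ : β ≤ B / (2 ^ s₀ * q ^ 8)) (hx : x = 2 ^ s₀ * 2 ^ j) :
    β * x * (1 * (2 ^ ℓ * q ^ 9 * (4 / 3) ^ j) / x ^ (d + 1) + 0) ≤
      B * 2 ^ (d + 1) * (19 / 20) ^ j := by
  rw [add_zero]
  refine (mid_and_high_aux hd hq h2 hB zero_le_one hβ hx).trans ?_
  rw [one_mul]
  gcongr
  refine (pow_le_pow_iff_left₀ (by positivity) (by positivity) two_ne_zero).1 ?_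
  calc (q * (2 / 3) ^ j) ^ 2 = q ^ 2 * ((2 / 3) ^ j) ^ 2 := by ring
    _ ≤ 2 ^ j * ((2 / 3) ^ j) ^ 2 := by gcongr
    _ = (8 / 9) ^ j := by rw [← pow_mul, mul_comm j, pow_mul, ← mul_pow]; norm_num
    _ ≤ ((19 / 20) ^ 2) ^ j := pow_le_pow_left₀ (by norm_num) (by norm_num) j
    _ = _ := by rw [← pow_mul, ← pow_mul, mul_comm]

end

section

/-- The dyadic logarithm governing the parameters at height `h`. -/
def lg (h : ℕ) : ℕ := Nat.log 2 (h + 16)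

/-- The eighth root of `lg h + 1`. -/
def qq (h : ℕ) : ℝ := ((lg h : ℝ) + 1) ^ (1 / 8 : ℝ)

/-- The first frequency that is treated separately at height `h`. -/
def Jh (h : ℕ) : ℕ := 3 * (lg h + 1)

/-- The shift of the critical frequency at height `h`. -/
def sh (d h : ℕ) : ℕ := lg h / (d - 1)

/-- The distance of the frequency `n` to the critical frequency at height `h`. -/
def ee (d h n : ℕ) : ℕ := (n - (h + sh d h)) + (h + sh d h - n)

/-- The reciprocal of the weight of the height `h`. -/
def Ph (h : ℕ) : ℝ := 2 ^ lg h * qq h ^ 9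

theorem four_le_lg (h : ℕ) : 4 ≤ lg h :=
  Nat.le_log_of_pow_le (by norm_num) (by omega)

theorem qq_pow (h : ℕ) : qq h ^ 8 = lg h + 1 := by
  rw [qq, ← Real.rpow_natCast, ← Real.rpow_mul (by positivity)]
  norm_num

theorem one_le_qq (h : ℕ) : 1 ≤ qq h :=
  Real.one_le_rpow (by linarith [Nat.cast_nonneg (α := ℝ) (lg h)]) (by norm_num)

theorem Ph_pos (h : ℕ) : 0 < Ph h := by
  have := one_le_qq h
  unfold Ph
  positivity

theorem Jh_add_le (h : ℕ) : (Jh h : ℝ) + 5 ≤ 4 * qq h ^ 8 := by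
  have : (4 : ℝ) ≤ lg h := by exact_mod_cast four_le_lg h
  rw [qq_pow, Jh]
  push_cast
  linarith

theorem exists_choice {d : ℕ} (hd : 3 ≤ d) {K S₀ B : ℝ} (hK : 0 < K) (hS : 0 < S₀) (hB : 0 ≤ B) :
    ∃ C, 0 < C ∧ ∀ (h n : ℕ) (β : ℝ), 0 ≤ β → β ≤ 1 →
      β ≤ B * (3 / 2) ^ (h - n) / (2 ^ sh d h * qq h ^ 8) → ∃ l S, 0 < l ∧ 0 ≤ S ∧
        (1 ≤ l ∨ K * (2 ^ n / 2 ^ h / 2 ^ Jh h) ^ d ≤ l) ∧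
        (S₀ * (Jh h + 5) ≤ S ∨ (∃ θ, 0 < θ ∧ S₀ * (θ + (Jh h + 5) / (θ * l)) ≤ S) ∨ 1 ≤ l) ∧
        β * (2 ^ n / 2 ^ h) * (l * (Ph h * (4 / 3) ^ ee d h n) / (2 ^ n / 2 ^ h) ^ (d - 1) + S) ≤
          C * (19 / 20) ^ ee d h n := by
  obtain ⟨d, rfl⟩ : ∃ e, d = e + 2 := ⟨d - 2, by omega⟩
  have hd1 : 1 ≤ d := by omega
  simp only [show d + 2 - 1 = d + 1 from rfl]
  refine ⟨(K + 4 * B * S₀) + (K + B * 2 ^ (d + 1) + 5 * B * S₀) + B * 2 ^ (d + 1),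
    by positivity, fun h n β hβ0 hβ1 hβ ↦ ?_⟩
  have hq := one_le_qq h
  have hq0 : 0 < qq h := by linarith
  have hq8 := qq_pow h
  have hJ5 := Jh_add_le h
  have h1 : sh (d + 2) h * (d + 1) ≤ lg h := Nat.div_mul_le_self _ _
  have h2 : lg h ≤ sh (d + 2) h * (d + 1) + (d + 1) := by
    have := Nat.lt_div_mul_add (a := lg h) (b := d + 1) (by omega)
    exact this.le
  have hw (j : ℕ) : (3 / 4 : ℝ) ^ j ≤ (19 / 20) ^ j :=
    pow_le_pow_left₀ (by norm_num) (by norm_num) j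
  have hx0 : (0 : ℝ) < 2 ^ n / 2 ^ h := by positivity
  rcases le_total n (h + sh (d + 2) h) with hn | hn
  · have he : ee (d + 2) h n = h + sh (d + 2) h - n := by unfold ee; omega
    rw [he]
    have hx : (2 : ℝ) ^ n / 2 ^ h = 2 ^ sh (d + 2) h / 2 ^ (h + sh (d + 2) h - n) := by
      rw [div_eq_div_iff (by positivity) (by positivity), ← pow_add, ← pow_add]
      congr 1; omega
    generalize h + sh (d + 2) h - n = j at *
    have hβ' : β ≤ B * (3 / 2) ^ j / (2 ^ sh (d + 2) h * qq h ^ 8) := by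
      refine hβ.trans ?_
      have : (3 / 2 : ℝ) ^ (h - n) ≤ (3 / 2) ^ j :=
        pow_le_pow_right₀ (by norm_num) (by unfold ee at he; omega)
      gcongr
    refine ⟨K * (2 ^ n / 2 ^ h / 2 ^ Jh h) ^ (d + 2), S₀ * (4 * qq h ^ 8), by positivity,
      by positivity, .inr le_rfl, .inl (by gcongr), ?_⟩
    refine (choice_below hd1 hq hq8 h1 hK hS.le hβ1 hβ' hx).trans ?_
    gcongr ?_ * ?_
    · have : 0 ≤ B * 2 ^ (d + 1) := by positivity
      have : 0 ≤ B * S₀ := by positivity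
      linarith
    · exact hw j
  · have he : ee (d + 2) h n = n - (h + sh (d + 2) h) := by unfold ee; omega
    rw [he]
    have hx : (2 : ℝ) ^ n / 2 ^ h = 2 ^ sh (d + 2) h * 2 ^ (n - (h + sh (d + 2) h)) := by
      rw [div_eq_iff (by positivity), ← pow_add, ← pow_add]
      congr 1; omega
    have hβ' : β ≤ B / (2 ^ sh (d + 2) h * qq h ^ 8) := by
      simpa [show h - n = 0 by omega] using hβ
    generalize n - (h + sh (d + 2) h) = j at *
    rcases le_total ((2 : ℝ) ^ j) (qq h ^ 2) with hj | hj
    · have hl : 1 / qq h ^ 2 ≤ 1 / qq h ^ 2 + K * (2 ^ n / 2 ^ h / 2 ^ Jh h) ^ (d + 2) :=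
        le_add_of_nonneg_right (by positivity)
      have hl0 : 0 < 1 / qq h ^ 2 := by positivity
      refine ⟨1 / qq h ^ 2 + K * (2 ^ n / 2 ^ h / 2 ^ Jh h) ^ (d + 2), S₀ * (5 * qq h ^ 5),
        by positivity, by positivity, .inr (le_add_of_nonneg_left hl0.le),
        .inr (.inl ⟨qq h ^ 5, by positivity, ?_⟩), ?_⟩
      · generalize 1 / qq h ^ 2 + K * (2 ^ n / 2 ^ h / 2 ^ Jh h) ^ (d + 2) = l at *
        have hlp : 0 < l := hl0.trans_le hl
        have : (Jh h + 5) / (qq h ^ 5 * l) ≤ 4 * qq h ^ 5 := by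
          rw [div_le_iff₀ (by positivity)]
          calc (Jh h : ℝ) + 5 ≤ 4 * qq h ^ 8 := hJ5
            _ = 4 * qq h ^ 5 * (qq h ^ 5 * (1 / qq h ^ 2)) := by field_simp
            _ ≤ _ := by gcongr
        gcongr
        linarith
      · refine (choice_middle hd1 hq hq8 h1 h2 hj hK hS.le hB hβ1 hβ' hx).trans ?_
        gcongr ?_ * ?_
        · have : 0 ≤ B * 2 ^ (d + 1) := by positivity
          have : 0 ≤ B * S₀ := by positivity
          linarith
        · exact hw j
    · refine ⟨1, 0, one_pos, le_rfl, .inl le_rfl, .inr (.inr le_rfl), ?_⟩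
      refine (choice_above hd1 hq h2 hj hB hβ' hx).trans ?_
      gcongr
      have : 0 ≤ B * S₀ := by positivity
      have : 0 ≤ B * 2 ^ (d + 1) := by positivity
      linarith

end

section

theorem exists_pow_le_mul_pow (m : ℕ) {b : ℝ} (hb : 1 < b) :
    ∃ C : ℝ, 0 < C ∧ ∀ r : ℕ, (2 + (r : ℝ)) ^ m ≤ C * b ^ r := by
  obtain ⟨C, hC, h⟩ := exists_pow_mul_exp_le m (Real.log_pos hb)
  refine ⟨C, hC, fun r ↦ ?_⟩
  have := h r (Nat.cast_nonneg r)
  rw [Real.exp_neg, mul_comm (Real.log b), Real.exp_nat_mul,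
    Real.exp_log (by linarith)] at this
  rwa [mul_inv_le_iff₀ (by positivity)] at this

theorem two_pow_lg_le (h : ℕ) : (2 : ℝ) ^ lg h ≤ h + 16 := by
  have : 2 ^ lg h ≤ h + 16 := Nat.pow_log_le_self 2 (by omega)
  exact_mod_cast this

theorem lg_add_one_le (h : ℕ) : (lg h : ℝ) + 1 ≤ h + 16 := by
  refine le_trans ?_ (two_pow_lg_le h)
  exact_mod_cast Nat.lt_two_pow_self

theorem exists_two_pow_Jh_le :
    ∃ C : ℝ, 0 < C ∧ ∀ h : ℕ, (2 : ℝ) ^ Jh h * (Jh h + 5) ≤ C * 2 ^ h := by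
  obtain ⟨C, hC, hb⟩ := exists_pow_le_mul_pow 4 one_lt_two
  refine ⟨32 * 8 ^ 4 * C, by positivity, fun h ↦ ?_⟩
  have h1 := Jh_add_le h
  have h2 := lg_add_one_le h
  rw [qq_pow] at h1
  have h3 : (2 : ℝ) ^ Jh h ≤ 8 * (h + 16) ^ 3 := by
    calc (2 : ℝ) ^ Jh h = 8 * (2 ^ lg h) ^ 3 := by rw [Jh, ← pow_mul]; ring
      _ ≤ _ := by gcongr; exact two_pow_lg_le h
  calc (2 : ℝ) ^ Jh h * (Jh h + 5) ≤ 8 * (h + 16) ^ 3 * (4 * (h + 16)) := by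
        gcongr; linarith
    _ = 32 * (h + 16) ^ 4 := by ring
    _ ≤ 32 * (8 * (2 + h)) ^ 4 := by gcongr; linarith [Nat.cast_nonneg (α := ℝ) h]
    _ = 32 * 8 ^ 4 * (2 + h) ^ 4 := by ring
    _ ≤ 32 * 8 ^ 4 * (C * 2 ^ h) := by gcongr; exact hb h
    _ = _ := by ring

theorem log_bounds {d h n : ℕ} (hd : 3 ≤ d) (hn16 : 16 ≤ n) (hh : h ≤ 2 * n) :
    2 ≤ n * Real.log 2 ∧
    (n * Real.log 2) ^ (-(1 / ((d : ℝ) - 1))) ≤ 8 / 2 ^ sh d h ∧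
    (Real.log (n * Real.log 2))⁻¹ ≤ 10 / qq h ^ 8 := by
  have hlg := four_le_lg h
  have hq := one_le_qq h
  have hd2 : (2 : ℝ) ≤ (d : ℝ) - 1 := by
    have : (3 : ℝ) ≤ d := by exact_mod_cast hd
    linarith
  have hlog2 : (1 / 2 : ℝ) ≤ Real.log 2 := by linarith [Real.log_two_gt_d9]
  set y : ℝ := 2 ^ lg h / 8 with hy
  have hy1 : (2 : ℝ) ≤ y := by
    rw [hy, le_div_iff₀ (by norm_num)]
    calc (2 : ℝ) * 8 = 2 ^ 4 := by norm_num
      _ ≤ _ := pow_le_pow_right₀ one_le_two hlg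
  have hL : y ≤ n * Real.log 2 := by
    have h1 := two_pow_lg_le h
    have h2 : (h : ℝ) ≤ 2 * n := by exact_mod_cast hh
    have h3 : (16 : ℝ) ≤ n := by exact_mod_cast hn16
    rw [hy]
    nlinarith
  have hLp : (0 : ℝ) < n * Real.log 2 := by linarith
  have e1 : ((n : ℝ) * Real.log 2) ^ (-(1 / ((d : ℝ) - 1))) ≤ 8 / 2 ^ sh d h := by
    rw [Real.rpow_neg hLp.le, ← inv_div (2 ^ sh d h) (8 : ℝ)]
    refine inv_anti₀ (by positivity) ?_
    rw [one_div, Real.le_rpow_inv_iff_of_pos (by positivity) hLp.le (by linarith)]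
    refine le_trans ?_ hL
    have hdc : (d : ℝ) - 1 = ((d - 1 : ℕ) : ℝ) := by
      rw [Nat.cast_sub (by omega)]; simp
    rw [hdc, Real.rpow_natCast, div_pow, ← pow_mul, hy]
    have h8 : (8 : ℝ) ≤ 8 ^ (d - 1) := le_self_pow₀ (by norm_num) (by omega)
    have h2 : (2 : ℝ) ^ (sh d h * (d - 1)) ≤ 2 ^ lg h :=
      pow_le_pow_right₀ one_le_two (Nat.div_mul_le_self _ _)
    gcongr
  have e2 : (Real.log (n * Real.log 2))⁻¹ ≤ 10 / qq h ^ 8 := by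
    have h4 : (4 : ℝ) ≤ lg h := by exact_mod_cast hlg
    have h3 : (lg h - 3 : ℝ) * Real.log 2 ≤ Real.log (n * Real.log 2) := by
      refine le_trans (le_of_eq ?_) (Real.log_le_log (by linarith) hL)
      rw [hy, Real.log_div (by positivity) (by norm_num), Real.log_pow,
        show (8 : ℝ) = 2 ^ 3 by norm_num, Real.log_pow]
      push_cast; ring
    rw [← inv_div, qq_pow]
    refine inv_anti₀ (by positivity) (le_trans ?_ h3)
    nlinarith
  exact ⟨hy1.trans hL, e1, e2⟩

theorem exists_covN_le {d : ℕ} (hd : 3 ≤ d) {E : Set ℝ} {C : ℝ}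
    (hN : ∀ k : ℤ, ∀ δ : ℝ, 0 < δ → δ ≤ Real.exp (-2) →
      (covN (Ek E k) ((2 : ℝ) ^ k * δ) : ℝ) ≤
        C * δ⁻¹ * (Real.log (1 / δ)) ^ (-(1 / ((d : ℝ) - 1))) * (Real.log (Real.log (1 / δ)))⁻¹) :
    ∃ B, 0 ≤ B ∧ ∀ (h n : ℕ) (k : ℤ), Jh h < n →
      (covN (Ek E k) ((2 : ℝ) ^ (k - (n : ℤ))) : ℝ) ≤
        2 ^ n * (B * (3 / 2) ^ (h - n) / (2 ^ sh d h * qq h ^ 8)) := by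
  obtain ⟨C₁, hC₁, hb⟩ := exists_pow_le_mul_pow 2 (b := 3 / 2) (by norm_num)
  refine ⟨80 * |C| + 64 * C₁, by positivity, fun h n k hn ↦ ?_⟩
  have hlg := four_le_lg h
  have hn16 : 16 ≤ n := by unfold Jh at hn; omega
  have hq := one_le_qq h
  have hshl : sh d h ≤ lg h := Nat.div_le_self _ _
  rcases le_or_gt h (2 * n) with hh | hh
  · have hδ : Real.log (1 / (2 ^ n)⁻¹) = n * Real.log 2 := by
      rw [one_div, inv_inv, Real.log_pow]
    obtain ⟨hL, e1, e2⟩ := log_bounds hd hn16 hh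
    have hδ2 : ((2 : ℝ) ^ n)⁻¹ ≤ Real.exp (-2) := by
      rw [← Real.log_le_iff_le_exp (by positivity), Real.log_inv, Real.log_pow]
      linarith
    have hmain := hN k _ (by positivity) hδ2
    rw [hδ, inv_inv] at hmain
    have e0 : (2 : ℝ) ^ k * (2 ^ n)⁻¹ = 2 ^ (k - (n : ℤ)) := by
      rw [zpow_sub₀ two_ne_zero, zpow_natCast, div_eq_mul_inv]
    rw [e0] at hmain
    have hL2 : 0 ≤ (Real.log (n * Real.log 2))⁻¹ := inv_nonneg.2 (Real.log_nonneg (by linarith))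
    have h32 : (1 : ℝ) ≤ (3 / 2) ^ (h - n) := one_le_pow₀ (by norm_num)
    calc _ ≤ _ := hmain
      _ ≤ |C| * 2 ^ n * (8 / 2 ^ sh d h) * (10 / qq h ^ 8) := by
          refine mul_le_mul (mul_le_mul (mul_le_mul_of_nonneg_right (le_abs_self C) ?_) e1 ?_ ?_)
            e2 hL2 ?_ <;> positivity
      _ = 2 ^ n * (80 * |C| * 1 / (2 ^ sh d h * qq h ^ 8)) := by field_simp; ring
      _ ≤ _ := by
          gcongr
          exact le_add_of_nonneg_right (by positivity)
  · have h1 : (covN (Ek E k) ((2 : ℝ) ^ (k - (n : ℤ))) : ℝ) ≤ 2 ^ n := by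
      exact_mod_cast covN_le_two_pow E k n
    refine h1.trans (le_mul_of_one_le_right (by positivity) ?_)
    rw [one_le_div (by positivity)]
    have hr : (h : ℝ) ≤ 2 * (h - n : ℕ) := by
      have : h ≤ 2 * (h - n) := by omega
      exact_mod_cast this
    calc (2 : ℝ) ^ sh d h * qq h ^ 8 ≤ (h + 16) * (h + 16) := by
          rw [qq_pow]
          exact mul_le_mul ((pow_le_pow_right₀ one_le_two hshl).trans (two_pow_lg_le h))
            (lg_add_one_le h) (by positivity) (by positivity)
      _ ≤ (8 * (2 + (h - n : ℕ))) * (8 * (2 + (h - n : ℕ))) := by gcongr <;> linarith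
      _ = 64 * (2 + (h - n : ℕ)) ^ 2 := by ring
      _ ≤ 64 * (C₁ * (3 / 2) ^ (h - n)) := by gcongr; exact hb _
      _ = 64 * C₁ * (3 / 2) ^ (h - n) := by ring
      _ ≤ _ := by gcongr; exact le_add_of_nonneg_left (by positivity)

theorem tsum_pow_ee_le (d h : ℕ) {r : ℝ} (h0 : 0 ≤ r) (h1 : r < 1) :
    ∑' n, ENNReal.ofReal (r ^ ee d h n) ≤ ENNReal.ofReal (2 / (1 - r)) := by
  set m := h + sh d h with hm
  let i : ℕ → ℕ ⊕ ℕ := fun n ↦ if m ≤ n then .inl (n - m) else .inr (m - n)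
  let g : ℕ ⊕ ℕ → ℝ≥0∞ := fun z ↦ ENNReal.ofReal (r ^ Sum.elim id id z)
  have hi : Function.Injective i := by
    intro a b hab
    simp only [i] at hab
    split_ifs at hab <;> simp at hab <;> omega
  have hgi : ∀ n, ENNReal.ofReal (r ^ ee d h n) = g (i n) := by
    intro n
    simp only [g, i, ee, ← hm]
    split_ifs with h
    · simp [show m - n = 0 by omega]
    · simp [show n - m = 0 by omega]
  have hgeo : ∑' n : ℕ, ENNReal.ofReal (r ^ n) = ENNReal.ofReal (1 / (1 - r)) := by
    rw [← ENNReal.ofReal_tsum_of_nonneg (fun n ↦ by positivity)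
      (summable_geometric_of_lt_one h0 h1), tsum_geometric_of_lt_one h0 h1, one_div]
  calc _ = ∑' n, g (i n) := tsum_congr hgi
    _ ≤ ∑' z, g z := ENNReal.tsum_comp_le_tsum_of_injective hi g
    _ = ∑' n, g (.inl n) + ∑' n, g (.inr n) :=
        (HasSum.sum ENNReal.summable.hasSum ENNReal.summable.hasSum).tsum_eq
    _ = ENNReal.ofReal (1 / (1 - r)) + ENNReal.ofReal (1 / (1 - r)) := by
        simp only [g, Sum.elim_inl, Sum.elim_inr, id, hgeo]
    _ = _ := by
        have : 0 ≤ 1 / (1 - r) := by have := sub_pos.2 h1; positivity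
        rw [← ENNReal.ofReal_add this this]; congr 1; ring

theorem summable_inv_Ph : Summable fun h ↦ (Ph h)⁻¹ := by
  let f : ℕ → ℝ := fun m ↦
    (2 ^ Nat.log 2 m * (((Nat.log 2 m : ℝ) + 1) ^ (1 / 8 : ℝ)) ^ 9)⁻¹
  suffices h : Summable f from h.comp_injective (add_left_injective 16)
  have hf0 : ∀ n, 0 ≤ f n := fun n ↦ by positivity
  rw [← summable_condensed_iff_of_nonneg hf0]
  · have : (fun k : ℕ ↦ (2 : ℝ) ^ k * f (2 ^ k)) =
        fun k : ℕ ↦ (((k + 1 : ℕ) : ℝ) ^ (9 / 8 : ℝ))⁻¹ := by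
      funext k
      simp only [f, Nat.log_pow one_lt_two]
      rw [← Real.rpow_natCast (_ ^ (1 / 8 : ℝ)) 9, ← Real.rpow_mul (by positivity)]
      push_cast
      rw [mul_inv, mul_inv_cancel_left₀ (by positivity)]
      norm_num
    rw [this]
    exact (summable_nat_add_iff 1).2 (Real.summable_nat_rpow_inv.2 (by norm_num))
  · intro m n _ hmn
    have h1 : Nat.log 2 m ≤ Nat.log 2 n := Nat.log_mono_right hmn
    simp only [f]
    refine inv_anti₀ (by positivity) ?_
    gcongr
    norm_num

end

section

variable {d : ℕ}

theorem two_pow_mul_two_pow (hd : 3 ≤ d) (h : ℕ) :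
    (2 : ℝ) ^ (h * (d - 1)) * 2 ^ h = 2 ^ (h * d) := by
  rw [← pow_add]; congr 1
  obtain ⟨e, rfl⟩ : ∃ e, d = e + 1 := ⟨d - 1, by omega⟩
  simp only [Nat.add_sub_cancel]; ring

theorem level_mul_eq (hd : 3 ≤ d) (h : ℕ) :
    (2 : ℝ) ^ (h * (d - 1)) * (2 ^ d / 2 ^ (h * d)) = 2 ^ d * (2 ^ h)⁻¹ := by
  rw [← two_pow_mul_two_pow hd h]; field_simp

theorem tsum_ite_lt_le (J : ℕ) {c : ℝ} (hc : 0 ≤ c) :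
    ∑' n : ℕ, (if J < n then ENNReal.ofReal (c * (2 ^ (n - J))⁻¹) else 0) ≤
      ENNReal.ofReal (c * 2) := by
  rw [← Summable.sum_add_tsum_nat_add' (k := J) ENNReal.summable,
    Finset.sum_eq_zero fun n hn ↦ if_neg (by simpa using (Finset.mem_range.1 hn).le), zero_add]
  have h1 (n : ℕ) : (if J < n + J then ENNReal.ofReal (c * (2 ^ (n + J - J))⁻¹) else 0) ≤
      ENNReal.ofReal (c * (1 / 2) ^ n) := by
    rw [Nat.add_sub_cancel, one_div, inv_pow]
    exact (ite_le_sup _ _ _).trans (by simp)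
  refine (ENNReal.tsum_le_tsum h1).trans (le_of_eq ?_)
  rw [← ENNReal.ofReal_tsum_of_nonneg (fun n ↦ by positivity)
    (summable_geometric_two.mul_left _), tsum_mul_left, tsum_geometric_two]

theorem exists_level_low (d : ℕ) [hd : Fact (3 ≤ d)] :
    ∃ C, 0 < C ∧ ∀ (E : Set ℝ) (h : ℕ) (Ω : Set (Ed d)) (v : Ed d → ℝ≥0∞) (g : Ed d → ℝ),
      Controlled Ω (2 ^ d / 2 ^ (h * d)) v g → ∃ G : Ed d → ℝ≥0∞, Measurable G ∧
        (∀ x ∉ Ω, ∀ k, ∀ t ∈ Ek E k, ENNReal.ofReal (2 ^ (h * (d - 1))) *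
          ‖Top t (4 ^ (k - (Jh h : ℤ))) g x‖ₑ ≤ ENNReal.ofReal (C * (2 ^ h)⁻¹) + G x) ∧
        ∫⁻ x, G x ≤ ENNReal.ofReal (C * 2 ^ (h * d)) * ∫⁻ x, v x := by
  obtain ⟨C, hC, H⟩ := exists_low d
  obtain ⟨C₁, hC₁, H₁⟩ := exists_two_pow_Jh_le
  refine ⟨C * 2 ^ d + C * C₁, by positivity, fun E h Ω v g hg ↦ ?_⟩
  obtain ⟨G, hGm, hG, hGi⟩ := H E Ω _ v g hg (Jh h) (ENNReal.ofReal (2 ^ Jh h)) fun k ↦ by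
    rw [← ENNReal.ofReal_natCast]
    refine ENNReal.ofReal_le_ofReal ?_
    exact_mod_cast covN_le_two_pow E k (Jh h)
  refine ⟨fun x ↦ ENNReal.ofReal (2 ^ (h * (d - 1))) * G x, hGm.const_mul _,
    fun x hx k t ht ↦ ?_, ?_⟩
  · refine (mul_le_mul_right (hG x hx k t ht) _).trans ?_
    rw [mul_add, ← ENNReal.ofReal_mul (by positivity)]
    refine add_le_add (ENNReal.ofReal_le_ofReal ?_) le_rfl
    rw [mul_left_comm, level_mul_eq hd.out, ← mul_assoc]
    gcongr
    exact le_add_of_nonneg_right (by positivity)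
  · rw [lintegral_const_mul _ hGm]
    refine (mul_le_mul_right hGi _).trans ?_
    rw [← ENNReal.ofReal_mul (by positivity), ← mul_assoc, ← ENNReal.ofReal_mul (by positivity)]
    refine mul_le_mul_left (ENNReal.ofReal_le_ofReal ?_) _
    calc (2 : ℝ) ^ (h * (d - 1)) * (C * (Jh h + 5) * 2 ^ Jh h)
        = C * 2 ^ (h * (d - 1)) * (2 ^ Jh h * (Jh h + 5)) := by ring
      _ ≤ C * 2 ^ (h * (d - 1)) * (C₁ * 2 ^ h) :=
          mul_le_mul_of_nonneg_left (H₁ h) (by positivity)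
      _ = C * C₁ * 2 ^ (h * d) := by rw [← two_pow_mul_two_pow hd.out]; ring
      _ ≤ _ := by gcongr; exact le_add_of_nonneg_left (by positivity)

theorem exists_level_high [hd : Fact (3 ≤ d)] {E : Set ℝ} {B : ℝ} (hB : 0 ≤ B)
    (hN : ∀ (h n : ℕ) (k : ℤ), Jh h < n → (covN (Ek E k) ((2 : ℝ) ^ (k - (n : ℤ))) : ℝ) ≤
      2 ^ n * (B * (3 / 2) ^ (h - n) / (2 ^ sh d h * qq h ^ 8))) :
    ∃ C, 0 < C ∧ ∀ (h n : ℕ) (Ω : Set (Ed d)) (v : Ed d → ℝ≥0∞) (g : Ed d → ℝ),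
      Controlled Ω (2 ^ d / 2 ^ (h * d)) v g → Jh h < n → ∃ G : Ed d → ℝ≥0∞, Measurable G ∧
        (∀ x ∉ Ω, ∀ k, ∀ t ∈ Ek E k, ENNReal.ofReal (2 ^ (h * (d - 1))) *
          ‖Qop t (4 ^ (k - (n : ℤ))) (wh (k - n) g) x‖ₑ ≤
            ENNReal.ofReal ((Ph h)⁻¹ * (3 / 4) ^ ee d h n) +
              ENNReal.ofReal (C * (2 ^ h)⁻¹ * (2 ^ (n - Jh h))⁻¹) + G x) ∧
        ∫⁻ x, G x ≤ ENNReal.ofReal (C * 2 ^ (h * d) * (19 / 20) ^ ee d h n) * ∫⁻ x, v x := by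
  obtain ⟨C, hC, H⟩ := exists_high d
  obtain ⟨C₁, hC₁, H₁⟩ := exists_tsum_lintegral_mid_le (d := d)
  obtain ⟨C₂, hC₂, H₂⟩ := exists_choice (d := d) hd.out
    (K := 6 ^ ((d : ℝ) / 2) * Real.exp (1 / 4) * 2 ^ d) (S₀ := 2 ^ d * 2 + C₁) (B := B)
    (by positivity) (by positivity) hB
  refine ⟨C * 2 ^ d + C * C₂, by positivity, fun h n Ω v g hg hn ↦ ?_⟩
  have hq := one_le_qq h
  have hP := Ph_pos h
  have hβ0 : 0 ≤ B * (3 / 2) ^ (h - n) / (2 ^ sh d h * qq h ^ 8) := by positivity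
  obtain ⟨β, hβ⟩ : ∃ β, β = min 1 (B * (3 / 2) ^ (h - n) / (2 ^ sh d h * qq h ^ 8)) := ⟨_, rfl⟩
  have hβ0 : 0 ≤ β := by rw [hβ]; exact le_min zero_le_one hβ0
  obtain ⟨l, S, hl, hS, hl', hS', hfin⟩ := H₂ h n β hβ0 (hβ ▸ min_le_left _ _)
    (hβ ▸ min_le_right _ _)
  have hcov (k : ℤ) : (covN (Ek E k) ((2 : ℝ) ^ (k - (n : ℤ))) : ℝ≥0∞) ≤
      ENNReal.ofReal (2 ^ n * β) := by
    rw [← ENNReal.ofReal_natCast]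
    refine ENNReal.ofReal_le_ofReal ?_
    rw [hβ, mul_min_of_nonneg _ _ (by positivity), mul_one]
    exact le_min (by exact_mod_cast covN_le_two_pow E k n) (hN h n k hn)
  have hlev (k : ℤ) (y : Ed d) (hy : infDist y Ωᶜ ≤ (2 : ℝ) ^ (k - (Jh h : ℤ))) :
      uh (k - n + 1) g y ≤ l := by
    rcases hl' with hl' | hl'
    · exact (hg.uh_le_one _ _).trans hl'
    · refine (hg.uh_le hn.le k hy).trans (le_trans (le_of_eq ?_) hl')
      rw [div_pow, div_pow, pow_mul, pow_mul, pow_sub₀ _ two_ne_zero hn.le, mul_pow, inv_pow]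
      field_simp
  have hmid : ∑' k : ℤ, ∫⁻ y, mid Ω v g (Jh h) n l k y ≤ ENNReal.ofReal S * ∫⁻ x, v x := by
    rcases hS' with h1 | ⟨θ, hθ, h1⟩ | h1
    · refine (hg.tsum_lintegral_mid_le (Jh h) n l).trans
        (mul_le_mul_left (ENNReal.ofReal_le_ofReal (le_trans ?_ h1)) _)
      gcongr
      exact le_add_of_nonneg_right hC₁.le
    · refine (H₁ Ω _ v g hg (Jh h) n l θ hl hθ).trans
        (mul_le_mul_left (ENNReal.ofReal_le_ofReal (le_trans ?_ h1)) _)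
      gcongr
      exact le_add_of_nonneg_left (by positivity)
    · simp [hg.mid_eq_zero (Jh h) n h1]
  set e := ee d h n with he
  set a : ℝ := 2 ^ (h * (d - 1)) with ha
  have ha0 : 0 < a := by positivity
  have hc : 0 < (Ph h)⁻¹ * a⁻¹ * (3 / 4) ^ e := by positivity
  obtain ⟨G, hGm, hG, hGi⟩ := H E Ω _ v g hg (Jh h) n l _ _ _ hn.le hl hc hlev hcov hmid
  refine ⟨fun x ↦ ENNReal.ofReal a * G x, hGm.const_mul _, fun x hx k t ht ↦ ?_, ?_⟩
  · refine (mul_le_mul_right (hG x hx k t ht) _).trans ?_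
    rw [mul_add, ← ENNReal.ofReal_mul ha0.le, ← ENNReal.ofReal_add (by positivity) (by positivity)]
    refine add_le_add (ENNReal.ofReal_le_ofReal ?_) le_rfl
    have h1 := level_mul_eq hd.out h
    rw [← ha] at h1
    calc a * ((Ph h)⁻¹ * a⁻¹ * (3 / 4) ^ e + C * (2 ^ d / 2 ^ (h * d)) * (2 ^ (n - Jh h))⁻¹)
        = (Ph h)⁻¹ * (3 / 4) ^ e * (a * a⁻¹) +
          C * (a * (2 ^ d / 2 ^ (h * d))) * (2 ^ (n - Jh h))⁻¹ := by ring
      _ = (Ph h)⁻¹ * (3 / 4) ^ e + C * 2 ^ d * (2 ^ h)⁻¹ * (2 ^ (n - Jh h))⁻¹ := by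
          rw [h1, mul_inv_cancel₀ ha0.ne']; ring
      _ ≤ _ := by gcongr; exact le_add_of_nonneg_right (by positivity)
  · rw [lintegral_const_mul _ hGm]
    refine (mul_le_mul_right hGi _).trans ?_
    rw [← add_mul, ← ENNReal.ofReal_add (by positivity) hS, ← ENNReal.ofReal_mul (by positivity),
      ← mul_assoc, ← mul_assoc, ← ENNReal.ofReal_mul (by positivity),
      ← ENNReal.ofReal_mul (by positivity)]
    refine mul_le_mul_left (ENNReal.ofReal_le_ofReal ?_) _
    have h1 := two_pow_mul_two_pow hd.out h
    rw [← ha] at h1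
    have h2 : (3 / 4 : ℝ) ^ e * (4 / 3) ^ e = 1 := by rw [← mul_pow]; norm_num
    have h3 : (4 / 3 : ℝ) ^ e = ((3 / 4) ^ e)⁻¹ := eq_inv_of_mul_eq_one_right h2
    calc a * (C * (2 ^ n * β)) * ((2 ^ (n * (d - 1)))⁻¹ * l / ((Ph h)⁻¹ * a⁻¹ * (3 / 4) ^ e) + S)
        = C * 2 ^ (h * d) * (β * (2 ^ n / 2 ^ h) *
          (l * (Ph h * (4 / 3) ^ e) / (2 ^ n / 2 ^ h) ^ (d - 1) + S)) := by
          rw [← h1, h3, div_pow (2 ^ n), ← pow_mul, ← pow_mul, ← ha]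
          field_simp
      _ ≤ C * 2 ^ (h * d) * (C₂ * (19 / 20) ^ e) := by gcongr
      _ = C * C₂ * 2 ^ (h * d) * (19 / 20) ^ e := by ring
      _ ≤ _ := by gcongr; exact le_add_of_nonneg_left (by positivity)

theorem exists_level [hd : Fact (3 ≤ d)] {E : Set ℝ} {B : ℝ} (hB : 0 ≤ B)
    (hN : ∀ (h n : ℕ) (k : ℤ), Jh h < n → (covN (Ek E k) ((2 : ℝ) ^ (k - (n : ℤ))) : ℝ) ≤
      2 ^ n * (B * (3 / 2) ^ (h - n) / (2 ^ sh d h * qq h ^ 8))) :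
    ∃ C, 0 < C ∧ ∀ (h : ℕ) (Ω : Set (Ed d)) (v : Ed d → ℝ≥0∞) (g : Ed d → ℝ),
      Controlled Ω (2 ^ d / 2 ^ (h * d)) v g → ∃ G : Ed d → ℝ≥0∞, Measurable G ∧
        (∀ x ∉ Ω, ∀ k, ∀ t ∈ Ek E k, ENNReal.ofReal (2 ^ (h * (d - 1))) *
          ‖∫ y : sphere (0 : Ed d) 1, g (x - t • (y : Ed d)) ∂(sphereProb d)‖ₑ ≤
            ENNReal.ofReal (C * ((2 ^ h)⁻¹ + (Ph h)⁻¹)) + G x) ∧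
        ∫⁻ x, G x ≤ ENNReal.ofReal (C * 2 ^ (h * d)) * ∫⁻ x, v x := by
  obtain ⟨C₁, hC₁, H₁⟩ := exists_level_low d
  obtain ⟨C₂, hC₂, H₂⟩ := exists_level_high hB hN
  refine ⟨C₁ + 40 * C₂ + 8, by positivity, fun h Ω v g hg ↦ ?_⟩
  obtain ⟨G₁, hm₁, hp₁, hi₁⟩ := H₁ E h Ω v g hg
  have H (n : ℕ) : ∃ G : Ed d → ℝ≥0∞, Measurable G ∧ (Jh h < n → ∀ x ∉ Ω, ∀ k, ∀ t ∈ Ek E k,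
      ENNReal.ofReal (2 ^ (h * (d - 1))) * ‖Qop t (4 ^ (k - (n : ℤ))) (wh (k - n) g) x‖ₑ ≤
        ENNReal.ofReal ((Ph h)⁻¹ * (3 / 4) ^ ee d h n) +
          ENNReal.ofReal (C₂ * (2 ^ h)⁻¹ * (2 ^ (n - Jh h))⁻¹) + G x) ∧
      ∫⁻ x, G x ≤ ENNReal.ofReal (C₂ * 2 ^ (h * d) * (19 / 20) ^ ee d h n) * ∫⁻ x, v x := by
    by_cases hn : Jh h < n
    · obtain ⟨G, h1, h2, h3⟩ := H₂ h n Ω v g hg hn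
      exact ⟨G, h1, fun _ ↦ h2, h3⟩
    · exact ⟨0, measurable_zero, fun h' ↦ absurd h' hn, by simp⟩
  choose G hm hp hi using H
  have hP := Ph_pos h
  refine ⟨fun x ↦ G₁ x + ∑' n, G n x, hm₁.add (Measurable.tsum hm), fun x hx k t ht ↦ ?_, ?_⟩
  · set a : ℝ≥0∞ := ENNReal.ofReal (2 ^ (h * (d - 1))) with ha
    have ha0 : a ≠ 0 := by rw [ha]; simp
    have hat : a ≠ ⊤ := by rw [ha]; exact ENNReal.ofReal_ne_top
    have hmean := enorm_mean_le hg.continuous hg.integrable hg.abs_le_one t k x (Jh h)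
      (fun n ↦ if Jh h < n then ‖Qop t (4 ^ (k - (n : ℤ))) (wh (k - n) g) x‖ₑ else 0)
      fun n hn ↦ by simp [hn]
    have hgeo := tsum_ite_lt_le (Jh h) (c := C₂ * (2 ^ h)⁻¹) (by positivity)
    have hee : ∑' n, ENNReal.ofReal ((Ph h)⁻¹ * (3 / 4) ^ ee d h n) ≤
        ENNReal.ofReal ((Ph h)⁻¹ * 8) := by
      have := tsum_pow_ee_le d h (r := 3 / 4) (by norm_num) (by norm_num)
      simp_rw [ENNReal.ofReal_mul (inv_nonneg.2 hP.le)]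
      rw [ENNReal.tsum_mul_left]
      refine mul_le_mul_right (this.trans (ENNReal.ofReal_le_ofReal (by norm_num))) _
    calc _ ≤ a * (‖Top t (4 ^ (k - (Jh h : ℤ))) g x‖ₑ + ∑' n, if Jh h < n then
          ‖Qop t (4 ^ (k - (n : ℤ))) (wh (k - n) g) x‖ₑ else 0) := mul_le_mul_right hmean _
      _ = a * ‖Top t (4 ^ (k - (Jh h : ℤ))) g x‖ₑ + ∑' n, a * (if Jh h < n then
          ‖Qop t (4 ^ (k - (n : ℤ))) (wh (k - n) g) x‖ₑ else 0) := by
          rw [mul_add, ENNReal.tsum_mul_left]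
      _ ≤ (ENNReal.ofReal (C₁ * (2 ^ h)⁻¹) + G₁ x) +
          ∑' n, (ENNReal.ofReal ((Ph h)⁻¹ * (3 / 4) ^ ee d h n) + (if Jh h < n then
            ENNReal.ofReal (C₂ * (2 ^ h)⁻¹ * (2 ^ (n - Jh h))⁻¹) else 0) + G n x) := by
          refine add_le_add (hp₁ x hx k t ht) (ENNReal.tsum_le_tsum fun n ↦ ?_)
          split_ifs with hn
          · exact hp n hn x hx k t ht
          · simp
      _ ≤ (ENNReal.ofReal (C₁ * (2 ^ h)⁻¹) + G₁ x) + (ENNReal.ofReal ((Ph h)⁻¹ * 8) +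
          ENNReal.ofReal (C₂ * (2 ^ h)⁻¹ * 2) + ∑' n, G n x) := by
          rw [ENNReal.tsum_add, ENNReal.tsum_add]
          exact add_le_add le_rfl (add_le_add (add_le_add hee hgeo) le_rfl)
      _ = ENNReal.ofReal (C₁ * (2 ^ h)⁻¹ + ((Ph h)⁻¹ * 8 + C₂ * (2 ^ h)⁻¹ * 2)) +
          (G₁ x + ∑' n, G n x) := by
          rw [ENNReal.ofReal_add (by positivity) (by positivity),
            ENNReal.ofReal_add (by positivity) (by positivity)]
          ring
      _ ≤ _ := by
          refine add_le_add (ENNReal.ofReal_le_ofReal ?_) le_rfl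
          have h1 : 0 < ((2 : ℝ) ^ h)⁻¹ := by positivity
          have h2 : 0 < (Ph h)⁻¹ := by positivity
          nlinarith [mul_pos hC₁ h2, mul_pos hC₂ h2, mul_pos hC₂ h1]
  · rw [lintegral_add_left hm₁, lintegral_tsum fun n ↦ (hm n).aemeasurable]
    have hsum : ∑' n, ∫⁻ x, G n x ≤ ENNReal.ofReal (C₂ * 2 ^ (h * d) * 40) * ∫⁻ x, v x := by
      refine (ENNReal.tsum_le_tsum hi).trans ?_
      rw [ENNReal.tsum_mul_right]
      refine mul_le_mul_left ?_ _
      have := tsum_pow_ee_le d h (r := 19 / 20) (by norm_num) (by norm_num)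
      simp_rw [ENNReal.ofReal_mul (show (0 : ℝ) ≤ C₂ * 2 ^ (h * d) by positivity)]
      rw [ENNReal.tsum_mul_left]
      refine mul_le_mul_right (this.trans (ENNReal.ofReal_le_ofReal (by norm_num))) _
    refine (add_le_add hi₁ hsum).trans ?_
    rw [← add_mul, ← ENNReal.ofReal_add (by positivity) (by positivity)]
    refine mul_le_mul_left (ENNReal.ofReal_le_ofReal ?_) _
    have : (0 : ℝ) < 2 ^ (h * d) := by positivity
    nlinarith

end

section

variable {d : ℕ}

/-- The normalised part of `F` between the consecutive heights `h` and `h + 1`. -/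
def layer (F : Ed d → ℝ) (h : ℕ) (z : Ed d) : ℝ :=
  (min (F z) (2 ^ ((h + 1) * (d - 1))) - min (F z) (2 ^ (h * (d - 1)))) / 2 ^ ((h + 1) * (d - 1))

/-- The set where `F` exceeds the height `h`. -/
def superlevel (F : Ed d → ℝ) (h : ℕ) : Set (Ed d) := {z | 2 ^ (h * (d - 1)) < F z}

theorem height_le_height (d h : ℕ) : (2 : ℝ) ^ (h * (d - 1)) ≤ 2 ^ ((h + 1) * (d - 1)) :=
  pow_le_pow_right₀ one_le_two (Nat.mul_le_mul_right _ (Nat.le_succ h))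

theorem measurableSet_superlevel {F : Ed d → ℝ} (hF : Continuous F) (h : ℕ) :
    MeasurableSet (superlevel F h) :=
  (isOpen_lt continuous_const hF).measurableSet

theorem min_add_sum_layer (F : Ed d → ℝ) (H : ℕ) (z : Ed d) :
    min (F z) 1 + ∑ h ∈ Finset.range H, 2 ^ ((h + 1) * (d - 1)) * layer F h z =
      min (F z) (2 ^ (H * (d - 1))) := by
  have h1 (h : ℕ) : 2 ^ ((h + 1) * (d - 1)) * layer F h z =
      min (F z) (2 ^ ((h + 1) * (d - 1))) - min (F z) (2 ^ (h * (d - 1))) := by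
    rw [layer, mul_div_cancel₀ _ (by positivity)]
  simp_rw [h1]
  rw [Finset.sum_range_sub (fun h ↦ min (F z) (2 ^ (h * (d - 1))))]
  simp

theorem continuous_layer {F : Ed d → ℝ} (hF : Continuous F) (h : ℕ) : Continuous (layer F h) :=
  ((hF.min continuous_const).sub (hF.min continuous_const)).div_const _

theorem layer_nonneg (F : Ed d → ℝ) (h : ℕ) (z : Ed d) : 0 ≤ layer F h z :=
  div_nonneg (sub_nonneg.2 (min_le_min le_rfl (height_le_height d h))) (by positivity)

theorem layer_le_one {F : Ed d → ℝ} (hF : ∀ z, 0 ≤ F z) (h : ℕ) (z : Ed d) : layer F h z ≤ 1 := by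
  rw [layer, div_le_one (by positivity)]
  have h1 := min_le_right (F z) (2 ^ ((h + 1) * (d - 1)))
  have h2 : 0 ≤ min (F z) (2 ^ (h * (d - 1))) := le_min (hF z) (by positivity)
  linarith

theorem layer_eq_zero {F : Ed d → ℝ} {h : ℕ} {z : Ed d} (hz : z ∉ superlevel F h) :
    layer F h z = 0 := by
  have h1 : F z ≤ 2 ^ (h * (d - 1)) := not_lt.1 hz
  rw [layer, min_eq_left h1, min_eq_left (h1.trans (height_le_height d h)), sub_self, zero_div]

theorem ofReal_layer_le {F : Ed d → ℝ} (hF : ∀ z, 0 ≤ F z) (h : ℕ) (z : Ed d) :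
    ENNReal.ofReal (layer F h z) ≤ (superlevel F h).indicator 1 z := by
  by_cases hz : z ∈ superlevel F h
  · rw [indicator_of_mem hz]
    exact ENNReal.ofReal_le_one.2 (layer_le_one hF h z)
  · simp [layer_eq_zero hz]

theorem hasCompactSupport_layer {F : Ed d → ℝ} (hF : HasCompactSupport F) (h : ℕ) :
    HasCompactSupport (layer F h) := by
  refine hF.mono fun z hz ↦ ?_
  contrapose! hz
  have h0 : F z = 0 := by simpa using hz
  have : layer F h z = 0 := layer_eq_zero (fun h' ↦ by
    have h1 : 2 ^ (h * (d - 1)) < F z := h'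
    rw [h0] at h1
    exact absurd h1 (not_lt.2 (by positivity)))
  simpa using this

theorem two_pow_le_rpow_of_mem_superlevel (hd : 3 ≤ d) {F : Ed d → ℝ} {h : ℕ} {z : Ed d}
    (hz : z ∈ superlevel F h) : (2 : ℝ) ^ (h * d) ≤ F z ^ ((d : ℝ) / ((d : ℝ) - 1)) := by
  have h1 : (2 : ℝ) ^ (h * (d - 1)) < F z := hz
  have hd' : (3 : ℝ) ≤ d := by exact_mod_cast hd
  have h2 : ((2 : ℝ) ^ (h * (d - 1))) ^ ((d : ℝ) / ((d : ℝ) - 1)) = 2 ^ (h * d) := by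
    rw [← Real.rpow_natCast, ← Real.rpow_mul two_pos.le, ← Real.rpow_natCast]
    congr 1
    have h3 : (d : ℝ) - 1 ≠ 0 := by linarith
    push_cast [Nat.cast_sub (show 1 ≤ d by omega)]
    field_simp
  rw [← h2]
  exact Real.rpow_le_rpow (by positivity) h1.le (div_nonneg (by linarith) (by linarith))

theorem sum_indicator_superlevel_le (hd : 3 ≤ d) {F : Ed d → ℝ} (hF : ∀ z, 0 ≤ F z) (H : ℕ)
    (z : Ed d) :
    ∑ h ∈ Finset.range H, (2 : ℝ) ^ ((h + 1) * d) * (superlevel F h).indicator 1 z ≤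
      2 * 2 ^ d * F z ^ ((d : ℝ) / ((d : ℝ) - 1)) := by
  have hsum (n : ℕ) : ∑ h ∈ Finset.range (n + 1), (2 : ℝ) ^ ((h + 1) * d) ≤
      2 * 2 ^ ((n + 1) * d) := by
    induction n with
    | zero => simp [two_mul]
    | succ n ih =>
      rw [Finset.sum_range_succ]
      have : (2 : ℝ) * 2 ^ ((n + 1) * d) ≤ 2 ^ ((n + 1 + 1) * d) := by
        rw [← pow_succ']
        exact pow_le_pow_right₀ one_le_two (by nlinarith)
      linarith
  induction H with
  | zero => simpa using by have := Real.rpow_nonneg (hF z) ((d : ℝ) / ((d : ℝ) - 1)); positivity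
  | succ n ih =>
    by_cases hz : z ∈ superlevel F n
    · calc _ ≤ ∑ h ∈ Finset.range (n + 1), (2 : ℝ) ^ ((h + 1) * d) := by
            refine Finset.sum_le_sum fun h _ ↦ mul_le_of_le_one_right (by positivity) ?_
            exact indicator_le_self' (fun _ _ ↦ zero_le_one) z
        _ ≤ 2 * 2 ^ ((n + 1) * d) := hsum n
        _ = 2 * 2 ^ d * 2 ^ (n * d) := by ring
        _ ≤ _ := by
            have := two_pow_le_rpow_of_mem_superlevel hd hz
            gcongr
    · rw [Finset.sum_range_succ, indicator_of_notMem hz, mul_zero, add_zero]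
      exact ih

theorem controlled_layer [hd : Fact (3 ≤ d)] {F : Ed d → ℝ} (hF : Continuous F)
    (hFc : HasCompactSupport F) (hF0 : ∀ z, 0 ≤ F z) {Ω : Set (Ed d)} (hne : Ωᶜ.Nonempty)
    (hΩ : ∀ x ∉ Ω, ∀ R, ∫⁻ z in ball x R, ENNReal.ofReal (F z ^ ((d : ℝ) / ((d : ℝ) - 1))) ≤
      volume (ball x R)) (h : ℕ) :
    Controlled Ω (2 ^ d / 2 ^ ((h + 1) * d)) ((superlevel F h).indicator 1) (layer F h) where
  nonempty := hne
  A_nonneg := by positivity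
  measurable := measurable_one.indicator (measurableSet_superlevel hF h)
  Hl_le x hx τ hτ := by
    refine Hl_indicator_le hτ (measurableSet_superlevel hF h) fun R ↦ ?_
    have h1 : ENNReal.ofReal (2 ^ (h * d)) * volume (superlevel F h ∩ ball x R) ≤
        volume (ball x R) := by
      refine le_trans ?_ (hΩ x hx R)
      rw [← setLIntegral_const]
      refine le_trans ?_ (lintegral_mono_set (inter_subset_right (s := superlevel F h)))
      refine setLIntegral_mono' ((measurableSet_superlevel hF h).inter measurableSet_ball)
        fun z hz ↦ ENNReal.ofReal_le_ofReal (two_pow_le_rpow_of_mem_superlevel hd.out hz.1)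
    have h2 : (2 : ℝ) ^ d / 2 ^ ((h + 1) * d) = (2 ^ (h * d))⁻¹ := by
      rw [Nat.succ_mul, pow_add]; field_simp
    rw [h2, ENNReal.ofReal_inv_of_pos (by positivity)]
    rw [← ENNReal.div_eq_inv_mul, ENNReal.le_div_iff_mul_le (by simp) (by simp), mul_comm]
    exact h1
  continuous := continuous_layer hF h
  integrable := (continuous_layer hF h).integrable_of_hasCompactSupport
    (hasCompactSupport_layer hFc h)
  nonneg := layer_nonneg F h
  le_one := layer_le_one hF0 h
  le := ofReal_layer_le hF0 h

theorem summable_level_error (C : ℝ) :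
    Summable fun h ↦ C * (((2 : ℝ) ^ (h + 1))⁻¹ + (Ph (h + 1))⁻¹) := by
  have h1 : Summable fun h : ℕ ↦ ((2 : ℝ) ^ h)⁻¹ := by
    simpa using summable_geometric_two
  have h2 : Summable fun h : ℕ ↦ (Ph (h + 1))⁻¹ :=
    (summable_nat_add_iff (f := fun h ↦ (Ph h)⁻¹) 1).2 summable_inv_Ph
  have h3 : Summable fun h : ℕ ↦ ((2 : ℝ) ^ (h + 1))⁻¹ :=
    (summable_nat_add_iff (f := fun h : ℕ ↦ ((2 : ℝ) ^ h)⁻¹) 1).2 h1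
  exact (h3.add h2).mul_left C

theorem exists_weak_bound [hd : Fact (3 ≤ d)] {E : Set ℝ} (hE : E ⊆ Ioi 0) {B : ℝ} (hB : 0 ≤ B)
    (hN : ∀ (h n : ℕ) (k : ℤ), Jh h < n → (covN (Ek E k) ((2 : ℝ) ^ (k - (n : ℤ))) : ℝ) ≤
      2 ^ n * (B * (3 / 2) ^ (h - n) / (2 ^ sh d h * qq h ^ 8))) :
    ∃ C, 0 < C ∧ ∀ F : Ed d → ℝ, Continuous F → HasCompactSupport F → (∀ z, 0 ≤ F z) →
      volume {x | ∃ t ∈ E, ENNReal.ofReal C <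
        ‖∫ y : sphere (0 : Ed d) 1, F (x - t • (y : Ed d)) ∂(sphereProb d)‖ₑ} ≤
      ENNReal.ofReal C * ∫⁻ z, ENNReal.ofReal (F z ^ ((d : ℝ) / ((d : ℝ) - 1))) := by
  obtain ⟨C, hC, H⟩ := exists_level hB hN
  obtain ⟨e, he⟩ : ∃ e : ℕ → ℝ, ∀ h, e h = C * (((2 : ℝ) ^ (h + 1))⁻¹ + (Ph (h + 1))⁻¹) :=
    ⟨_, fun _ ↦ rfl⟩
  have hsm : Summable e := (summable_level_error C).congr fun h ↦ (he h).symm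
  have hterm (h : ℕ) : 0 ≤ e h := by
    rw [he]
    exact mul_nonneg hC.le (add_nonneg (by positivity) (inv_nonneg.2 (Ph_pos _).le))
  have H' (h : ℕ) := H (h + 1)
  simp_rw [← he] at H'
  clear H he
  obtain ⟨K, hK⟩ : ∃ K, K = ∑' h, e h := ⟨_, rfl⟩
  have hK0 : 0 ≤ K := hK ▸ tsum_nonneg hterm
  refine ⟨(K + 2) + (5 ^ d + C * (2 * 2 ^ d)), by positivity, fun F hF hFc hF0 ↦ ?_⟩
  set p : ℝ := (d : ℝ) / ((d : ℝ) - 1) with hp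
  have hd' : (3 : ℝ) ≤ d := by exact_mod_cast hd.out
  have hp0 : 0 < p := div_pos (by linarith) (by linarith)
  have hFp : Continuous fun z ↦ F z ^ p := hF.rpow_const fun _ ↦ .inr hp0.le
  have hFpc : HasCompactSupport fun z ↦ F z ^ p :=
    hFc.comp_left (g := fun r : ℝ ↦ r ^ p) (Real.zero_rpow hp0.ne')
  have hφt : ∫⁻ z, ENNReal.ofReal (F z ^ p) ≠ ⊤ :=
    (hFp.integrable_of_hasCompactSupport hFpc).lintegral_lt_top.ne
  obtain ⟨Ω, -, hΩv, hΩ⟩ := exists_exceptional hφt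
  have hne : Ωᶜ.Nonempty := by
    rw [nonempty_compl]
    rintro rfl
    refine absurd hΩv (not_le.2 ?_)
    have : Nonempty (Fin d) := ⟨⟨0, by have := hd.out; omega⟩⟩
    rw [measure_univ_of_isAddLeftInvariant]
    exact (ENNReal.mul_ne_top ENNReal.ofReal_ne_top hφt).lt_top
  choose G hGm hG hGi using fun h ↦ H' h Ω _ _ (controlled_layer hF hFc hF0 hne hΩ h)
  obtain ⟨M, hM⟩ := hF.bounded_above_of_compact_support hFc
  obtain ⟨L, hL⟩ := pow_unbounded_of_one_lt M one_lt_two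
  have hML (z : Ed d) : F z ≤ 2 ^ (L * (d - 1)) := by
    refine ((le_abs_self _).trans (hM z)).trans (hL.le.trans ?_)
    exact pow_le_pow_right₀ one_le_two (Nat.le_mul_of_pos_right _ (by have := hd.out; omega))
  have hdec (z : Ed d) :
      F z = min (F z) 1 + ∑ h ∈ Finset.range L, 2 ^ ((h + 1) * (d - 1)) * layer F h z := by
    rw [min_add_sum_layer, min_eq_left (hML z)]
  have hpt (x : Ed d) (hx : x ∉ Ω) (t : ℝ) (ht : t ∈ E) :
      ‖∫ y : sphere (0 : Ed d) 1, F (x - t • (y : Ed d)) ∂(sphereProb d)‖ₑ ≤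
        ENNReal.ofReal (K + 1) + ∑ h ∈ Finset.range L, G h x := by
    obtain ⟨k, hk⟩ := exists_mem_Ico_zpow (hE ht) (one_lt_two (α := ℝ))
    have htk : t ∈ Ek E k := ⟨ht, hk⟩
    have e1 : ∫ y : sphere (0 : Ed d) 1, F (x - t • (y : Ed d)) ∂(sphereProb d) =
        ∫ y : sphere (0 : Ed d) 1, min (F (x - t • (y : Ed d))) 1 ∂(sphereProb d) +
        ∑ h ∈ Finset.range L, 2 ^ ((h + 1) * (d - 1)) *
          ∫ y : sphere (0 : Ed d) 1, layer F h (x - t • (y : Ed d)) ∂(sphereProb d) := by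
      have hi (h : ℕ) := integrable_sphere (continuous_layer hF h) x t
      rw [integral_congr_ae (.of_forall fun y ↦ hdec _), integral_add
        (integrable_sphere (f := fun z ↦ min (F z) 1) (hF.min continuous_const) x t)
        (integrable_finsetSum _ fun h _ ↦ (hi h).const_mul _),
        integral_finsetSum _ fun h _ ↦ (hi h).const_mul _]
      simp_rw [integral_const_mul]
    have e2 : ‖∫ y : sphere (0 : Ed d) 1, min (F (x - t • (y : Ed d))) 1 ∂(sphereProb d)‖ₑ ≤
        ENNReal.ofReal 1 := by
      rw [← ofReal_norm]
      refine ENNReal.ofReal_le_ofReal ((norm_integral_le_of_norm_le_const (C := 1)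
        (.of_forall fun y ↦ ?_)).trans_eq (by simp))
      rw [Real.norm_of_nonneg (le_min (hF0 _) zero_le_one)]
      exact min_le_right _ _
    have e3 : ∑ h ∈ Finset.range L,
        ENNReal.ofReal (e h) ≤ ENNReal.ofReal K := by
      rw [← ENNReal.ofReal_sum_of_nonneg fun h _ ↦ hterm h]
      exact ENNReal.ofReal_le_ofReal (hK ▸ hsm.sum_le_tsum _ fun h _ ↦ hterm h)
    rw [e1]
    refine (enorm_add_le _ _).trans ?_
    calc _ ≤ ENNReal.ofReal 1 + ∑ h ∈ Finset.range L,
          (ENNReal.ofReal (e h) + G h x) := by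
          refine add_le_add e2 ((enorm_sum_le _ _).trans (Finset.sum_le_sum fun h _ ↦ ?_))
          rw [enorm_mul, Real.enorm_of_nonneg (by positivity)]
          exact hG h x hx k t htk
      _ ≤ ENNReal.ofReal 1 + (ENNReal.ofReal K + ∑ h ∈ Finset.range L, G h x) := by
          rw [Finset.sum_add_distrib]
          exact add_le_add le_rfl (add_le_add e3 le_rfl)
      _ = _ := by rw [ENNReal.ofReal_add hK0 zero_le_one]; ring
  have hsub : {x | ∃ t ∈ E, ENNReal.ofReal (K + 2 + (5 ^ d + C * (2 * 2 ^ d))) <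
      ‖∫ y : sphere (0 : Ed d) 1, F (x - t • (y : Ed d)) ∂(sphereProb d)‖ₑ} ⊆
      Ω ∪ {x | 1 ≤ ∑ h ∈ Finset.range L, G h x} := by
    rintro x ⟨t, ht, hxt⟩
    by_cases hx : x ∈ Ω
    · exact .inl hx
    · refine .inr (show 1 ≤ ∑ h ∈ Finset.range L, G h x from ?_)
      by_contra! hlt
      refine absurd hxt (not_lt.2 ((hpt x hx t ht).trans ((add_le_add le_rfl hlt.le).trans ?_)))
      rw [← ENNReal.ofReal_one, ← ENNReal.ofReal_add (by positivity) zero_le_one]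
      refine ENNReal.ofReal_le_ofReal ?_
      have : (0 : ℝ) ≤ 5 ^ d + C * (2 * 2 ^ d) := by positivity
      linarith
  have hGs : Measurable fun x ↦ ∑ h ∈ Finset.range L, G h x :=
    Finset.measurable_fun_sum _ fun h _ ↦ hGm h
  have hGsum : ∫⁻ x, ∑ h ∈ Finset.range L, G h x ≤
      ENNReal.ofReal (C * (2 * 2 ^ d)) * ∫⁻ z, ENNReal.ofReal (F z ^ p) := by
    have hmI (h : ℕ) : Measurable ((superlevel F h).indicator (1 : Ed d → ℝ≥0∞)) :=
      measurable_one.indicator (measurableSet_superlevel hF h)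
    rw [lintegral_finsetSum _ fun h _ ↦ hGm h]
    refine (Finset.sum_le_sum fun h _ ↦ hGi h).trans ?_
    simp_rw [← lintegral_const_mul _ (hmI _)]
    rw [← lintegral_finsetSum _ fun h _ ↦ (hmI h).const_mul _, ← lintegral_const_mul _
      (hFp.measurable.ennreal_ofReal)]
    refine lintegral_mono fun z ↦ ?_
    have h1 := sum_indicator_superlevel_le hd.out hF0 L z
    have h2 (h : ℕ) : ENNReal.ofReal (C * 2 ^ ((h + 1) * d)) * (superlevel F h).indicator 1 z =
        ENNReal.ofReal (C * (2 ^ ((h + 1) * d) * (superlevel F h).indicator 1 z)) := by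
      by_cases hz : z ∈ superlevel F h <;> simp [hz]
    simp_rw [h2]
    have h3 (h : ℕ) : 0 ≤ C * (2 ^ ((h + 1) * d) * (superlevel F h).indicator 1 z) :=
      mul_nonneg hC.le (mul_nonneg (by positivity) (indicator_nonneg (fun _ _ ↦ zero_le_one) z))
    rw [← ENNReal.ofReal_sum_of_nonneg fun h _ ↦ h3 h, ← Finset.mul_sum,
      ← ENNReal.ofReal_mul (by positivity), mul_assoc C]
    exact ENNReal.ofReal_le_ofReal (mul_le_mul_of_nonneg_left h1 hC.le)
  refine (measure_mono hsub).trans ((measure_union_le _ _).trans ?_)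
  have hcheb : volume {x | 1 ≤ ∑ h ∈ Finset.range L, G h x} ≤
      ∫⁻ x, ∑ h ∈ Finset.range L, G h x := by
    simpa using mul_meas_ge_le_lintegral hGs 1 (μ := volume)
  refine (add_le_add hΩv (hcheb.trans hGsum)).trans ?_
  rw [← add_mul, ← ENNReal.ofReal_add (by positivity) (by positivity)]
  refine mul_le_mul_left (ENNReal.ofReal_le_ofReal ?_) _
  linarith

theorem weakTypePP_of_covN_le [hd : Fact (3 ≤ d)] {E : Set ℝ} (hE : E ⊆ Ioi 0) {C : ℝ}
    (hN : ∀ k : ℤ, ∀ δ : ℝ, 0 < δ → δ ≤ Real.exp (-2) →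
      (covN (Ek E k) ((2 : ℝ) ^ k * δ) : ℝ) ≤
        C * δ⁻¹ * (Real.log (1 / δ)) ^ (-(1 / ((d : ℝ) - 1))) * (Real.log (Real.log (1 / δ)))⁻¹) :
    WeakTypePP d E ((d : ℝ) / ((d : ℝ) - 1)) := by
  obtain ⟨B, hB, hN'⟩ := exists_covN_le hd.out hN
  obtain ⟨C₀, hC₀, H⟩ := exists_weak_bound hE hB hN'
  have hd' : (3 : ℝ) ≤ d := by exact_mod_cast hd.out
  have hp0 : 0 < (d : ℝ) / ((d : ℝ) - 1) := div_pos (by linarith) (by linarith)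
  generalize (d : ℝ) / ((d : ℝ) - 1) = p at *
  refine ⟨C₀ * C₀ ^ p, fun f hf hfc a ha ↦ ?_⟩
  have hr : 0 < C₀ / a := by positivity
  have hF : Continuous fun z ↦ C₀ / a * ‖f z‖ := hf.norm.const_mul _
  have hFc : HasCompactSupport fun z ↦ C₀ / a * ‖f z‖ := hfc.norm.mul_left
  have hFp : Continuous fun z ↦ ‖f z‖ ^ p := hf.norm.rpow_const fun _ ↦ .inr hp0.le
  have hFpc : HasCompactSupport fun z ↦ ‖f z‖ ^ p :=
    hfc.norm.comp_left (g := fun r : ℝ ↦ r ^ p) (Real.zero_rpow hp0.ne')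
  have h := H _ hF hFc fun z ↦ by positivity
  have hsub : {x | ENNReal.ofReal a < maxFn d E f x} ⊆ {x | ∃ t ∈ E, ENNReal.ofReal C₀ <
      ‖∫ y : sphere (0 : Ed d) 1, C₀ / a * ‖f (x - t • (y : Ed d))‖ ∂(sphereProb d)‖ₑ} := by
    intro x hx
    have hx' : ENNReal.ofReal a < ⨆ t ∈ E, (‖sphMean d t f x‖₊ : ℝ≥0∞) := hx
    simp only [lt_iSup_iff] at hx'
    obtain ⟨t, ht, hxt⟩ := hx'
    refine ⟨t, ht, ?_⟩
    have h0 : 0 ≤ ∫ y : sphere (0 : Ed d) 1, ‖f (x - t • (y : Ed d))‖ ∂(sphereProb d) :=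
      integral_nonneg fun _ ↦ norm_nonneg _
    have h1 : a < ‖sphMean d t f x‖ := by
      rw [← enorm_eq_nnnorm, ← ofReal_norm] at hxt
      exact (ENNReal.ofReal_lt_ofReal_iff_of_nonneg ha.le).1 hxt
    have h2 : a < ∫ y : sphere (0 : Ed d) 1, ‖f (x - t • (y : Ed d))‖ ∂(sphereProb d) :=
      h1.trans_le (norm_integral_le_integral_norm _)
    rw [integral_const_mul, Real.enorm_of_nonneg (by positivity)]
    refine (ENNReal.ofReal_lt_ofReal_iff_of_nonneg hC₀.le).2 ?_
    calc C₀ = C₀ / a * a := by field_simp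
      _ < _ := by gcongr
  refine (measure_mono hsub).trans (h.trans (le_of_eq ?_))
  have h3 (z : Ed d) : (C₀ / a * ‖f z‖) ^ p = C₀ ^ p * a ^ (-p) * ‖f z‖ ^ p := by
    rw [Real.mul_rpow hr.le (norm_nonneg _), Real.div_rpow hC₀.le ha.le, Real.rpow_neg ha.le]
    ring
  simp_rw [h3]
  have h4 : 0 ≤ C₀ ^ p * a ^ (-p) := by positivity
  rw [← ofReal_integral_eq_lintegral_ofReal
    ((hFp.integrable_of_hasCompactSupport hFpc).const_mul _) (.of_forall fun z ↦ by positivity),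
    integral_const_mul, ← ENNReal.ofReal_mul hC₀.le]
  congr 1; ring

end

end SphMax

/-- Theorem IV: for `d ≥ 3`, `p_d = d/(d-1)`, the regularity hypothesis `(R̃_{p_d})`
together with the entropy bound
`N(E^k, 2^k δ) ≤ C δ^{-1} (log(1/δ))^{-1/(d-1)} (log log(1/δ))^{-1}` implies that
`M_E` is of weak type `(p_d,p_d)`. -/
theorem spherical_maximal_weaktype_limiting (d : ℕ) (hd : 3 ≤ d)
    (E : Set ℝ) (hE : E ⊆ Set.Ioi (0:ℝ))
    (hreg : RegHypTilde E d ((d:ℝ) / ((d:ℝ) - 1)))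
    (C : ℝ)
    (hN : ∀ k : ℤ, ∀ δ : ℝ, 0 < δ → δ ≤ Real.exp (-2) →
      (covN (Ek E k) ((2:ℝ) ^ k * δ) : ℝ) ≤
        C * δ⁻¹ * (Real.log (1/δ)) ^ (-(1 / ((d:ℝ) - 1))) *
          (Real.log (Real.log (1/δ)))⁻¹) :
    WeakTypePP d E ((d:ℝ) / ((d:ℝ) - 1)) := by
  have : Fact (3 ≤ d) := ⟨hd⟩
  exact SphMax.weakTypePP_of_covN_le hE hN
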